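/- arXiv:1601.07814 — 5 statements merged into one kernel-verified Lean document; each statement's English description precedes it below -/
import Mathlib

section
/- Let n ≥ 3, let 𝒰 ⊆ ℝⁿ be open, and let Q : 𝒰 → (real symmetric n×n matrices) be continuously differentiable with Q(x) of signature (n−1,1) for every x (i.e. n−1 positive eigenvalues and one negative eigenvalue). Let φ₊, φ₋ : 𝒰 → ℝ be C² with dφ₊(x) ≠ 0 whenever φ₊(x)=0, dφ₋(x) ≠ 0 whenever φ₋(x)=0, and dφ₊(x), dφ₋(x) linearly independent whenever φ₊(x)=φ₋(x)=0. Set Ω = {x ∈ 𝒰 : φ₊(x) > 0 and φ₋(x) > 0}, Σ_± = {x ∈ 𝒰 : φ_±(x) = 0}. Assume both hypersurfaces are characteristic: ⟨Q(x)dφ₊(x), dφ₊(x)⟩ = 0 for all x ∈ Σ₊ and ⟨Q(x)dφ₋(x), dφ₋(x)⟩ = 0 for all x ∈ Σ₋, and assume the sign condition ⟨Q(x)dφ₊(x), dφ₋(x)⟩ > 0 for all x ∈ Σ₊ ∩ Σ₋. Let u : 𝒰 → ℝ be C², vanishing on the boundary ∂Ω, such that there exists C ≥ 0 with |∑_{j,k=1}^n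 Q_{jk}(x) ∂_j∂_k u(x)| ≤ C(|∇u(x)| + |u(x)|) for all x ∈ Ω. Then there is an open set V containing Σ₊ ∩ Σ₋ such that u vanishes on Ω ∩ V. -/
open Matrix

namespace UC
variable {n : ℕ}

/-- partial derivative -/
noncomputable def pd (j : Fin n) (f : (Fin n → ℝ) → ℝ) (x : Fin n → ℝ) : ℝ :=
  fderiv ℝ f x (Pi.single j 1)

lemma pd_add {j : Fin n} {f g : (Fin n → ℝ) → ℝ} {x : Fin n → ℝ}
    (hf : DifferentiableAt ℝ f x) (hg : DifferentiableAt ℝ g x) :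
    pd j (fun y => f y + g y) x = pd j f x + pd j g x := by
  simp [pd, fderiv_fun_add hf hg]

lemma pd_sub {j : Fin n} {f g : (Fin n → ℝ) → ℝ} {x : Fin n → ℝ}
    (hf : DifferentiableAt ℝ f x) (hg : DifferentiableAt ℝ g x) :
    pd j (fun y => f y - g y) x = pd j f x - pd j g x := by
  simp [pd, fderiv_fun_sub hf hg]

lemma pd_mul {j : Fin n} {f g : (Fin n → ℝ) → ℝ} {x : Fin n → ℝ}
    (hf : DifferentiableAt ℝ f x) (hg : DifferentiableAt ℝ g x) :
    pd j (fun y => f y * g y) x = pd j f x * g x + f x * pd j g x := by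
  simp [pd, fderiv_fun_mul hf hg]; ring

lemma pd_const_mul {j : Fin n} {f : (Fin n → ℝ) → ℝ} {x : Fin n → ℝ} (c : ℝ)
    (hf : DifferentiableAt ℝ f x) :
    pd j (fun y => c * f y) x = c * pd j f x := by
  simp [pd, fderiv_const_mul hf]

lemma pd_const {j : Fin n} {x : Fin n → ℝ} (c : ℝ) :
    pd j (fun _ => c) x = 0 := by
  simp [pd]

lemma pd_sum {j : Fin n} {f : Fin n → (Fin n → ℝ) → ℝ} {x : Fin n → ℝ}
    (hf : ∀ i, DifferentiableAt ℝ (f i) x) :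
    pd j (fun y => ∑ i, f i y) x = ∑ i, pd j (f i) x := by
  simp [pd, fderiv_fun_sum (fun i _ => hf i)]

lemma pd_comp {j : Fin n} {f : (Fin n → ℝ) → ℝ} {x : Fin n → ℝ} {g : ℝ → ℝ}
    (hg : DifferentiableAt ℝ g (f x)) (hf : DifferentiableAt ℝ f x) :
    pd j (fun y => g (f y)) x = deriv g (f x) * pd j f x := by
  have := (hg.hasDerivAt.comp_hasFDerivAt x hf.hasFDerivAt).fderiv
  unfold pd
  rw [show (fun y => g (f y)) = g ∘ f from rfl, this]; simp

lemma pd_congr {j : Fin n} {f g : (Fin n → ℝ) → ℝ} {x : Fin n → ℝ}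
    (h : f =ᶠ[nhds x] g) : pd j f x = pd j g x := by
  simp [pd, h.fderiv_eq]

lemma pd_congr' {j : Fin n} {f g : (Fin n → ℝ) → ℝ} {x : Fin n → ℝ}
    (h : f =ᶠ[nhds x] g) : pd j f =ᶠ[nhds x] pd j g := by
  filter_upwards [h.eventuallyEq_nhds] with y hy using pd_congr hy

lemma contDiff_pd {j : Fin n} {f : (Fin n → ℝ) → ℝ} (hf : ContDiff ℝ 2 f) :
    ContDiff ℝ 1 (pd j f) := by
  unfold pd
  exact (hf.fderiv_right (m := 1) (by norm_num)).clm_apply contDiff_const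

lemma continuous_pd {j : Fin n} {f : (Fin n → ℝ) → ℝ} (hf : ContDiff ℝ 1 f) :
    Continuous (pd j f) := by
  unfold pd
  exact (hf.continuous_fderiv (by norm_num)).clm_apply continuous_const

lemma pd_pd {j k : Fin n} {f : (Fin n → ℝ) → ℝ} (hf : ContDiff ℝ 2 f) (x : Fin n → ℝ) :
    pd j (pd k f) x = fderiv ℝ (fderiv ℝ f) x (Pi.single j 1) (Pi.single k 1) := by
  have h1 : DifferentiableAt ℝ (fderiv ℝ f) x :=
    ((hf.fderiv_right (m := 1) (by norm_num)).differentiable (by norm_num)) x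
  unfold pd
  rw [fderiv_clm_apply h1 (by fun_prop)]
  simp

lemma pd_comm {j k : Fin n} {f : (Fin n → ℝ) → ℝ} (hf : ContDiff ℝ 2 f) (x : Fin n → ℝ) :
    pd j (pd k f) x = pd k (pd j f) x := by
  rw [pd_pd hf, pd_pd hf]
  exact (hf.contDiffAt.isSymmSndFDerivAt (by simp)) _ _

/-- integral of a partial derivative of a compactly supported function -/
lemma integral_pd {j : Fin n} {f : (Fin n → ℝ) → ℝ} (hf : ContDiff ℝ 1 f)
    (hc : HasCompactSupport f) : ∫ x, pd j f x = 0 := by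
  have hcd : HasCompactSupport (pd j f) := by
    unfold pd
    exact hc.fderiv_apply (𝕜 := ℝ) _
  obtain ⟨R, hR⟩ := hc.isCompact.isBounded.subset_closedBall (0 : Fin n → ℝ)
  let χ : ContDiffBump (0 : Fin n → ℝ) := ⟨|R| + 1, |R| + 2, by positivity, by linarith⟩
  have hone : ∀ x ∈ tsupport f, (χ : (Fin n → ℝ) → ℝ) =ᶠ[nhds x] fun _ => 1 := by
    intro x hx
    have := hR hx
    have h2 : x ∈ Metric.ball (0 : Fin n → ℝ) (|R| + 1) := by
      simp at this ⊢; linarith [le_abs_self R]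
    filter_upwards [Metric.isOpen_ball.mem_nhds h2] with y hy
    exact χ.one_of_mem_closedBall (Metric.ball_subset_closedBall hy)
  have key := integral_mul_fderiv_eq_neg_fderiv_mul_of_integrable (μ := MeasureTheory.volume)
    (𝕜 := ℝ) (f := (χ : (Fin n → ℝ) → ℝ)) (g := f) (v := Pi.single j 1) ?_ ?_ ?_ 
    (fun x _ => (χ.contDiff.differentiable (n := 1) (by norm_num)) x)
    (fun x _ => (hf.differentiable (by norm_num)) x)
  · have e1 : ∀ x, χ x * fderiv ℝ f x (Pi.single j 1) = pd j f x := by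
      intro x
      by_cases hx : x ∈ tsupport f
      · rw [(hone x hx).eq_of_nhds]; simp [pd]
      · have : f =ᶠ[nhds x] 0 := notMem_tsupport_iff_eventuallyEq.mp hx
        have h0 : fderiv ℝ f x = 0 := by rw [this.fderiv_eq]; simp
        simp [pd, h0]
    have e2 : ∀ x, fderiv ℝ (χ : (Fin n → ℝ) → ℝ) x (Pi.single j 1) * f x = 0 := by
      intro x
      by_cases hx : x ∈ tsupport f
      · rw [(hone x hx).fderiv_eq]; simp
      · rw [image_eq_zero_of_notMem_tsupport hx]; simp
    simpa [e1, e2] using key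
  · have : Continuous fun x => fderiv ℝ (χ : (Fin n → ℝ) → ℝ) x (Pi.single j 1) * f x :=
      (((χ.contDiff (n := 1)).continuous_fderiv (by norm_num)).clm_apply continuous_const).mul hf.continuous
    exact this.integrable_of_hasCompactSupport hc.mul_left
  · have : Continuous fun x => χ x * fderiv ℝ f x (Pi.single j 1) :=
      χ.continuous.mul (continuous_pd hf)
    exact this.integrable_of_hasCompactSupport hcd.mul_left
  · exact (χ.continuous.mul hf.continuous).integrable_of_hasCompactSupport hc.mul_left

end UC

namespace UC
variable {n : ℕ}

/-- second-order terms cancel -/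
lemma alg_T (Q : Fin n → Fin n → ℝ) (hQ : ∀ j k, Q j k = Q k j)
    (dQ : Fin n → Fin n → Fin n → ℝ) (DXm : Fin n → Fin n → ℝ) (X v : Fin n → ℝ) (vv : Fin n → Fin n → ℝ)
    (hv : ∀ j k, vv j k = vv k j) :
    ∑ j, (2 * (∑ l, (DXm j l * v l + X l * vv j l)) * (∑ k, Q j k * v k)
      - X j * ∑ l, ((∑ m, (dQ j l m * v m + Q l m * vv j m)) * v l + (∑ m, Q l m * v m) * vv j l))
    = ∑ j, (2 * (∑ k, Q j k * v k) * (∑ l, DXm j l * v l)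
      - X j * ∑ l, ∑ m, dQ j l m * v m * v l) := by
  set Y : Fin n → ℝ := fun j => ∑ k, Q j k * v k with hY
  have h1 : ∀ j, ∑ l, (∑ m, Q l m * vv j m) * v l = ∑ l, Y l * vv j l := by
    intro j
    simp only [hY, Finset.sum_mul]
    rw [Finset.sum_comm]
    refine Finset.sum_congr rfl fun l _ => Finset.sum_congr rfl fun m _ => ?_
    rw [hQ m l]; ring
  have h2 : ∑ j, ∑ l, X l * vv j l * Y j = ∑ j, ∑ l, X j * (Y l * vv j l) := by
    rw [Finset.sum_comm]
    refine Finset.sum_congr rfl fun l _ => Finset.sum_congr rfl fun m _ => ?_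
    rw [hv m l]; ring
  have h3 : ∀ j, (2 * (∑ l, (DXm j l * v l + X l * vv j l)) * Y j
      - X j * ∑ l, ((∑ m, (dQ j l m * v m + Q l m * vv j m)) * v l + Y l * vv j l))
      = (2 * Y j * (∑ l, DXm j l * v l)
      - X j * ∑ l, ∑ m, dQ j l m * v m * v l) + 2 * (∑ l, X l * vv j l * Y j)
       - 2 * ∑ l, X j * (Y l * vv j l) := by
    intro j
    have := h1 j
    have h4 : ∑ l, (∑ m, dQ j l m * v m) * v l = ∑ l, ∑ m, dQ j l m * v m * v l := by
      simp only [Finset.sum_mul]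
    simp only [Finset.sum_add_distrib, add_mul] at this ⊢
    rw [this, ← Finset.sum_mul, ← Finset.mul_sum, h4]
    ring
  calc _ = ∑ j, ((2 * Y j * (∑ l, DXm j l * v l)
      - X j * ∑ l, ∑ m, dQ j l m * v m * v l) + 2 * (∑ l, X l * vv j l * Y j)
       - 2 * ∑ l, X j * (Y l * vv j l)) := Finset.sum_congr rfl fun j _ => h3 j
    _ = _ := by
      rw [Finset.sum_sub_distrib, Finset.sum_add_distrib, ← Finset.mul_sum, ← Finset.mul_sum, h2]
      ring
end UC

namespace UC
variable {n : ℕ}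

/-- `(Q ∇f)_j` -/
noncomputable def Xf (Q : (Fin n → ℝ) → Fin n → Fin n → ℝ) (f : (Fin n → ℝ) → ℝ) (j : Fin n)
    (x : Fin n → ℝ) : ℝ := ∑ k, Q x j k * pd k f x

/-- `⟨Q∇f,∇g⟩` -/
noncomputable def Pf (Q : (Fin n → ℝ) → Fin n → Fin n → ℝ) (f g : (Fin n → ℝ) → ℝ)
    (x : Fin n → ℝ) : ℝ := ∑ l, Xf Q f l x * pd l g x

/-- `div (Q ∇f)` -/
noncomputable def Lf (Q : (Fin n → ℝ) → Fin n → Fin n → ℝ) (f : (Fin n → ℝ) → ℝ)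
    (x : Fin n → ℝ) : ℝ := ∑ j, pd j (Xf Q f j) x

/-- half of the double Poisson bracket -/
noncomputable def Hf (Q : (Fin n → ℝ) → Fin n → Fin n → ℝ) (h : (Fin n → ℝ) → ℝ)
    (x : Fin n → ℝ) (ξ : Fin n → ℝ) : ℝ :=
  ∑ j, (2 * (∑ k, Q x j k * ξ k) * (∑ l, pd j (Xf Q h l) x * ξ l)
      - Xf Q h j x * ∑ l, ∑ m, pd j (fun y => Q y l m) x * ξ m * ξ l)

/-- the flux -/
noncomputable def Ff (Q : (Fin n → ℝ) → Fin n → Fin n → ℝ) (h : (Fin n → ℝ) → ℝ) (a w : ℝ)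
    (v : (Fin n → ℝ) → ℝ) (j : Fin n) (x : Fin n → ℝ) : ℝ :=
  2 * Pf Q h v x * Xf Q v j x - Xf Q h j x * Pf Q v v x
    + a ^ 2 * (Pf Q h h x * (v x * v x)) * Xf Q h j x + w * (v x * Xf Q v j x)

section
variable {Q : (Fin n → ℝ) → Fin n → Fin n → ℝ}

lemma contDiff_Xf (hQ : ∀ j k, ContDiff ℝ 1 (fun x => Q x j k))
    {f : (Fin n → ℝ) → ℝ} (hf : ContDiff ℝ 2 f) (j : Fin n) :
    ContDiff ℝ 1 (Xf Q f j) := by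
  unfold Xf
  exact ContDiff.sum fun k _ => (hQ j k).mul (contDiff_pd hf)

lemma contDiff_Pf (hQ : ∀ j k, ContDiff ℝ 1 (fun x => Q x j k))
    {f g : (Fin n → ℝ) → ℝ} (hf : ContDiff ℝ 2 f) (hg : ContDiff ℝ 2 g) :
    ContDiff ℝ 1 (Pf Q f g) := by
  unfold Pf
  exact ContDiff.sum fun k _ => (contDiff_Xf hQ hf k).mul (contDiff_pd hg)

lemma contDiff_Ff (hQ : ∀ j k, ContDiff ℝ 1 (fun x => Q x j k))
    {f g : (Fin n → ℝ) → ℝ} (hf : ContDiff ℝ 2 f) (hg : ContDiff ℝ 2 g) (a w : ℝ)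
    (j : Fin n) : ContDiff ℝ 1 (Ff Q f a w g j) := by
  unfold Ff
  have h1 := contDiff_Xf hQ hf j
  have h2 := contDiff_Xf hQ hg j
  have h3 := contDiff_Pf hQ hf hf
  have h4 := contDiff_Pf hQ hf hg
  have h5 := contDiff_Pf hQ hg hg
  have h6 : ContDiff ℝ 1 g := hg.of_le (by norm_num)
  fun_prop

lemma continuous_Lf (hQ : ∀ j k, ContDiff ℝ 1 (fun x => Q x j k))
    {f : (Fin n → ℝ) → ℝ} (hf : ContDiff ℝ 2 f) : Continuous (Lf Q f) := by
  unfold Lf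
  exact continuous_finsetSum _ fun j _ => continuous_pd (contDiff_Xf hQ hf j)

lemma pd_Xf (hQ : ∀ j k, ContDiff ℝ 1 (fun x => Q x j k))
    {f : (Fin n → ℝ) → ℝ} (hf : ContDiff ℝ 2 f) (j l : Fin n) (x : Fin n → ℝ) :
    pd j (Xf Q f l) x =
      ∑ m, (pd j (fun y => Q y l m) x * pd m f x + Q x l m * pd j (pd m f) x) := by
  have d1 : ∀ l m, DifferentiableAt ℝ (fun y => Q y l m) x := fun l m =>
    (hQ l m).differentiable (by norm_num) x
  have d2 : ∀ m, DifferentiableAt ℝ (pd m f) x := fun m =>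
    (contDiff_pd hf).differentiable (by norm_num) x
  unfold Xf
  rw [pd_sum (fun m => (d1 l m).fun_mul (d2 m))]
  exact Finset.sum_congr rfl fun m _ => pd_mul (d1 l m) (d2 m)

lemma pd_Pf (hQ : ∀ j k, ContDiff ℝ 1 (fun x => Q x j k))
    {f g : (Fin n → ℝ) → ℝ} (hf : ContDiff ℝ 2 f) (hg : ContDiff ℝ 2 g) (j : Fin n)
    (x : Fin n → ℝ) :
    pd j (Pf Q f g) x = ∑ l, (pd j (Xf Q f l) x * pd l g x + Xf Q f l x * pd j (pd l g) x) := by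
  have d1 : ∀ l, DifferentiableAt ℝ (Xf Q f l) x := fun l =>
    (contDiff_Xf hQ hf l).differentiable (by norm_num) x
  have d2 : ∀ m, DifferentiableAt ℝ (pd m g) x := fun m =>
    (contDiff_pd hg).differentiable (by norm_num) x
  unfold Pf
  rw [pd_sum (fun m => (d1 m).fun_mul (d2 m))]
  exact Finset.sum_congr rfl fun m _ => pd_mul (d1 m) (d2 m)

lemma T_eq (hQ : ∀ j k, ContDiff ℝ 1 (fun x => Q x j k))
    {h v : (Fin n → ℝ) → ℝ} (hh : ContDiff ℝ 2 h) (hv : ContDiff ℝ 2 v)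
    {x : Fin n → ℝ} (hs : ∀ j k, Q x j k = Q x k j) :
    ∑ j, (2 * pd j (Pf Q h v) x * Xf Q v j x - Xf Q h j x * pd j (Pf Q v v) x)
      = Hf Q h x (fun j => pd j v x) := by
  have := alg_T (Q x) hs (fun j l m => pd j (fun y => Q y l m) x) (fun j l => pd j (Xf Q h l) x)
    (fun j => Xf Q h j x) (fun j => pd j v x) (fun j k => pd j (pd k v) x)
    (fun j k => pd_comm hv x)
  unfold Hf
  rw [← this]
  refine Finset.sum_congr rfl fun j _ => ?_
  rw [pd_Pf hQ hh hv, pd_Pf hQ hv hv]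
  simp only [pd_Xf hQ hv]
  rfl

lemma K_eq (hQ : ∀ j k, ContDiff ℝ 1 (fun x => Q x j k))
    {h : (Fin n → ℝ) → ℝ} (hh : ContDiff ℝ 2 h)
    {x : Fin n → ℝ} (hs : ∀ j k, Q x j k = Q x k j) :
    ∑ j, Xf Q h j x * pd j (Pf Q h h) x = Hf Q h x (fun j => pd j h x) := by
  rw [← T_eq hQ hh hh hs]
  exact Finset.sum_congr rfl fun j _ => by ring

lemma div_Ff (hQ : ∀ j k, ContDiff ℝ 1 (fun x => Q x j k))
    {h v : (Fin n → ℝ) → ℝ} (hh : ContDiff ℝ 2 h) (hv : ContDiff ℝ 2 v) (a w : ℝ)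
    {x : Fin n → ℝ} (hs : ∀ j k, Q x j k = Q x k j) :
    ∑ j, pd j (Ff Q h a w v j) x =
      (Lf Q v x + a ^ 2 * Pf Q h h x * v x) * (2 * Pf Q h v x + w * v x)
      - (Lf Q h x - w) * Pf Q v v x + a ^ 2 * v x ^ 2 * (Pf Q h h x * (Lf Q h x - w))
      + Hf Q h x (fun j => pd j v x) + a ^ 2 * v x ^ 2 * Hf Q h x (fun j => pd j h x) := by
  have dX : ∀ l, DifferentiableAt ℝ (Xf Q h l) x := fun l =>
    (contDiff_Xf hQ hh l).differentiable (by norm_num) x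
  have dY : ∀ l, DifferentiableAt ℝ (Xf Q v l) x := fun l =>
    (contDiff_Xf hQ hv l).differentiable (by norm_num) x
  have dhh : DifferentiableAt ℝ (Pf Q h h) x :=
    (contDiff_Pf hQ hh hh).differentiable (by norm_num) x
  have dhv : DifferentiableAt ℝ (Pf Q h v) x :=
    (contDiff_Pf hQ hh hv).differentiable (by norm_num) x
  have dvv : DifferentiableAt ℝ (Pf Q v v) x :=
    (contDiff_Pf hQ hv hv).differentiable (by norm_num) x
  have dv : DifferentiableAt ℝ v x := hv.differentiable (by norm_num) x
  rw [← T_eq hQ hh hv hs, ← K_eq hQ hh hs]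
  have e : ∀ j, pd j (Ff Q h a w v j) x =
      2 * Pf Q h v x * pd j (Xf Q v j) x
      - pd j (Xf Q h j) x * Pf Q v v x
      + (2 * pd j (Pf Q h v) x * Xf Q v j x - Xf Q h j x * pd j (Pf Q v v) x)
      + a ^ 2 * v x ^ 2 * (Xf Q h j x * pd j (Pf Q h h) x)
      + 2 * a ^ 2 * Pf Q h h x * v x * (Xf Q h j x * pd j v x)
      + a ^ 2 * Pf Q h h x * v x ^ 2 * pd j (Xf Q h j) x
      + w * (Xf Q v j x * pd j v x) + w * v x * pd j (Xf Q v j) x := by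
    intro j
    unfold Ff
    rw [pd_add (by fun_prop) (by fun_prop), pd_add (by fun_prop) (by fun_prop),
      pd_sub (by fun_prop) (by fun_prop), pd_mul (by fun_prop) (by fun_prop),
      pd_const_mul _ (by fun_prop), pd_mul (by fun_prop) (by fun_prop),
      pd_mul (by fun_prop) (by fun_prop),
      pd_const_mul _ (by fun_prop), pd_const_mul _ (by fun_prop),
      pd_mul (by fun_prop) (by fun_prop), pd_mul (by fun_prop) (by fun_prop),
      pd_mul (by fun_prop) (by fun_prop)]
    ring
  rw [Finset.sum_congr rfl fun j _ => e j]
  simp only [Finset.sum_add_distrib, Finset.sum_sub_distrib, ← Finset.mul_sum, ← Finset.sum_mul]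
  have i1 : ∑ j, Xf Q h j x * pd j v x = Pf Q h v x := rfl
  have i2 : ∑ j, Xf Q v j x * pd j v x = Pf Q v v x := rfl
  have i3 : ∑ j, pd j (Xf Q v j) x = Lf Q v x := rfl
  have i4 : ∑ j, pd j (Xf Q h j) x = Lf Q h x := rfl
  rw [i1, i2, i3, i4]
  ring
end

lemma Pf_comm {Q : (Fin n → ℝ) → Fin n → Fin n → ℝ} {f g : (Fin n → ℝ) → ℝ}
    {x : Fin n → ℝ} (hs : ∀ j k, Q x j k = Q x k j) : Pf Q f g x = Pf Q g f x := by
  unfold Pf Xf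
  simp only [Finset.sum_mul]
  rw [Finset.sum_comm]
  refine Finset.sum_congr rfl fun l _ => Finset.sum_congr rfl fun m _ => ?_
  rw [hs m l]; ring

lemma pd_conj {h u : (Fin n → ℝ) → ℝ} (hh : ContDiff ℝ 2 h) (hu : ContDiff ℝ 2 u) (a : ℝ)
    (j : Fin n) (x : Fin n → ℝ) :
    pd j (fun y => Real.exp (a * h y) * u y) x =
      Real.exp (a * h x) * (pd j u x + a * (u x * pd j h x)) := by
  have dh : DifferentiableAt ℝ h x := hh.differentiable (by norm_num) x
  have du : DifferentiableAt ℝ u x := hu.differentiable (by norm_num) x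
  rw [pd_mul (by fun_prop) du, pd_comp (g := Real.exp) (f := fun y => a * h y) (by fun_prop) (by fun_prop), pd_const_mul _ dh,
    Real.deriv_exp]
  ring

lemma conj_eq {Q : (Fin n → ℝ) → Fin n → Fin n → ℝ} (hQ : ∀ j k, ContDiff ℝ 1 (fun x => Q x j k))
    {h u : (Fin n → ℝ) → ℝ} (hh : ContDiff ℝ 2 h) (hu : ContDiff ℝ 2 u) (a : ℝ)
    {x : Fin n → ℝ} (hs : ∀ j k, Q x j k = Q x k j) {v : (Fin n → ℝ) → ℝ}
    (hv : v = fun y => Real.exp (a * h y) * u y) :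
    Lf Q v x - 2 * a * Pf Q h v x + a ^ 2 * Pf Q h h x * v x - a * Lf Q h x * v x
      = Real.exp (a * h x) * Lf Q u x := by
  have dh : DifferentiableAt ℝ h x := hh.differentiable (by norm_num) x
  have du : DifferentiableAt ℝ u x := hu.differentiable (by norm_num) x
  have dX : ∀ l, DifferentiableAt ℝ (Xf Q h l) x := fun l =>
    (contDiff_Xf hQ hh l).differentiable (by norm_num) x
  have dY : ∀ l, DifferentiableAt ℝ (Xf Q u l) x := fun l =>
    (contDiff_Xf hQ hu l).differentiable (by norm_num) x
  have hX : ∀ j, Xf Q v j = fun y => Real.exp (a * h y) * (Xf Q u j y + a * (u y * Xf Q h j y)) := by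
    intro j; funext y
    subst hv
    unfold Xf
    simp only [pd_conj hh hu, Finset.mul_sum, ← Finset.sum_add_distrib]
    refine Finset.sum_congr rfl fun l _ => ?_
    ring
  have hP : Pf Q h v x = Real.exp (a * h x) * (Pf Q h u x + a * u x * Pf Q h h x) := by
    subst hv
    unfold Pf
    simp only [pd_conj hh hu, Finset.mul_sum, ← Finset.sum_add_distrib]
    refine Finset.sum_congr rfl fun l _ => ?_
    ring
  have hL : Lf Q v x = Real.exp (a * h x) * (a * Pf Q u h x + a ^ 2 * u x * Pf Q h h x
      + Lf Q u x + a * Pf Q h u x + a * u x * Lf Q h x) := by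
    unfold Lf Pf
    simp only [Finset.mul_sum, ← Finset.sum_add_distrib]
    refine Finset.sum_congr rfl fun j _ => ?_
    rw [hX, pd_mul (by fun_prop) (by fun_prop), pd_comp (g := Real.exp) (f := fun y => a * h y) (by fun_prop) (by fun_prop),
      pd_const_mul _ dh, Real.deriv_exp, pd_add (by fun_prop) (by fun_prop),
      pd_const_mul _ (by fun_prop), pd_mul (by fun_prop) (by fun_prop)]
    ring
  rw [hL, hP, Pf_comm hs (f := u) (g := h), hv]
  ring
end UC

namespace UC
variable {n : ℕ}

lemma st_bound : ∃ D : ℝ, 0 ≤ D ∧ ∀ s : ℝ, |deriv Real.smoothTransition s| ≤ D ∧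
    (s ≤ 0 → deriv Real.smoothTransition s = 0) ∧ (1 ≤ s → deriv Real.smoothTransition s = 0) := by
  have hc : Continuous (deriv Real.smoothTransition) :=
    (Real.smoothTransition.contDiff (n := 1)).continuous_deriv (by norm_num)
  have h0 : ∀ s : ℝ, s ≤ 0 → deriv Real.smoothTransition s = 0 := by
    intro s hs
    apply IsLocalMin.deriv_eq_zero
    refine Filter.Eventually.of_forall fun y => ?_
    rw [Real.smoothTransition.zero_of_nonpos hs]
    exact Real.smoothTransition.nonneg y
  have h1 : ∀ s : ℝ, 1 ≤ s → deriv Real.smoothTransition s = 0 := by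
    intro s hs
    apply IsLocalMax.deriv_eq_zero
    refine Filter.Eventually.of_forall fun y => ?_
    rw [Real.smoothTransition.one_of_one_le hs]
    exact Real.smoothTransition.le_one y
  obtain ⟨D, hD⟩ := (isCompact_Icc (a := (0:ℝ)) (b := 1)).exists_bound_of_continuousOn hc.continuousOn
  refine ⟨max D 0, le_max_right _ _, fun s => ⟨?_, h0 s, h1 s⟩⟩
  by_cases a : s ≤ 0
  · simp [h0 s a]
  by_cases b : 1 ≤ s
  · simp [h1 s b]
  · exact (hD s ⟨by linarith, by linarith⟩).trans (le_max_left _ _)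

lemma flux_zero {F : Fin n → (Fin n → ℝ) → ℝ} (hF : ∀ j, ContDiff ℝ 1 (F j))
    (hFc : ∀ j, HasCompactSupport (F j)) {p m : (Fin n → ℝ) → ℝ}
    (hp : ContDiff ℝ 1 p) (hm : ContDiff ℝ 1 m) (K : ℝ)
    (hK1 : ∀ x, 0 < p x → 0 < m x → |∑ j, F j x * pd j p x| ≤ K * p x)
    (hK2 : ∀ x, 0 < p x → 0 < m x → |∑ j, F j x * pd j m x| ≤ K * m x) :
    ∫ x in {x | 0 < p x ∧ 0 < m x}, ∑ j, pd j (F j) x = 0 := by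
  classical
  obtain ⟨D, hD0, hD⟩ := st_bound
  set ω := Real.smoothTransition with hω
  have ωc : ContDiff ℝ 1 ω := Real.smoothTransition.contDiff
  have ωd : Differentiable ℝ ω := ωc.differentiable (by norm_num)
  set W : Set (Fin n → ℝ) := {x | 0 < p x ∧ 0 < m x} with hW
  have hWo : IsOpen W := (isOpen_lt continuous_const hp.continuous).inter
    (isOpen_lt continuous_const hm.continuous)
  -- compact set
  set S : Set (Fin n → ℝ) := ⋃ j, tsupport (F j) with hS
  have hSc : IsCompact S := isCompact_iUnion fun j => hFc j
  -- the cut off functions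
  let η : ℕ → (Fin n → ℝ) → ℝ := fun N x => ω ((N : ℝ) * p x) * ω ((N : ℝ) * m x)
  have hη : ∀ N, ContDiff ℝ 1 (η N) := fun N => by
    have := ωc.comp (contDiff_const.mul hp : ContDiff ℝ 1 fun x => (N : ℝ) * p x)
    have := ωc.comp (contDiff_const.mul hm : ContDiff ℝ 1 fun x => (N : ℝ) * m x)
    exact ContDiff.mul ‹_› ‹_›
  have dp : Differentiable ℝ p := hp.differentiable (by norm_num)
  have dm : Differentiable ℝ m := hm.differentiable (by norm_num)
  have hηd : ∀ N j x, pd j (η N) x =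
      deriv ω ((N : ℝ) * p x) * ((N : ℝ) * pd j p x) * ω ((N : ℝ) * m x)
      + ω ((N : ℝ) * p x) * (deriv ω ((N : ℝ) * m x) * ((N : ℝ) * pd j m x)) := by
    intro N j x
    have a1 : DifferentiableAt ℝ (fun y => ω ((N : ℝ) * p y)) x :=
      (ωd _).comp (f := fun y => (N : ℝ) * p y) x ((dp x).const_mul _)
    have a2 : DifferentiableAt ℝ (fun y => ω ((N : ℝ) * m y)) x :=
      (ωd _).comp (f := fun y => (N : ℝ) * m y) x ((dm x).const_mul _)
    simp only [η]
    rw [pd_mul a1 a2, pd_comp (f := fun y => (N : ℝ) * p y) (ωd _) ((dp x).const_mul _),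
      pd_comp (f := fun y => (N : ℝ) * m y) (ωd _) ((dm x).const_mul _),
      pd_const_mul _ (dp x), pd_const_mul _ (dm x)]
  let G : ℕ → (Fin n → ℝ) → ℝ := fun N x => ∑ j, pd j (fun y => η N y * F j y) x
  have hGc : ∀ N, Continuous (G N) := fun N =>
    continuous_finsetSum _ fun j _ => continuous_pd ((hη N).mul (hF j))
  have hGi : ∀ N, ∫ x, G N x = 0 := by
    intro N
    simp only [G]
    rw [MeasureTheory.integral_finsetSum]
    · exact Finset.sum_eq_zero fun j _ => integral_pd ((hη N).mul (hF j)) (hFc j).mul_left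
    · intro j _
      refine (continuous_pd ((hη N).mul (hF j))).integrable_of_hasCompactSupport ?_
      unfold pd
      exact ((hFc j).mul_left (f := η N)).fderiv_apply (𝕜 := ℝ) _
  have hGe : ∀ N x, G N x = η N x * (∑ j, pd j (F j) x)
      + deriv ω ((N : ℝ) * p x) * N * ω ((N : ℝ) * m x) * (∑ j, F j x * pd j p x)
      + ω ((N : ℝ) * p x) * deriv ω ((N : ℝ) * m x) * N * (∑ j, F j x * pd j m x) := by
    intro N x
    simp only [G, Finset.mul_sum, ← Finset.sum_add_distrib]
    refine Finset.sum_congr rfl fun j _ => ?_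
    rw [pd_mul ((hη N).differentiable (by norm_num) x) ((hF j).differentiable (by norm_num) x), hηd]
    ring
  have hdc : Continuous fun x => ∑ j, pd j (F j) x :=
    continuous_finsetSum _ fun j _ => continuous_pd (hF j)
  have hzero : ∀ x, x ∉ S → ∀ j, F j x = 0 ∧ pd j (F j) x = 0 := by
    intro x hx j
    have hj : x ∉ tsupport (F j) := fun h => hx (Set.mem_iUnion.2 ⟨j, h⟩)
    have e : F j =ᶠ[nhds x] 0 := notMem_tsupport_iff_eventuallyEq.mp hj
    refine ⟨e.eq_of_nhds, ?_⟩
    unfold pd; rw [e.fderiv_eq]; simp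
  have hlim : Filter.Tendsto (fun N => ∫ x, G N x) Filter.atTop
      (nhds (∫ x, W.indicator (fun x => ∑ j, pd j (F j) x) x)) := by
    refine MeasureTheory.tendsto_integral_of_dominated_convergence
      (S.indicator fun x => |∑ j, pd j (F j) x| + (D * |K| + D * |K|)) ?_ ?_ ?_ ?_
    · exact fun N => (hGc N).aestronglyMeasurable
    · refine (MeasureTheory.integrable_indicator_iff hSc.measurableSet).2 ?_
      exact (hdc.abs.add continuous_const).continuousOn.integrableOn_compact hSc
    · intro N
      refine Filter.Eventually.of_forall fun x => ?_
      rw [hGe, Real.norm_eq_abs]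
      by_cases hx : x ∈ S
      · rw [Set.indicator_of_mem hx]
        have b0 : |η N x| ≤ 1 := by
          simp only [η]
          rw [abs_mul, abs_of_nonneg (Real.smoothTransition.nonneg _),
            abs_of_nonneg (Real.smoothTransition.nonneg _)]
          exact mul_le_one₀ (Real.smoothTransition.le_one _) (Real.smoothTransition.nonneg _)
            (Real.smoothTransition.le_one _)
        have key : ∀ q q' f : ℝ, (0 < q → 0 < q' → |f| ≤ K * q) →
            |deriv ω ((N : ℝ) * q) * N * ω ((N : ℝ) * q') * f| ≤ D * |K| := by
          intro q q' f hf
          have hDK : 0 ≤ D * |K| := by positivity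
          by_cases h0 : (N : ℝ) * q ≤ 0
          · rw [(hD _).2.1 h0]; simpa using hDK
          by_cases h0' : (N : ℝ) * q' ≤ 0
          · rw [hω, Real.smoothTransition.zero_of_nonpos h0']; simpa using hDK
          by_cases h1 : 1 ≤ (N : ℝ) * q
          · rw [(hD _).2.2 h1]; simpa using hDK
          have hN : (0 : ℝ) ≤ N := Nat.cast_nonneg N
          have hq : 0 < q := by
            by_contra hh; exact h0 (mul_nonpos_of_nonneg_of_nonpos hN (not_lt.1 hh))
          have hq' : 0 < q' := by
            by_contra hh; exact h0' (mul_nonpos_of_nonneg_of_nonpos hN (not_lt.1 hh))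
          have hf' := hf hq hq'
          have hf2 : N * |f| ≤ |K| := by
            calc N * |f| ≤ N * (K * q) := by gcongr
              _ ≤ N * (|K| * q) := by gcongr; exact le_abs_self K
              _ = |K| * (N * q) := by ring
              _ ≤ |K| * 1 := by gcongr; linarith
              _ = |K| := mul_one _
          rw [abs_mul, abs_mul, abs_mul, abs_of_nonneg hN,
            abs_of_nonneg (Real.smoothTransition.nonneg ((N : ℝ) * q'))]
          calc |deriv ω (N * q)| * N * ω (N * q') * |f|
              = |deriv ω (N * q)| * ω (N * q') * (N * |f|) := by ring
            _ ≤ D * 1 * |K| := by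
                gcongr
                · exact Real.smoothTransition.nonneg _
                · exact (hD _).1
                · exact Real.smoothTransition.le_one _
            _ = D * |K| := by ring
        have b1 := key (p x) (m x) _ (hK1 x)
        have b2 := key (m x) (p x) _ (fun a b => hK2 x b a)
        have b3 : |η N x * ∑ j, pd j (F j) x| ≤ |∑ j, pd j (F j) x| := by
          rw [abs_mul]; exact mul_le_of_le_one_left (abs_nonneg _) b0
        refine (abs_add_three _ _ _).trans ?_
        have b2' : ω ((N : ℝ) * p x) * deriv ω ((N : ℝ) * m x) * N * (∑ j, F j x * pd j m x)
          = deriv ω ((N : ℝ) * m x) * N * ω ((N : ℝ) * p x) * (∑ j, F j x * pd j m x) := by ring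
        rw [b2']
        linarith
      · rw [Set.indicator_of_notMem hx]
        simp [hzero x hx]
    · refine Filter.Eventually.of_forall fun x => ?_
      by_cases hx : x ∈ W
      · rw [Set.indicator_of_mem hx]
        apply tendsto_const_nhds.congr'
        have t1 : ∀ᶠ N : ℕ in Filter.atTop, 1 ≤ (N : ℝ) * p x :=
          (tendsto_natCast_atTop_atTop.atTop_mul_const hx.1).eventually_ge_atTop 1
        have t2 : ∀ᶠ N : ℕ in Filter.atTop, 1 ≤ (N : ℝ) * m x :=
          (tendsto_natCast_atTop_atTop.atTop_mul_const hx.2).eventually_ge_atTop 1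
        filter_upwards [t1, t2] with N h1 h2
        rw [hGe, (hD _).2.2 h1, (hD _).2.2 h2]
        simp [η, hω, Real.smoothTransition.one_of_one_le h1, Real.smoothTransition.one_of_one_le h2]
      · rw [Set.indicator_of_notMem hx]
        apply tendsto_const_nhds.congr
        intro N
        rw [hGe]
        have hN : (0 : ℝ) ≤ N := Nat.cast_nonneg N
        rcases not_and_or.1 hx with h | h
        · have h' : (N : ℝ) * p x ≤ 0 := mul_nonpos_of_nonneg_of_nonpos hN (not_lt.1 h)
          rw [(hD _).2.1 h']
          simp [η, hω, Real.smoothTransition.zero_of_nonpos h']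
        · have h' : (N : ℝ) * m x ≤ 0 := mul_nonpos_of_nonneg_of_nonpos hN (not_lt.1 h)
          rw [(hD _).2.1 h']
          simp [η, hω, Real.smoothTransition.zero_of_nonpos h']
  rw [← MeasureTheory.integral_indicator hWo.measurableSet]
  simp only [hGi] at hlim
  exact (tendsto_nhds_unique hlim tendsto_const_nhds)
end UC

namespace UC
variable {n : ℕ}

lemma fderiv_eq_sum (f : (Fin n → ℝ) → ℝ) (x e : Fin n → ℝ) :
    fderiv ℝ f x e = ∑ j, pd j f x * e j := by
  have h := (LinearMap.pi_apply_eq_sum_univ (fderiv ℝ f x : (Fin n → ℝ) →ₗ[ℝ] ℝ) e)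
  simp only [ContinuousLinearMap.coe_coe] at h
  rw [h]
  refine Finset.sum_congr rfl fun j _ => ?_
  have e2 : (fun i => if j = i then (1:ℝ) else 0) = Pi.single j 1 := by
    ext i; simp [Pi.single_apply, eq_comm]
  rw [e2, smul_eq_mul, mul_comm]; rfl

lemma exists_dir {a b : Fin n → ℝ} (h : LinearIndependent ℝ ![a, b]) (s t : ℝ) :
    ∃ e : Fin n → ℝ, ∑ j, a j * e j = s ∧ ∑ j, b j * e j = t := by
  rw [LinearIndependent.pair_iff] at h
  set A := ∑ j, a j * a j with hA
  set B := ∑ j, b j * b j with hB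
  set c := ∑ j, a j * b j with hc
  have hB0 : B ≠ 0 := by
    intro h0
    have : ∀ j, b j = 0 := by
      intro j
      have := (Finset.sum_eq_zero_iff_of_nonneg (fun j _ => mul_self_nonneg (b j))).1 h0 j
        (Finset.mem_univ j)
      exact mul_self_eq_zero.1 this
    have := h 0 1 (by ext j; simp [this j])
    simp at this
  have hne : A * B - c ^ 2 ≠ 0 := by
    intro h0
    have h1 : ∑ j, (B * a j - c * b j) * (B * a j - c * b j) = 0 := by
      have : ∀ j, (B * a j - c * b j) * (B * a j - c * b j)
        = B ^ 2 * (a j * a j) - 2 * B * c * (a j * b j) + c ^ 2 * (b j * b j) := fun j => by ring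
      simp only [this, Finset.sum_add_distrib, Finset.sum_sub_distrib, ← Finset.mul_sum]
      rw [← hA, ← hB, ← hc]
      linear_combination B * h0
    have h2 : ∀ j, B * a j - c * b j = 0 := by
      intro j
      have := (Finset.sum_eq_zero_iff_of_nonneg (fun j _ => mul_self_nonneg (B * a j - c * b j))).1 h1 j
        (Finset.mem_univ j)
      exact mul_self_eq_zero.1 this
    have := h B (-c) (by ext j; simp; linarith [h2 j])
    exact hB0 this.1
  refine ⟨fun j => ((s * B - t * c) / (A * B - c ^ 2)) * a j + ((t * A - s * c) / (A * B - c ^ 2)) * b j, ?_, ?_⟩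
  · have : ∀ j, a j * (((s * B - t * c) / (A * B - c ^ 2)) * a j + ((t * A - s * c) / (A * B - c ^ 2)) * b j)
      = ((s * B - t * c) / (A * B - c ^ 2)) * (a j * a j) + ((t * A - s * c) / (A * B - c ^ 2)) * (a j * b j) := fun j => by ring
    simp only [this, Finset.sum_add_distrib, ← Finset.mul_sum]
    rw [← hA, ← hc, div_mul_eq_mul_div, div_mul_eq_mul_div, ← add_div, div_eq_iff hne]; ring
  · have : ∀ j, b j * (((s * B - t * c) / (A * B - c ^ 2)) * a j + ((t * A - s * c) / (A * B - c ^ 2)) * b j)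
      = ((s * B - t * c) / (A * B - c ^ 2)) * (a j * b j) + ((t * A - s * c) / (A * B - c ^ 2)) * (b j * b j) := fun j => by ring
    simp only [this, Finset.sum_add_distrib, ← Finset.mul_sum]
    rw [← hB, ← hc, div_mul_eq_mul_div, div_mul_eq_mul_div, ← add_div, div_eq_iff hne]; ring

lemma path {p m : (Fin n → ℝ) → ℝ} (hp : ContDiff ℝ 1 p) (hm : ContDiff ℝ 1 m)
    {x0 : Fin n → ℝ} (hp0 : p x0 = 0) (hi : LinearIndependent ℝ ![fun j => pd j p x0, fun j => pd j m x0])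
    {r1 : ℝ} (hr1 : 0 < r1) :
    ∃ r2 > 0, ∃ K0 ≥ 0, r2 ≤ r1 ∧ ∀ x ∈ Metric.ball x0 r2, 0 < p x → 0 < m x →
      ∃ z ∈ Metric.ball x0 r1, p z = 0 ∧ 0 < m z ∧ ‖x - z‖ ≤ K0 * p x := by
  obtain ⟨e, he1, he2⟩ := exists_dir hi 1 (-1)
  rw [← fderiv_eq_sum] at he1 he2
  have c1 : Continuous fun x => fderiv ℝ p x e :=
    (hp.continuous_fderiv (by norm_num)).clm_apply continuous_const
  have c2 : Continuous fun x => fderiv ℝ m x e :=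
    (hm.continuous_fderiv (by norm_num)).clm_apply continuous_const
  have ev : ∀ᶠ x in nhds x0, 1 / 2 < fderiv ℝ p x e ∧ fderiv ℝ m x e < 0 :=
    (c1.continuousAt.eventually (lt_mem_nhds (by simp only [he1]; norm_num))).and
    (c2.continuousAt.eventually (gt_mem_nhds (by simp only [he2]; norm_num)))
  obtain ⟨r', hr', hb'⟩ := Metric.eventually_nhds_iff_ball.1 ev
  set r := min r' r1 with hr
  have hr0 : 0 < r := lt_min hr' hr1
  have ev2 : ∀ᶠ x in nhds x0, p x * (2 * ‖e‖) < r / 2 := by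
    have : Continuous fun x => p x * (2 * ‖e‖) := hp.continuous.mul continuous_const
    exact this.continuousAt.eventually (gt_mem_nhds (by simpa [hp0] using hr0))
  obtain ⟨r'', hr'', hb''⟩ := Metric.eventually_nhds_iff_ball.1 ev2
  have dp : Differentiable ℝ p := hp.differentiable (by norm_num)
  have dm : Differentiable ℝ m := hm.differentiable (by norm_num)
  refine ⟨min r'' (r / 2), by positivity, 2 * ‖e‖, by positivity,
    (min_le_right _ _).trans (by linarith [min_le_right r' r1]), ?_⟩
  intro x hx hpx hmx
  have hx1 : x ∈ Metric.ball x0 r'' := Metric.ball_subset_ball (min_le_left _ _) hx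
  have hx2 : x ∈ Metric.ball x0 (r / 2) := Metric.ball_subset_ball (min_le_right _ _) hx
  have hsmall := hb'' x hx1
  have hin : ∀ t ∈ Set.Icc 0 (2 * p x), x - t • e ∈ Metric.ball x0 r := by
    intro t ht
    rw [Metric.mem_ball, dist_eq_norm] at hx2 ⊢
    have : ‖t • e‖ ≤ 2 * p x * ‖e‖ := by
      rw [norm_smul, Real.norm_eq_abs, abs_of_nonneg ht.1]
      gcongr; exact ht.2
    calc ‖x - t • e - x0‖ = ‖(x - x0) - t • e‖ := by congr 1; abel
      _ ≤ ‖x - x0‖ + ‖t • e‖ := norm_sub_le _ _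
      _ < r := by linarith
  have hd : ∀ f : (Fin n → ℝ) → ℝ, Differentiable ℝ f → ∀ t : ℝ,
      HasDerivAt (fun t : ℝ => f (x - t • e)) (-(fderiv ℝ f (x - t • e) e)) t := by
    intro f hf t
    have h1 : HasDerivAt (fun t : ℝ => x - t • e) (-e) t := by
      simpa using ((hasDerivAt_id t).smul_const e).const_sub x
    have := (hf (x - t • e)).hasFDerivAt.comp_hasDerivAt t h1
    simp only [map_neg] at this
    exact this
  have hsub : ∀ t ∈ interior (Set.Icc 0 (2 * p x)), x - t • e ∈ Metric.ball x0 r' := fun t ht =>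
    Metric.ball_subset_ball (min_le_left _ _) (hin t (interior_subset ht))
  have hcp : Continuous fun t : ℝ => p (x - t • e) :=
    continuous_iff_continuousAt.2 fun t => (hd p dp t).continuousAt
  have hcm : Continuous fun t : ℝ => m (x - t • e) :=
    continuous_iff_continuousAt.2 fun t => (hd m dm t).continuousAt
  have m1 := Convex.image_sub_le_mul_sub_of_deriv_le (convex_Icc 0 (2 * p x))
    (f := fun t : ℝ => p (x - t • e)) (C := -(1/2)) hcp.continuousOn
    (fun t _ => (hd p dp t).differentiableAt.differentiableWithinAt)
    (fun t ht => by rw [(hd p dp t).deriv]; linarith [(hb' _ (hsub t ht)).1])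
    0 ⟨le_rfl, by linarith⟩ (2 * p x) ⟨by linarith, le_rfl⟩ (by linarith)
  simp only [zero_smul, sub_zero] at m1
  have hend : p (x - (2 * p x) • e) ≤ 0 := by linarith
  obtain ⟨t, ht, hpt⟩ : (0 : ℝ) ∈ (fun t : ℝ => p (x - t • e)) '' Set.Icc 0 (2 * p x) := by
    apply intermediate_value_Icc' (by linarith) hcp.continuousOn
    exact ⟨hend, by simpa using hpx.le⟩
  have m2 := Convex.mul_sub_le_image_sub_of_le_deriv (convex_Icc 0 (2 * p x))
    (f := fun t : ℝ => m (x - t • e)) (C := 0) hcm.continuousOn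
    (fun t _ => (hd m dm t).differentiableAt.differentiableWithinAt)
    (fun t ht => by rw [(hd m dm t).deriv]; linarith [(hb' _ (hsub t ht)).2])
    0 ⟨le_rfl, by linarith⟩ t ht ht.1
  simp only [zero_smul, sub_zero, zero_mul] at m2
  refine ⟨x - t • e, Metric.ball_subset_ball (min_le_right _ _) (hin t ht), hpt, by linarith, ?_⟩
  have : ‖t • e‖ ≤ 2 * p x * ‖e‖ := by
      rw [norm_smul, Real.norm_eq_abs, abs_of_nonneg ht.1]
      gcongr; exact ht.2
  rw [sub_sub_cancel]; linarith

lemma grad_parallel {v p : (Fin n → ℝ) → ℝ} (hv : ContDiff ℝ 1 v) (hp : ContDiff ℝ 1 p)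
    {z : Fin n → ℝ} (hz : p z = 0) (hd : fderiv ℝ p z ≠ 0)
    (h0 : ∀ᶠ y in nhds z, p y = 0 → v y = 0) :
    ∃ k : ℝ, ∀ j, pd j v z = k * pd j p z := by
  have hvz : v z = 0 := h0.self_of_nhds hz
  have hext : IsLocalExtrOn v {y | p y = p z} z := by
    left
    have : ∀ᶠ y in nhdsWithin z {y | p y = p z}, v z ≤ v y := by
      filter_upwards [mem_nhdsWithin_of_mem_nhds h0, self_mem_nhdsWithin] with y hy hy2
      rw [hvz, hy (by rw [← hz]; exact hy2)]
    exact this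
  obtain ⟨a, b, hab, h⟩ := hext.exists_multipliers_of_hasStrictFDerivAt_1d
    (hp.contDiffAt.hasStrictFDerivAt (by norm_num)) (hv.contDiffAt.hasStrictFDerivAt (by norm_num))
  have hb : b ≠ 0 := by
    rintro rfl
    simp at h
    rcases h with h | h
    · exact hab (by simp [h])
    · exact hd h
  refine ⟨-a / b, fun j => ?_⟩
  have := congrArg (fun L => L (Pi.single j 1)) h
  simp at this
  unfold pd
  field_simp
  linarith
end UC

namespace UC
variable {n : ℕ}

lemma norm_sq_le_sum (ξ : Fin n → ℝ) : ‖ξ‖ ^ 2 ≤ ∑ j, ξ j ^ 2 := by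
  have : ‖ξ‖ ≤ Real.sqrt (∑ j, ξ j ^ 2) := by
    refine (pi_norm_le_iff_of_nonneg (Real.sqrt_nonneg _)).2 fun i => ?_
    apply Real.le_sqrt_of_sq_le
    rw [Real.norm_eq_abs, sq_abs]
    exact Finset.single_le_sum (f := fun j => ξ j ^ 2) (fun j _ => sq_nonneg _) (Finset.mem_univ i)
  calc ‖ξ‖ ^ 2 ≤ Real.sqrt (∑ j, ξ j ^ 2) ^ 2 := by gcongr
    _ = _ := Real.sq_sqrt (Finset.sum_nonneg fun j _ => sq_nonneg _)

lemma quad_bound {f : (Fin n → ℝ) → ℝ} (hf : Continuous f)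
    (hh : ∀ (t : ℝ) ξ, f (t • ξ) = t ^ 2 * f ξ) : ∃ C ≥ 0, ∀ ξ, |f ξ| ≤ C * ∑ j, ξ j ^ 2 := by
  obtain ⟨C, hC⟩ := (isCompact_sphere (0 : Fin n → ℝ) 1).exists_bound_of_continuousOn hf.continuousOn
  refine ⟨max C 0, le_max_right _ _, fun ξ => ?_⟩
  by_cases h0 : ξ = 0
  · have := hh 0 0
    subst h0
    simp at this
    simp [this]
  have hn : ‖ξ‖ ≠ 0 := norm_ne_zero_iff.2 h0
  have h1 := hC (‖ξ‖⁻¹ • ξ) (by simp [norm_smul, hn])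
  have h2 : f ξ = ‖ξ‖ ^ 2 * f (‖ξ‖⁻¹ • ξ) := by
    rw [← hh, smul_smul, mul_inv_cancel₀ hn, one_smul]
  rw [h2, abs_mul, abs_of_nonneg (sq_nonneg _), mul_comm]
  rw [Real.norm_eq_abs] at h1
  exact mul_le_mul (h1.trans (le_max_left _ _)) (norm_sq_le_sum ξ) (sq_nonneg _) (le_max_right _ _)

/-- a positive continuous homogeneous function is uniformly positive nearby -/
lemma quad_pos {f : (Fin n → ℝ) → (Fin n → ℝ) → ℝ} (hf : Continuous fun z : (Fin n → ℝ) × (Fin n → ℝ) => f z.1 z.2)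
    (hh : ∀ x (t : ℝ) ξ, f x (t • ξ) = t ^ 2 * f x ξ) {x0 : Fin n → ℝ}
    (hpos : ∀ ξ, ξ ≠ 0 → 0 < f x0 ξ) : ∀ᶠ x in nhds x0, ∀ ξ, 0 ≤ f x ξ := by
  have h1 : ∀ᶠ x in nhds x0, ∀ ξ ∈ Metric.sphere (0 : Fin n → ℝ) 1, 0 < f x ξ := by
    apply (isCompact_sphere (0 : Fin n → ℝ) 1).eventually_forall_of_forall_eventually
    intro ξ hξ
    have : 0 < f x0 ξ := hpos ξ (by rintro rfl; simp at hξ)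
    exact hf.continuousAt.eventually (lt_mem_nhds this)
  filter_upwards [h1] with x hx ξ
  by_cases h0 : ξ = 0
  · have := hh x 0 0
    subst h0
    simp at this
    simp [this]
  have hn : ‖ξ‖ ≠ 0 := norm_ne_zero_iff.2 h0
  have h2 : f x ξ = ‖ξ‖ ^ 2 * f x (‖ξ‖⁻¹ • ξ) := by
    rw [← hh, smul_smul, mul_inv_cancel₀ hn, one_smul]
  rw [h2]
  have := hx (‖ξ‖⁻¹ • ξ) (by simp [norm_smul, hn])
  positivity

/-- the quadratic form -/
noncomputable def qf (Q : (Fin n → ℝ) → Fin n → Fin n → ℝ) (x ξ : Fin n → ℝ) : ℝ :=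
  ∑ l, (∑ k, Q x l k * ξ k) * ξ l

lemma qf_smul (Q : (Fin n → ℝ) → Fin n → Fin n → ℝ) (x ξ : Fin n → ℝ) (t : ℝ) :
    qf Q x (t • ξ) = t ^ 2 * qf Q x ξ := by
  unfold qf
  simp only [Finset.mul_sum, Finset.sum_mul, Pi.smul_apply, smul_eq_mul]
  refine Finset.sum_congr rfl fun l _ => Finset.sum_congr rfl fun m _ => ?_
  ring

lemma Hf_smul (Q : (Fin n → ℝ) → Fin n → Fin n → ℝ) (h : (Fin n → ℝ) → ℝ) (x ξ : Fin n → ℝ) (t : ℝ) :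
    Hf Q h x (t • ξ) = t ^ 2 * Hf Q h x ξ := by
  unfold Hf
  rw [Finset.mul_sum]
  refine Finset.sum_congr rfl fun j _ => ?_
  simp only [Pi.smul_apply, smul_eq_mul]
  have e1 : ∑ k, Q x j k * (t * ξ k) = t * ∑ k, Q x j k * ξ k := by
    rw [Finset.mul_sum]; exact Finset.sum_congr rfl fun k _ => by ring
  have e2 : ∑ l, pd j (Xf Q h l) x * (t * ξ l) = t * ∑ l, pd j (Xf Q h l) x * ξ l := by
    rw [Finset.mul_sum]; exact Finset.sum_congr rfl fun k _ => by ring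
  have e3 : ∑ l, ∑ m, pd j (fun y => Q y l m) x * (t * ξ m) * (t * ξ l)
      = t ^ 2 * ∑ l, ∑ m, pd j (fun y => Q y l m) x * ξ m * ξ l := by
    simp only [Finset.mul_sum]
    exact Finset.sum_congr rfl fun k _ => Finset.sum_congr rfl fun m _ => by ring
  rw [e1, e2, e3]; ring

section
variable {Q : (Fin n → ℝ) → Fin n → Fin n → ℝ}

lemma continuous_qf (hQ : ∀ j k, ContDiff ℝ 1 (fun x => Q x j k)) :
    Continuous fun z : (Fin n → ℝ) × (Fin n → ℝ) => qf Q z.1 z.2 := by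
  have : ∀ j k, Continuous fun z : (Fin n → ℝ) × (Fin n → ℝ) => Q z.1 j k := fun j k =>
    (hQ j k).continuous.comp continuous_fst
  unfold qf
  fun_prop

lemma continuous_Hf (hQ : ∀ j k, ContDiff ℝ 1 (fun x => Q x j k)) {h : (Fin n → ℝ) → ℝ}
    (hh : ContDiff ℝ 2 h) :
    Continuous fun z : (Fin n → ℝ) × (Fin n → ℝ) => Hf Q h z.1 z.2 := by
  have a1 : ∀ j k, Continuous fun z : (Fin n → ℝ) × (Fin n → ℝ) => Q z.1 j k := fun j k =>
    (hQ j k).continuous.comp continuous_fst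
  have a2 : ∀ j l, Continuous fun z : (Fin n → ℝ) × (Fin n → ℝ) => pd j (Xf Q h l) z.1 := fun j l =>
    (continuous_pd (contDiff_Xf hQ hh l)).comp continuous_fst
  have a3 : ∀ j, Continuous fun z : (Fin n → ℝ) × (Fin n → ℝ) => Xf Q h j z.1 := fun j =>
    (contDiff_Xf hQ hh j).continuous.comp continuous_fst
  have a4 : ∀ j l m, Continuous fun z : (Fin n → ℝ) × (Fin n → ℝ) => pd j (fun y => Q y l m) z.1 :=
    fun j l m => (continuous_pd (hQ l m)).comp continuous_fst
  unfold Hf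
  fun_prop

lemma Xf_add {f g : (Fin n → ℝ) → ℝ} (hf : ContDiff ℝ 2 f) (hg : ContDiff ℝ 2 g) (l : Fin n) :
    Xf Q (fun x => f x + g x) l = fun x => Xf Q f l x + Xf Q g l x := by
  funext x
  unfold Xf
  rw [← Finset.sum_add_distrib]
  refine Finset.sum_congr rfl fun j _ => ?_
  rw [pd_add (hf.differentiable (by norm_num) x) (hg.differentiable (by norm_num) x)]; ring

lemma Xf_const_mul {f : (Fin n → ℝ) → ℝ} (hf : ContDiff ℝ 2 f) (c : ℝ) (l : Fin n) :
    Xf Q (fun x => c * f x) l = fun x => c * Xf Q f l x := by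
  funext x
  unfold Xf
  rw [Finset.mul_sum]
  refine Finset.sum_congr rfl fun j _ => ?_
  rw [pd_const_mul _ (hf.differentiable (by norm_num) x)]; ring

lemma Xf_sq {f : (Fin n → ℝ) → ℝ} (hf : ContDiff ℝ 2 f) (l : Fin n) :
    Xf Q (fun x => f x * f x) l = fun x => 2 * (f x * Xf Q f l x) := by
  funext x
  unfold Xf
  rw [Finset.mul_sum, Finset.mul_sum]
  refine Finset.sum_congr rfl fun j _ => ?_
  rw [pd_mul (hf.differentiable (by norm_num) x) (hf.differentiable (by norm_num) x)]; ring

lemma Hf_add (hQ : ∀ j k, ContDiff ℝ 1 (fun x => Q x j k)) {f g : (Fin n → ℝ) → ℝ}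
    (hf : ContDiff ℝ 2 f) (hg : ContDiff ℝ 2 g) (x ξ : Fin n → ℝ) :
    Hf Q (fun x => f x + g x) x ξ = Hf Q f x ξ + Hf Q g x ξ := by
  unfold Hf
  rw [← Finset.sum_add_distrib]
  refine Finset.sum_congr rfl fun j _ => ?_
  have e : ∀ l, pd j (Xf Q (fun x => f x + g x) l) x * ξ l =
      pd j (Xf Q f l) x * ξ l + pd j (Xf Q g l) x * ξ l := by
    intro l
    rw [Xf_add hf hg, pd_add ((contDiff_Xf hQ hf l).differentiable (by norm_num) x)
      ((contDiff_Xf hQ hg l).differentiable (by norm_num) x)]; ring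
  simp only [e, Finset.sum_add_distrib]
  rw [Xf_add hf hg]; ring

lemma Hf_const_mul (hQ : ∀ j k, ContDiff ℝ 1 (fun x => Q x j k)) {f : (Fin n → ℝ) → ℝ}
    (hf : ContDiff ℝ 2 f) (c : ℝ) (x ξ : Fin n → ℝ) :
    Hf Q (fun x => c * f x) x ξ = c * Hf Q f x ξ := by
  unfold Hf
  rw [Finset.mul_sum]
  refine Finset.sum_congr rfl fun j _ => ?_
  have e : ∀ l, pd j (Xf Q (fun x => c * f x) l) x * ξ l = c * (pd j (Xf Q f l) x * ξ l) := by
    intro l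
    rw [Xf_const_mul hf, pd_const_mul _ ((contDiff_Xf hQ hf l).differentiable (by norm_num) x)]; ring
  simp only [e, ← Finset.mul_sum]
  rw [Xf_const_mul hf]; ring

lemma Hf_sq (hQ : ∀ j k, ContDiff ℝ 1 (fun x => Q x j k)) {f : (Fin n → ℝ) → ℝ}
    (hf : ContDiff ℝ 2 f) {x : Fin n → ℝ} (hs : ∀ j k, Q x j k = Q x k j) (h0 : f x = 0)
    (ξ : Fin n → ℝ) :
    Hf Q (fun x => f x * f x) x ξ = 4 * (∑ l, Xf Q f l x * ξ l) ^ 2 := by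
  have e : ∀ j l, pd j (Xf Q (fun x => f x * f x) l) x = 2 * pd j f x * Xf Q f l x := by
    intro j l
    have d1 := hf.differentiable (by norm_num) x
    have d2 := (contDiff_Xf hQ hf l).differentiable (by norm_num) x
    rw [Xf_sq hf, pd_const_mul _ (d1.fun_mul d2), pd_mul d1 d2, h0]; ring
  have e2 : ∑ j, (∑ k, Q x j k * ξ k) * pd j f x = ∑ l, Xf Q f l x * ξ l := by
    unfold Xf
    simp only [Finset.sum_mul]
    rw [Finset.sum_comm]
    refine Finset.sum_congr rfl fun l _ => Finset.sum_congr rfl fun m _ => ?_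
    rw [hs m l]; ring
  unfold Hf
  have e3 : ∀ j, (2 * (∑ k, Q x j k * ξ k) * (∑ l, pd j (Xf Q (fun x => f x * f x) l) x * ξ l)
      - Xf Q (fun x => f x * f x) j x * ∑ l, ∑ m, pd j (fun y => Q y l m) x * ξ m * ξ l)
      = 4 * (∑ l, Xf Q f l x * ξ l) * ((∑ k, Q x j k * ξ k) * pd j f x) := by
    intro j
    have : ∑ l, pd j (Xf Q (fun x => f x * f x) l) x * ξ l = 2 * pd j f x * ∑ l, Xf Q f l x * ξ l := by
      rw [Finset.mul_sum]
      exact Finset.sum_congr rfl fun l _ => by rw [e]; ring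
    rw [this, Xf_sq hf]
    simp only [h0]; ring
  rw [Finset.sum_congr rfl fun j _ => e3 j, ← Finset.mul_sum, e2]; ring
end
end UC

namespace UC
variable {n : ℕ}

/-- squared distance -/
noncomputable def sqd (x0 x : Fin n → ℝ) : ℝ := ∑ j, (x j - x0 j) ^ 2

/-- main part of the weight -/
noncomputable def hz (p m : (Fin n → ℝ) → ℝ) (x0 x : Fin n → ℝ) : ℝ := (-1) * (p x + m x) - sqd x0 x

/-- the weight -/
noncomputable def hw (p m : (Fin n → ℝ) → ℝ) (x0 : Fin n → ℝ) (M : ℝ) (x : Fin n → ℝ) : ℝ :=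
  hz p m x0 x + (M / 2) * (p x * p x + m x * m x)

lemma contDiff_sqd (x0 : Fin n → ℝ) : ContDiff ℝ 2 (sqd x0) := by
  unfold sqd
  fun_prop

lemma contDiff_hz {p m : (Fin n → ℝ) → ℝ} (hp : ContDiff ℝ 2 p) (hm : ContDiff ℝ 2 m)
    (x0 : Fin n → ℝ) : ContDiff ℝ 2 (hz p m x0) := by
  have := contDiff_sqd x0
  unfold hz
  fun_prop

lemma contDiff_hw {p m : (Fin n → ℝ) → ℝ} (hp : ContDiff ℝ 2 p) (hm : ContDiff ℝ 2 m)
    (x0 : Fin n → ℝ) (M : ℝ) : ContDiff ℝ 2 (hw p m x0 M) := by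
  have := contDiff_hz hp hm x0
  unfold hw
  fun_prop

lemma pd_sqd (x0 : Fin n → ℝ) (j : Fin n) : pd j (sqd x0) x0 = 0 := by
  have : IsLocalMin (sqd x0) x0 := by
    refine Filter.Eventually.of_forall fun y => ?_
    have h0 : sqd x0 x0 = 0 := by simp [sqd]
    rw [h0]
    exact Finset.sum_nonneg fun j _ => sq_nonneg _
  unfold pd
  rw [this.fderiv_eq_zero]; simp

set_option maxHeartbeats 1000000 in
lemma weight {Q : (Fin n → ℝ) → Fin n → Fin n → ℝ} (hQ : ∀ j k, ContDiff ℝ 1 (fun x => Q x j k))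
    {p m : (Fin n → ℝ) → ℝ} (hp : ContDiff ℝ 2 p) (hm : ContDiff ℝ 2 m) {x0 : Fin n → ℝ}
    (hs : ∀ j k, Q x0 j k = Q x0 k j) (hp0 : p x0 = 0) (hm0 : m x0 = 0)
    (hpp : Pf Q p p x0 = 0) (hmm : Pf Q m m x0 = 0) (hpm : Pf Q p m x0 ≠ 0)
    {c k : ℝ} (hc : 0 < c)
    (hpos : ∀ ξ : Fin n → ℝ, c * ∑ j, ξ j ^ 2 ≤ qf Q x0 ξ +
      k * ((∑ l, Xf Q p l x0 * ξ l) ^ 2 + (∑ l, Xf Q m l x0 * ξ l) ^ 2)) :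
    ∃ M > 0, ∃ w : ℝ, ∃ c' > 0, ∀ᶠ x in nhds x0,
      (∀ ξ, c' * ∑ j, ξ j ^ 2 ≤ Hf Q (hw p m x0 M) x ξ - (Lf Q (hw p m x0 M) x - w) * qf Q x ξ) ∧
      c' ≤ Hf Q (hw p m x0 M) x (fun j => pd j (hw p m x0 M) x)
        + (Lf Q (hw p m x0 M) x - w) * Pf Q (hw p m x0 M) (hw p m x0 M) x := by
  have hz2 := contDiff_hz hp hm x0
  have c0 : Continuous fun ξ => Hf Q (hz p m x0) x0 ξ :=
    (continuous_Hf hQ hz2).comp (continuous_const.prodMk continuous_id)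
  obtain ⟨CR, hCR0, hCR⟩ := quad_bound c0 (fun t ξ => Hf_smul Q _ x0 ξ t)
  set a := Pf Q p m x0 with ha
  set γ := (CR + 1) / c with hγ
  have hγ0 : 0 < γ := by positivity
  set ζ : Fin n → ℝ := fun j => (-1) * (pd j p x0 + pd j m x0) with hζ
  have ha2 : 0 < a ^ 2 := by positivity
  set M := γ * |k| + (1 + |Hf Q (hz p m x0) x0 ζ| + 2 * γ * |a|) / (4 * a ^ 2) with hM
  have hM0 : 0 < M := by positivity
  have hM1 : γ * k ≤ 2 * M := by
    have h1 : γ * k ≤ γ * |k| := by gcongr; exact le_abs_self k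
    have h2 : 0 ≤ (1 + |Hf Q (hz p m x0) x0 ζ| + 2 * γ * |a|) / (4 * a ^ 2) := by positivity
    have h3 : 0 ≤ γ * |k| := by positivity
    linarith
  have hM2 : 1 + |Hf Q (hz p m x0) x0 ζ| + 2 * γ * |a| ≤ 4 * M * a ^ 2 := by
    have : (1 + |Hf Q (hz p m x0) x0 ζ| + 2 * γ * |a|) / (4 * a ^ 2) ≤ M := by
      have h3 : 0 ≤ γ * |k| := by positivity
      linarith
    rw [div_le_iff₀ (by positivity)] at this
    linarith
  set h := hw p m x0 M with hh
  have hC : ContDiff ℝ 2 h := contDiff_hw hp hm x0 M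
  have hpq : ContDiff ℝ 2 fun x => p x * p x := hp.mul hp
  have hmq : ContDiff ℝ 2 fun x => m x * m x := hm.mul hm
  have hH : ∀ ξ, Hf Q h x0 ξ = Hf Q (hz p m x0) x0 ξ +
      2 * M * ((∑ l, Xf Q p l x0 * ξ l) ^ 2 + (∑ l, Xf Q m l x0 * ξ l) ^ 2) := by
    intro ξ
    have e : h = fun x => hz p m x0 x + (M / 2) * (p x * p x + m x * m x) := rfl
    rw [e, Hf_add hQ hz2 (contDiff_const.mul (hpq.add hmq)), Hf_const_mul hQ (hpq.add hmq),
      Hf_add hQ hpq hmq, Hf_sq hQ hp hs hp0, Hf_sq hQ hm hs hm0]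
    ring
  have dp : DifferentiableAt ℝ p x0 := hp.differentiable (by norm_num) x0
  have dm : DifferentiableAt ℝ m x0 := hm.differentiable (by norm_num) x0
  have dq : DifferentiableAt ℝ (sqd x0) x0 := (contDiff_sqd x0).differentiable (by norm_num) x0
  have dz : DifferentiableAt ℝ (hz p m x0) x0 := hz2.differentiable (by norm_num) x0
  have hgrad : ∀ j, pd j h x0 = ζ j := by
    intro j
    have e : h = fun x => hz p m x0 x + (M / 2) * (p x * p x + m x * m x) := rfl
    have e' : hz p m x0 = fun x => (-1) * (p x + m x) - sqd x0 x := rfl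
    rw [e, pd_add dz (by fun_prop), pd_const_mul _ (by fun_prop), pd_add (by fun_prop) (by fun_prop),
      pd_mul dp dp, pd_mul dm dm, e', pd_sub (by fun_prop) dq, pd_const_mul _ (by fun_prop),
      pd_add dp dm, pd_sqd, hp0, hm0]
    simp [hζ]
  have hmp : Pf Q m p x0 = a := Pf_comm hs
  have hα : ∑ l, Xf Q p l x0 * ζ l = -a := by
    have : ∑ l, Xf Q p l x0 * ζ l = -(Pf Q p p x0 + Pf Q p m x0) := by
      unfold Pf
      rw [← Finset.sum_add_distrib, ← Finset.sum_neg_distrib]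
      exact Finset.sum_congr rfl fun l _ => by simp only [hζ]; ring
    rw [this, hpp]; ring
  have hβ : ∑ l, Xf Q m l x0 * ζ l = -a := by
    have : ∑ l, Xf Q m l x0 * ζ l = -(Pf Q m p x0 + Pf Q m m x0) := by
      unfold Pf
      rw [← Finset.sum_add_distrib, ← Finset.sum_neg_distrib]
      exact Finset.sum_congr rfl fun l _ => by simp only [hζ]; ring
    rw [this, hmm, hmp]; ring
  have hPh : Pf Q h h x0 = 2 * a := by
    have e1 : ∀ l, Xf Q h l x0 = -(Xf Q p l x0 + Xf Q m l x0) := by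
      intro l
      unfold Xf
      rw [← Finset.sum_add_distrib, ← Finset.sum_neg_distrib]
      exact Finset.sum_congr rfl fun l _ => by rw [hgrad]; simp only [hζ]; ring
    have : Pf Q h h x0 = -(∑ l, Xf Q p l x0 * ζ l + ∑ l, Xf Q m l x0 * ζ l) := by
      unfold Pf
      rw [← Finset.sum_add_distrib, ← Finset.sum_neg_distrib]
      exact Finset.sum_congr rfl fun l _ => by rw [hgrad, e1]; ring
    rw [this, hα, hβ]; ring
  have hLc : Continuous (Lf Q h) := continuous_Lf hQ hC
  set w := Lf Q h x0 + γ with hw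
  refine ⟨M, hM0, w, 1 / 2, by norm_num, ?_⟩
  have ev1 : ∀ᶠ x in nhds x0, ∀ ξ, 0 ≤ Hf Q h x ξ - (Lf Q h x - w) * qf Q x ξ
      - 1 / 2 * ∑ j, ξ j ^ 2 := by
    apply quad_pos (f := fun x ξ => Hf Q h x ξ - (Lf Q h x - w) * qf Q x ξ
      - 1 / 2 * ∑ j, ξ j ^ 2)
    · have b1 := continuous_Hf hQ hC
      have b2 := continuous_qf hQ
      have b3 : Continuous fun z : (Fin n → ℝ) × (Fin n → ℝ) => Lf Q h z.1 := hLc.comp continuous_fst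
      exact (b1.sub ((b3.sub continuous_const).mul b2)).sub (by fun_prop)
    · intro x t ξ
      simp only [Hf_smul, qf_smul, Pi.smul_apply, smul_eq_mul, mul_pow, ← Finset.mul_sum]
      ring
    · intro ξ hξ
      have hS : 0 < ∑ j, ξ j ^ 2 := lt_of_lt_of_le (by positivity) (norm_sq_le_sum ξ)
      have h1 := hpos ξ
      have h2 := neg_le_of_abs_le (hCR ξ)
      rw [hH, hw]
      set S := ∑ j, ξ j ^ 2
      set T := (∑ l, Xf Q p l x0 * ξ l) ^ 2 + (∑ l, Xf Q m l x0 * ξ l) ^ 2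
      have hT : 0 ≤ T := by positivity
      have h3 : γ * (c * S) ≤ γ * (qf Q x0 ξ + k * T) := by gcongr
      have h4 : γ * (c * S) = (CR + 1) * S := by rw [hγ]; field_simp
      have h5 : (γ * k) * T ≤ (2 * M) * T := by gcongr
      nlinarith
  have ev2 : ∀ᶠ x in nhds x0, 1 / 2 < Hf Q h x (fun j => pd j h x)
        + (Lf Q h x - w) * Pf Q h h x := by
    have b0 : Continuous fun x => (fun j => pd j h x : Fin n → ℝ) :=
      continuous_pi fun j => (contDiff_pd hC).continuous
    have b1 : Continuous fun x => Hf Q h x (fun j => pd j h x) :=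
      (continuous_Hf hQ hC).comp (continuous_id.prodMk b0)
    have b2 := (contDiff_Pf hQ hC hC).continuous
    have b : Continuous fun x => Hf Q h x (fun j => pd j h x) + (Lf Q h x - w) * Pf Q h h x :=
      b1.add ((hLc.sub continuous_const).mul b2)
    refine b.continuousAt.eventually (lt_mem_nhds ?_)
    simp only [hgrad]
    rw [show (fun j => ζ j) = ζ from rfl, hH, hα, hβ, hPh, hw]
    have h1 := neg_abs_le (Hf Q (hz p m x0) x0 ζ)
    have h2 : γ * a ≤ γ * |a| := by gcongr; exact le_abs_self a
    nlinarith
  filter_upwards [ev1, ev2] with x h1 h2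
  exact ⟨fun ξ => by linarith [h1 ξ], h2.le⟩
end UC

namespace UC
variable {n : ℕ}

lemma carleman_alg {S m D g v N c a G0 E : ℝ} (hc : 0 < c) (ha : 1 ≤ a)
    (hG0 : g ^ 2 ≤ G0) (haG : G0 ≤ c * a) (hE : E = S - a * m - a * g * v)
    (hD : S * m + c * N + c * a ^ 2 * v ^ 2 ≤ D) :
    c * a * (2 * N + a ^ 2 * v ^ 2) ≤ E ^ 2 + 2 * a * D := by
  have h1 : (E + a * g * v) ^ 2 = (S + a * m) ^ 2 - 4 * a * (S * m) := by rw [hE]; ring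
  have h2 : (E + a * g * v) ^ 2 ≤ 2 * E ^ 2 + 2 * (a ^ 2 * v ^ 2 * g ^ 2) := by
    nlinarith [sq_nonneg (E - a * g * v)]
  have h3 : a ^ 2 * v ^ 2 * g ^ 2 ≤ a ^ 2 * v ^ 2 * (c * a) := by
    gcongr; linarith
  have h4 : a * (S * m + c * N + c * a ^ 2 * v ^ 2) ≤ a * D := by gcongr
  nlinarith [sq_nonneg (S + a * m)]

lemma carleman_pt {Q : (Fin n → ℝ) → Fin n → Fin n → ℝ} (hQ : ∀ j k, ContDiff ℝ 1 (fun x => Q x j k))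
    {h u : (Fin n → ℝ) → ℝ} (hh : ContDiff ℝ 2 h) (hu : ContDiff ℝ 2 u) {a w : ℝ}
    {x : Fin n → ℝ} (hs : ∀ j k, Q x j k = Q x k j) {v : (Fin n → ℝ) → ℝ}
    (hv : v = fun y => Real.exp (a * h y) * u y) {c G0 G1 : ℝ} (hc : 0 < c) (ha : 1 ≤ a)
    (haG : G0 ≤ c * a) (hG0 : (Lf Q h x - w) ^ 2 ≤ G0) (hG1 : ∑ j, pd j h x ^ 2 ≤ G1)
    (h1 : ∀ ξ, c * ∑ j, ξ j ^ 2 ≤ Hf Q h x ξ - (Lf Q h x - w) * qf Q x ξ)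
    (h2 : c ≤ Hf Q h x (fun j => pd j h x) + (Lf Q h x - w) * Pf Q h h x) :
    c / (2 * G1 + 1) * a * Real.exp (a * h x) ^ 2 * (∑ j, pd j u x ^ 2 + u x ^ 2) ≤
      Real.exp (a * h x) ^ 2 * Lf Q u x ^ 2 + 2 * a * ∑ j, pd j (Ff Q h a w v j) x := by
  have hvC : ContDiff ℝ 2 v := by
    rw [hv]; exact (Real.contDiff_exp.comp (contDiff_const.mul hh)).mul hu
  have hconj := conj_eq hQ hh hu a hs hv
  have hdiv := div_Ff hQ hh hvC a w hs
  set D := ∑ j, pd j (Ff Q h a w v j) x with hDdef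
  set N := ∑ j, pd j v x ^ 2 with hN
  have h1' := h1 (fun j => pd j v x)
  have hq : qf Q x (fun j => pd j v x) = Pf Q v v x := rfl
  rw [hq] at h1'
  set e := Real.exp (a * h x) with he
  have hvx : v x = e * u x := by rw [hv]
  have hG1' : 0 ≤ G1 := (Finset.sum_nonneg fun j _ => sq_nonneg _).trans hG1
  have key := carleman_alg (S := Lf Q v x + a ^ 2 * Pf Q h h x * v x) (m := 2 * Pf Q h v x + w * v x)
    (D := D) (g := Lf Q h x - w) (v := v x) (N := N) (E := e * Lf Q u x) hc ha hG0 haG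
    (by rw [← hconj]; ring) (by
      rw [hdiv]
      have : (a ^ 2 * v x ^ 2) * c ≤ (a ^ 2 * v x ^ 2) *
        (Hf Q h x (fun j => pd j h x) + (Lf Q h x - w) * Pf Q h h x) := by gcongr
      nlinarith)
  have hsum : e ^ 2 * ∑ j, pd j u x ^ 2 ≤ 2 * N + 2 * a ^ 2 * v x ^ 2 * G1 := by
    have : ∀ j, e ^ 2 * pd j u x ^ 2 ≤ 2 * pd j v x ^ 2 + 2 * a ^ 2 * v x ^ 2 * pd j h x ^ 2 := by
      intro j
      have e1 : pd j v x = e * (pd j u x + a * (u x * pd j h x)) := by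
        rw [hv]; exact pd_conj hh hu a j x
      have e2 : e * pd j u x = pd j v x - a * v x * pd j h x := by rw [e1, hvx]; ring
      rw [← mul_pow, e2]
      nlinarith [sq_nonneg (pd j v x + a * v x * pd j h x)]
    calc e ^ 2 * ∑ j, pd j u x ^ 2 = ∑ j, e ^ 2 * pd j u x ^ 2 := Finset.mul_sum _ _ _
      _ ≤ ∑ j, (2 * pd j v x ^ 2 + 2 * a ^ 2 * v x ^ 2 * pd j h x ^ 2) :=
        Finset.sum_le_sum fun j _ => this j
      _ = 2 * N + 2 * a ^ 2 * v x ^ 2 * ∑ j, pd j h x ^ 2 := by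
        rw [Finset.sum_add_distrib, ← Finset.mul_sum, ← Finset.mul_sum]
      _ ≤ _ := by gcongr
  have hN0 : 0 ≤ N := Finset.sum_nonneg fun j _ => sq_nonneg _
  have hu2 : e ^ 2 * u x ^ 2 ≤ a ^ 2 * v x ^ 2 := by
    rw [hvx, ← mul_pow]
    have : 1 ≤ a ^ 2 := one_le_pow₀ ha
    nlinarith [sq_nonneg (e * u x)]
  have hfin : e ^ 2 * (∑ j, pd j u x ^ 2 + u x ^ 2) ≤ (2 * G1 + 1) * (2 * N + a ^ 2 * v x ^ 2) := by
    have : 0 ≤ G1 * N := by positivity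
    nlinarith
  calc c / (2 * G1 + 1) * a * e ^ 2 * (∑ j, pd j u x ^ 2 + u x ^ 2)
      = c / (2 * G1 + 1) * a * (e ^ 2 * (∑ j, pd j u x ^ 2 + u x ^ 2)) := by ring
    _ ≤ c / (2 * G1 + 1) * a * ((2 * G1 + 1) * (2 * N + a ^ 2 * v x ^ 2)) := by gcongr
    _ = c * a * (2 * N + a ^ 2 * v x ^ 2) := by field_simp
    _ ≤ (e * Lf Q u x) ^ 2 + 2 * a * D := key
    _ = _ := by ring

/-- the flux is `O(p)` near `{p = 0}` -/
lemma flux_bdry {Q : (Fin n → ℝ) → Fin n → Fin n → ℝ} (hQ : ∀ j k, ContDiff ℝ 1 (fun x => Q x j k))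
    {p m h v : (Fin n → ℝ) → ℝ} (hp : ContDiff ℝ 2 p) (hm : ContDiff ℝ 2 m)
    (hh : ContDiff ℝ 2 h) (hv : ContDiff ℝ 2 v) (a w : ℝ)
    (hFc : ∀ j, HasCompactSupport (Ff Q h a w v j)) {x0 : Fin n → ℝ} {r1 r2 K0 : ℝ} (hK0 : 0 ≤ K0)
    (hpath : ∀ x ∈ Metric.ball x0 r2, 0 < p x → 0 < m x →
      ∃ z ∈ Metric.ball x0 r1, p z = 0 ∧ 0 < m z ∧ ‖x - z‖ ≤ K0 * p x)
    (hFz : ∀ x, x ∉ Metric.ball x0 r2 → ∀ j, Ff Q h a w v j x = 0)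
    (hd : ∀ z ∈ Metric.ball x0 r1, fderiv ℝ p z ≠ 0)
    (hchar : ∀ z ∈ Metric.ball x0 r1, p z = 0 → Pf Q p p z = 0)
    (hv0 : ∀ z ∈ Metric.ball x0 r1, p z = 0 → 0 < m z → v z = 0) :
    ∃ K : ℝ, 0 ≤ K ∧ ∀ x, 0 < p x → 0 < m x → |∑ j, Ff Q h a w v j x * pd j p x| ≤ K * p x := by
  have hFC := fun j => contDiff_Ff hQ hh hv a w j
  have hGC : ContDiff ℝ 1 fun x => ∑ j, Ff Q h a w v j x * pd j p x :=
    ContDiff.sum fun j _ => (hFC j).mul (contDiff_pd hp)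
  have hGc : HasCompactSupport fun x => ∑ j, Ff Q h a w v j x * pd j p x := by
    apply HasCompactSupport.of_support_subset_isCompact (K := ⋃ j, tsupport (Ff Q h a w v j))
      (isCompact_iUnion fun j => hFc j)
    intro x hx
    by_contra hn
    apply hx
    refine Finset.sum_eq_zero fun j _ => ?_
    have : x ∉ tsupport (Ff Q h a w v j) := fun hj => hn (Set.mem_iUnion.2 ⟨j, hj⟩)
    rw [image_eq_zero_of_notMem_tsupport this, zero_mul]
  obtain ⟨L, hL⟩ := hGC.lipschitzWith_of_hasCompactSupport hGc (by norm_num)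
  refine ⟨L * K0, by positivity, fun x hpx hmx => ?_⟩
  by_cases hx : x ∈ Metric.ball x0 r2
  · obtain ⟨z, hz, hpz, hmz, hxz⟩ := hpath x hx hpx hmx
    have hev : ∀ᶠ y in nhds z, p y = 0 → v y = 0 := by
      filter_upwards [Metric.isOpen_ball.mem_nhds hz,
        hm.continuous.continuousAt.eventually (lt_mem_nhds hmz)] with y hy1 hy2 hy3
      exact hv0 y hy1 hy3 hy2
    obtain ⟨k, hk⟩ := grad_parallel (hv.of_le (by norm_num)) (hp.of_le (by norm_num)) hpz (hd z hz) hev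
    have hvz : v z = 0 := hv0 z hz hpz hmz
    have hX : ∀ j, Xf Q v j z = k * Xf Q p j z := by
      intro j
      unfold Xf
      rw [Finset.mul_sum]
      exact Finset.sum_congr rfl fun l _ => by rw [hk]; ring
    have hpp := hchar z hz hpz
    have hvv : Pf Q v v z = 0 := by
      have : Pf Q v v z = k ^ 2 * Pf Q p p z := by
        unfold Pf
        rw [Finset.mul_sum]
        exact Finset.sum_congr rfl fun l _ => by rw [hk, hX]; ring
      rw [this, hpp, mul_zero]
    have hGz : ∑ j, Ff Q h a w v j z * pd j p z = 0 := by
      have : ∀ j, Ff Q h a w v j z * pd j p z = (2 * Pf Q h v z * k) * (Xf Q p j z * pd j p z) := by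
        intro j
        unfold Ff
        rw [hvv, hvz, hX]; ring
      rw [Finset.sum_congr rfl fun j _ => this j, ← Finset.mul_sum]
      have e : ∑ j, Xf Q p j z * pd j p z = 0 := hpp
      rw [e, mul_zero]
    have hl := hL.dist_le_mul x z
    simp only [hGz, Real.dist_eq, sub_zero] at hl
    rw [dist_eq_norm] at hl
    calc _ ≤ L * ‖x - z‖ := hl
      _ ≤ L * (K0 * p x) := by gcongr
      _ = _ := by ring
  · simp only [hFz x hx, zero_mul, Finset.sum_const_zero, abs_zero]
    positivity
end UC

namespace UC
variable {n : ℕ}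

lemma limit_arg {W : Set (Fin n → ℝ)} (hW : IsOpen W) {u : (Fin n → ℝ) → ℝ} (hu : Continuous u)
    {x0 : Fin n → ℝ} {ρ r c1 K2 s a0 : ℝ} (hc1 : 0 < c1) (hK2 : 0 ≤ K2) (hs : 0 ≤ s)
    (D : ℝ → (Fin n → ℝ) → ℝ) (hD : ∀ a, a0 ≤ a → MeasureTheory.Integrable (D a))
    (hz : ∀ a, a0 ≤ a → ∫ x in W, D a x = 0)
    (hpt : ∀ a, a0 ≤ a → ∀ x ∈ W,
      c1 * a * Real.exp (-(a * s)) * (Metric.ball x0 ρ).indicator (fun y => u y ^ 2) x ≤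
        2 * a * D a x + K2 * Real.exp (-(2 * (a * s))) *
          (Metric.closedBall x0 r).indicator (fun _ => (1 : ℝ)) x) :
    ∀ x ∈ W, x ∈ Metric.ball x0 ρ → u x = 0 := by
  have iu0 : MeasureTheory.IntegrableOn (fun y => u y ^ 2) (Metric.ball x0 ρ) :=
    ((hu.pow 2).continuousOn.integrableOn_compact (isCompact_closedBall x0 ρ)).mono_set
      Metric.ball_subset_closedBall
  have iu : MeasureTheory.Integrable ((Metric.ball x0 ρ).indicator (fun y => u y ^ 2)) :=
    iu0.integrable_indicator measurableSet_ball
  have i1 : MeasureTheory.Integrable ((Metric.closedBall x0 r).indicator (fun _ => (1 : ℝ))) :=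
    (MeasureTheory.integrableOn_const (isCompact_closedBall x0 r).measure_lt_top.ne).integrable_indicator
      measurableSet_closedBall
  set J := ∫ x in W, (Metric.ball x0 ρ).indicator (fun y => u y ^ 2) x with hJ
  set V := ∫ x in W, (Metric.closedBall x0 r).indicator (fun _ => (1 : ℝ)) x with hV
  have hJ0 : 0 ≤ J := MeasureTheory.integral_nonneg fun x =>
    Set.indicator_nonneg (fun y _ => sq_nonneg _) x
  have hV0 : 0 ≤ V := MeasureTheory.integral_nonneg fun x =>
    Set.indicator_nonneg (fun y _ => zero_le_one) x
  have hb : ∀ a, a0 ≤ a → 0 ≤ a → c1 * a * J ≤ K2 * V := by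
    intro a ha ha0
    have hint : ∫ x in W, c1 * a * Real.exp (-(a * s)) * (Metric.ball x0 ρ).indicator (fun y => u y ^ 2) x ≤
        ∫ x in W, (2 * a * D a x + K2 * Real.exp (-(2 * (a * s))) *
          (Metric.closedBall x0 r).indicator (fun _ => (1 : ℝ)) x) := by
      refine MeasureTheory.setIntegral_mono_on (iu.const_mul _).integrableOn ?_ hW.measurableSet (hpt a ha)
      exact (((hD a ha).const_mul _).add (i1.const_mul _)).integrableOn
    rw [MeasureTheory.integral_add ((hD a ha).const_mul _).integrableOn (i1.const_mul _).integrableOn,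
      MeasureTheory.integral_const_mul, MeasureTheory.integral_const_mul,
      MeasureTheory.integral_const_mul, hz a ha, ← hJ, ← hV, mul_zero, zero_add] at hint
    have he : Real.exp (-(2 * (a * s))) = Real.exp (-(a * s)) * Real.exp (-(a * s)) := by
      rw [← Real.exp_add]; ring_nf
    have hpos := Real.exp_pos (-(a * s))
    have hle : Real.exp (-(a * s)) ≤ 1 := by
      rw [Real.exp_le_one_iff]; have := mul_nonneg ha0 hs; linarith
    rw [he] at hint
    set e := Real.exp (-(a * s))
    have : e * (c1 * a * J) ≤ e * (K2 * V) := by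
      have : e * (K2 * V * e) ≤ e * (K2 * V) := by
        refine mul_le_mul_of_nonneg_left ?_ hpos.le
        have := mul_nonneg hK2 hV0
        nlinarith
      nlinarith
    exact le_of_mul_le_mul_left this hpos
  have hJ00 : J = 0 := by
    by_contra hne
    have hJp : 0 < J := lt_of_le_of_ne hJ0 (Ne.symm hne)
    set a := max a0 0 + K2 * V / (c1 * J) + 1 with ha
    have hq : 0 ≤ K2 * V / (c1 * J) := by positivity
    have := hb a (by have := le_max_left a0 0; linarith) (by have := le_max_right a0 0; linarith)
    have h2 : K2 * V / (c1 * J) < a := by have := le_max_right a0 0; linarith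
    rw [div_lt_iff₀ (by positivity)] at h2
    nlinarith
  have hJ2 : ∫ x in W ∩ Metric.ball x0 ρ, u x ^ 2 = 0 := by
    rw [hJ, MeasureTheory.setIntegral_indicator measurableSet_ball] at hJ00
    exact hJ00
  rw [MeasureTheory.setIntegral_eq_zero_iff_of_nonneg_ae
    (Filter.Eventually.of_forall fun x => sq_nonneg _)
    (iu0.mono_set Set.inter_subset_right)] at hJ2
  have := MeasureTheory.Measure.eqOn_open_of_ae_eq hJ2 (hW.inter Metric.isOpen_ball)
    (hu.pow 2).continuousOn continuousOn_const
  intro x hx hxb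
  have h := this ⟨hx, hxb⟩
  simpa using h

lemma pd_zero {j : Fin n} {f : (Fin n → ℝ) → ℝ} {x : Fin n → ℝ} (h : f =ᶠ[nhds x] fun _ => 0) :
    pd j f x = 0 := by
  rw [pd_congr h]; simp [pd]

lemma Ff_zero {Q : (Fin n → ℝ) → Fin n → Fin n → ℝ} {h v : (Fin n → ℝ) → ℝ} {a w : ℝ}
    {x : Fin n → ℝ} (hv : v =ᶠ[nhds x] fun _ => 0) (j : Fin n) : Ff Q h a w v j x = 0 := by
  have h1 : ∀ j, pd j v x = 0 := fun j => pd_zero hv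
  have h2 : v x = 0 := hv.eq_of_nhds
  simp [Ff, Pf, Xf, h1, h2]

lemma Lf_congr {Q : (Fin n → ℝ) → Fin n → Fin n → ℝ} {f g : (Fin n → ℝ) → ℝ}
    {x : Fin n → ℝ} (h : f =ᶠ[nhds x] g) : Lf Q f x = Lf Q g x := by
  unfold Lf
  refine Finset.sum_congr rfl fun j _ => pd_congr ?_
  have : ∀ᶠ y in nhds x, ∀ k, pd k f y = pd k g y := 
    Filter.eventually_all.2 fun k => pd_congr' h
  filter_upwards [this] with y hy
  simp [Xf, hy]

lemma Lf_zero {Q : (Fin n → ℝ) → Fin n → Fin n → ℝ} {f : (Fin n → ℝ) → ℝ}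
    {x : Fin n → ℝ} (h : f =ᶠ[nhds x] fun _ => 0) : Lf Q f x = 0 := by
  rw [Lf_congr h]
  have : ∀ j, Xf Q (fun _ => (0 : ℝ)) j = fun _ => 0 := by
    intro j; funext y; simp [Xf, pd]
  simp [Lf, this, pd]

lemma bdd_closedBall {f : (Fin n → ℝ) → ℝ} (hf : Continuous f) (x0 : Fin n → ℝ) (r : ℝ) :
    ∃ K, 0 ≤ K ∧ ∀ x ∈ Metric.closedBall x0 r, f x ≤ K := by
  obtain ⟨K, hK⟩ := (isCompact_closedBall x0 r).bddAbove_image hf.continuousOn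
  exact ⟨max K 0, le_max_right _ _, fun x hx => (hK ⟨x, hx, rfl⟩).trans (le_max_left _ _)⟩

lemma hw_le {p m : (Fin n → ℝ) → ℝ} {x0 x : Fin n → ℝ} {M : ℝ} (hp : 0 < p x) (hm : 0 < m x)
    (hp1 : M * p x < 1) (hm1 : M * m x < 1) : hw p m x0 M x ≤ - ‖x - x0‖ ^ 2 := by
  have := norm_sq_le_sum (x - x0)
  unfold hw hz sqd
  simp only [Pi.sub_apply] at this
  nlinarith

end UC

namespace UC
variable {n : ℕ}

/-- pointwise estimate for the cut-off function -/
lemma pointwise {Q : (Fin n → ℝ) → Fin n → Fin n → ℝ} (hQ : ∀ j k, ContDiff ℝ 1 (fun x => Q x j k))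
    {p m h u ut v : (Fin n → ℝ) → ℝ} (hh : ContDiff ℝ 2 h) (hut : ContDiff ℝ 2 ut)
    {x0 : Fin n → ℝ} {r ρ a w c G0 G1 K2 C2 : ℝ}
    (hv : v = fun y => Real.exp (a * h y) * ut y)
    (hs : ∀ x ∈ Metric.closedBall x0 r, ∀ j k, Q x j k = Q x k j)
    (hc : 0 < c) (ha : 1 ≤ a) (haG : G0 ≤ c * a) (hG1n : 0 ≤ G1)
    (haC : C2 ≤ c / (2 * G1 + 1) / 2 * a) (hK2n : 0 ≤ K2) (hr : 0 < r)
    (hG0 : ∀ x ∈ Metric.closedBall x0 r, (Lf Q h x - w) ^ 2 ≤ G0)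
    (hG1 : ∀ x ∈ Metric.closedBall x0 r, ∑ j, pd j h x ^ 2 ≤ G1)
    (hK2 : ∀ x ∈ Metric.closedBall x0 r, Lf Q ut x ^ 2 ≤ K2)
    (h1 : ∀ x ∈ Metric.closedBall x0 r, ∀ ξ, c * ∑ j, ξ j ^ 2 ≤ Hf Q h x ξ - (Lf Q h x - w) * qf Q x ξ)
    (h2 : ∀ x ∈ Metric.closedBall x0 r, c ≤ Hf Q h x (fun j => pd j h x) + (Lf Q h x - w) * Pf Q h h x)
    (hle : ∀ x ∈ Metric.closedBall x0 r, 0 < p x → 0 < m x → h x ≤ - ‖x - x0‖ ^ 2)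
    (hineq : ∀ x ∈ Metric.closedBall x0 r, 0 < p x → 0 < m x →
      Lf Q u x ^ 2 ≤ C2 * (∑ j, pd j u x ^ 2 + u x ^ 2))
    (hρ : ρ ≤ r / 2) (hρh : ∀ x ∈ Metric.ball x0 ρ, - (r ^ 2 / 8) ≤ h x)
    (heq : ∀ x ∈ Metric.ball x0 (r / 2), ut =ᶠ[nhds x] u)
    (hzero : ∀ x, x ∉ Metric.closedBall x0 r → ut =ᶠ[nhds x] fun _ => 0)
    {x : Fin n → ℝ} (hpx : 0 < p x) (hmx : 0 < m x) :
    c / (2 * G1 + 1) / 2 * a * Real.exp (-(a * (r ^ 2 / 4))) *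
        (Metric.ball x0 ρ).indicator (fun y => u y ^ 2) x ≤
      2 * a * ∑ j, pd j (Ff Q h a w v j) x + K2 * Real.exp (-(2 * (a * (r ^ 2 / 4)))) *
          (Metric.closedBall x0 r).indicator (fun _ => (1 : ℝ)) x := by
  set c1 := c / (2 * G1 + 1) with hc1
  have hc1p : 0 < c1 := by positivity
  by_cases hx : x ∈ Metric.closedBall x0 r
  · have key := carleman_pt hQ hh hut (hs x hx) hv hc ha haG (hG0 x hx) (hG1 x hx) (h1 x hx) (h2 x hx)
    rw [← hc1] at key
    rw [Set.indicator_of_mem hx, mul_one]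
    have he2 : Real.exp (a * h x) ^ 2 = Real.exp (2 * (a * h x)) := by
      rw [← Real.exp_nat_mul]; norm_num
    have hN : 0 ≤ ∑ j, pd j ut x ^ 2 := Finset.sum_nonneg fun j _ => sq_nonneg _
    by_cases hxi : x ∈ Metric.ball x0 (r / 2)
    · have e0 : ut x = u x := (heq x hxi).eq_of_nhds
      have e1 : ∀ j, pd j ut x = pd j u x := fun j => pd_congr (heq x hxi)
      have e2 : Lf Q ut x = Lf Q u x := Lf_congr (heq x hxi)
      have hi := hineq x hx hpx hmx
      simp only [← e0, ← e1, ← e2] at hi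
      have hS : 0 ≤ ∑ j, pd j ut x ^ 2 + ut x ^ 2 := by positivity
      have hi2 : Real.exp (a * h x) ^ 2 * Lf Q ut x ^ 2 ≤
          Real.exp (a * h x) ^ 2 * (c1 / 2 * a * (∑ j, pd j ut x ^ 2 + ut x ^ 2)) := by
        gcongr
        exact hi.trans (mul_le_mul_of_nonneg_right haC hS)
      have h3 : c1 / 2 * a * Real.exp (a * h x) ^ 2 * (∑ j, pd j ut x ^ 2 + ut x ^ 2) ≤
          2 * a * ∑ j, pd j (Ff Q h a w v j) x := by nlinarith
      have h4 : c1 / 2 * a * Real.exp (-(a * (r ^ 2 / 4))) *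
        (Metric.ball x0 ρ).indicator (fun y => u y ^ 2) x ≤
          c1 / 2 * a * Real.exp (a * h x) ^ 2 * (∑ j, pd j ut x ^ 2 + ut x ^ 2) := by
        by_cases hxρ : x ∈ Metric.ball x0 ρ
        · rw [Set.indicator_of_mem hxρ]
          simp only [← e0]
          have hee : Real.exp (-(a * (r ^ 2 / 4))) ≤ Real.exp (a * h x) ^ 2 := by
            rw [he2]
            apply Real.exp_le_exp.2
            have := hρh x hxρ
            nlinarith
          have : ut x ^ 2 ≤ ∑ j, pd j ut x ^ 2 + ut x ^ 2 := by linarith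
          gcongr
        · rw [Set.indicator_of_notMem hxρ, mul_zero]
          positivity
      have h5 : 0 ≤ K2 * Real.exp (-(2 * (a * (r ^ 2 / 4)))) := by positivity
      linarith
    · have hxρ : x ∉ Metric.ball x0 ρ := fun hh => hxi (Metric.ball_subset_ball hρ hh)
      rw [Set.indicator_of_notMem hxρ, mul_zero]
      have hl : 0 ≤ c1 * a * Real.exp (a * h x) ^ 2 * (∑ j, pd j ut x ^ 2 + ut x ^ 2) := by positivity
      have hee : Real.exp (a * h x) ^ 2 ≤ Real.exp (-(2 * (a * (r ^ 2 / 4)))) := by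
        rw [he2]
        apply Real.exp_le_exp.2
        have h3 := hle x hx hpx hmx
        have h4 : r / 2 ≤ ‖x - x0‖ := by
          rw [Metric.mem_ball, not_lt, dist_eq_norm] at hxi; exact hxi
        have h5 : (r / 2) ^ 2 ≤ ‖x - x0‖ ^ 2 := by gcongr
        nlinarith
      have h6 : Real.exp (a * h x) ^ 2 * Lf Q ut x ^ 2 ≤ Real.exp (-(2 * (a * (r ^ 2 / 4)))) * K2 := by
        gcongr
        exact hK2 x hx
      linarith
  · have hxρ : x ∉ Metric.ball x0 ρ := fun hh => hx (Metric.ball_subset_closedBall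
      (Metric.ball_subset_ball (by linarith) hh))
    rw [Set.indicator_of_notMem hxρ, Set.indicator_of_notMem hx, mul_zero, mul_zero, add_zero]
    have hF : ∀ j, Ff Q h a w v j =ᶠ[nhds x] fun _ => 0 := by
      intro j
      filter_upwards [(hzero x hx).eventuallyEq_nhds] with y hy
      apply Ff_zero
      filter_upwards [hy] with z hz
      simp [hv, hz]
    rw [Finset.sum_eq_zero fun j _ => pd_zero (hF j), mul_zero]

theorem local_uc {Q : (Fin n → ℝ) → Fin n → Fin n → ℝ} (hQ : ∀ j k, ContDiff ℝ 1 (fun x => Q x j k))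
    {p m u : (Fin n → ℝ) → ℝ} (hp : ContDiff ℝ 2 p) (hm : ContDiff ℝ 2 m) (hu : ContDiff ℝ 2 u)
    {x0 : Fin n → ℝ} {r0 c k C2 : ℝ} (hr0 : 0 < r0)
    (hs : ∀ x ∈ Metric.ball x0 r0, ∀ j k, Q x j k = Q x k j)
    (hp0 : p x0 = 0) (hm0 : m x0 = 0)
    (hcp : ∀ x ∈ Metric.ball x0 r0, p x = 0 → Pf Q p p x = 0)
    (hcm : ∀ x ∈ Metric.ball x0 r0, m x = 0 → Pf Q m m x = 0)
    (hpm : Pf Q p m x0 ≠ 0)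
    (hi : LinearIndependent ℝ ![fun j => pd j p x0, fun j => pd j m x0])
    (hc : 0 < c) (hpos : ∀ ξ : Fin n → ℝ, c * ∑ j, ξ j ^ 2 ≤ qf Q x0 ξ +
      k * ((∑ l, Xf Q p l x0 * ξ l) ^ 2 + (∑ l, Xf Q m l x0 * ξ l) ^ 2))
    (hup : ∀ x ∈ Metric.ball x0 r0, p x = 0 → 0 < m x → u x = 0)
    (hum : ∀ x ∈ Metric.ball x0 r0, m x = 0 → 0 < p x → u x = 0)
    (hineq : ∀ x ∈ Metric.ball x0 r0, 0 < p x → 0 < m x →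
      Lf Q u x ^ 2 ≤ C2 * (∑ j, pd j u x ^ 2 + u x ^ 2)) :
    ∃ ρ > 0, ∀ x ∈ Metric.ball x0 ρ, 0 < p x → 0 < m x → u x = 0 := by
  have hx0 : x0 ∈ Metric.ball x0 r0 := Metric.mem_ball_self hr0
  obtain ⟨M, hM, w, c', hc', hev⟩ := weight hQ hp hm (hs x0 hx0) hp0 hm0 (hcp x0 hx0 hp0)
    (hcm x0 hx0 hm0) hpm hc hpos
  set h := hw p m x0 M with hh_def
  have hh : ContDiff ℝ 2 h := contDiff_hw hp hm x0 M
  have hp1 : ContDiff ℝ 1 p := hp.of_le (by norm_num)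
  have hm1 : ContDiff ℝ 1 m := hm.of_le (by norm_num)
  have hi' : LinearIndependent ℝ ![fun j => pd j m x0, fun j => pd j p x0] :=
    LinearIndependent.pair_symm_iff.1 hi
  have hdp0 : fderiv ℝ p x0 ≠ 0 := by
    intro h0
    apply hi.ne_zero 0
    funext j
    simp [pd, h0]
  have hdm0 : fderiv ℝ m x0 ≠ 0 := by
    intro h0
    apply hi.ne_zero 1
    funext j
    simp [pd, h0]
  have ev1 : ∀ᶠ x in nhds x0, fderiv ℝ p x ≠ 0 :=
    (hp1.continuous_fderiv (by norm_num)).continuousAt.eventually_ne hdp0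
  have ev2 : ∀ᶠ x in nhds x0, fderiv ℝ m x ≠ 0 :=
    (hm1.continuous_fderiv (by norm_num)).continuousAt.eventually_ne hdm0
  have ev3 : ∀ᶠ x in nhds x0, M * p x < 1 :=
    (continuous_const.mul hp.continuous).continuousAt.eventually (gt_mem_nhds (by simp [hp0]))
  have ev4 : ∀ᶠ x in nhds x0, M * m x < 1 :=
    (continuous_const.mul hm.continuous).continuousAt.eventually (gt_mem_nhds (by simp [hm0]))
  obtain ⟨r1, hr1, hball⟩ := Metric.eventually_nhds_iff_ball.1
    (hev.and (ev1.and (ev2.and (ev3.and (ev4.and (Metric.ball_mem_nhds x0 hr0))))))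
  obtain ⟨rp, hrp, Kp, hKp, hrp1, hpathp⟩ := path hp1 hm1 hp0 hi hr1
  obtain ⟨rm, hrm, Km, hKm, hrm1, hpathm⟩ := path hm1 hp1 hm0 hi' hr1
  set r := min rp rm / 2 with hr
  have hminp : 0 < min rp rm := lt_min hrp hrm
  have hrpos : 0 < r := by positivity
  have hr_p : r < rp := by have := min_le_left rp rm; linarith
  have hr_m : r < rm := by have := min_le_right rp rm; linarith
  have hsub : Metric.closedBall x0 r ⊆ Metric.ball x0 r1 :=
    Metric.closedBall_subset_ball (by linarith)
  let χ : ContDiffBump x0 := ⟨r / 2, r, by positivity, by linarith⟩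
  set ut : (Fin n → ℝ) → ℝ := fun x => χ x * u x with hut_def
  have hut : ContDiff ℝ 2 ut := χ.contDiff.mul hu
  have heq : ∀ x ∈ Metric.ball x0 (r / 2), ut =ᶠ[nhds x] u := by
    intro x hx
    filter_upwards [χ.eventuallyEq_one_of_mem_ball hx] with y hy
    simp [hut_def, hy]
  have hzero : ∀ x, x ∉ Metric.closedBall x0 r → ut =ᶠ[nhds x] fun _ => 0 := by
    intro x hx
    filter_upwards [Metric.isClosed_closedBall.isOpen_compl.mem_nhds hx] with y hy
    have : χ y = 0 := χ.zero_of_le_dist (by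
      have : ¬ dist y x0 ≤ r := hy
      exact (not_le.1 this).le)
    simp [hut_def, this]
  obtain ⟨G0, hG0n, hG0⟩ := bdd_closedBall (((continuous_Lf hQ hh).sub continuous_const).pow 2 :
    Continuous fun x => (Lf Q h x - w) ^ 2) x0 r
  obtain ⟨G1, hG1n, hG1⟩ := bdd_closedBall (continuous_finsetSum Finset.univ fun j _ =>
    ((contDiff_pd (j := j) hh).continuous.pow 2) : Continuous fun x => ∑ j, pd j h x ^ 2) x0 r
  obtain ⟨K2, hK2n, hK2⟩ := bdd_closedBall ((continuous_Lf hQ hut).pow 2 :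
    Continuous fun x => (Lf Q ut x) ^ 2) x0 r
  have h00 : h x0 = 0 := by simp [hh_def, hw, hz, sqd, hp0, hm0]
  obtain ⟨ρ', hρ', hball'⟩ := Metric.eventually_nhds_iff_ball.1
    (hh.continuous.continuousAt.eventually (lt_mem_nhds (show -(r ^ 2 / 8) < h x0 by
      rw [h00]; have : 0 < r ^ 2 := by positivity
      linarith)))
  refine ⟨min ρ' (r / 2), lt_min hρ' (by positivity), ?_⟩
  set c1 := c' / (2 * G1 + 1) / 2 with hc1
  have hc1p : 0 < c1 := by positivity
  set v : ℝ → (Fin n → ℝ) → ℝ := fun a y => Real.exp (a * h y) * ut y with hv_def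
  have hv : ∀ a, ContDiff ℝ 2 (v a) := fun a =>
    (Real.contDiff_exp.comp (contDiff_const.mul hh)).mul hut
  have hWo : IsOpen {x | 0 < p x ∧ 0 < m x} := (isOpen_lt continuous_const hp.continuous).inter
    (isOpen_lt continuous_const hm.continuous)
  have hF0 : ∀ a x, x ∉ Metric.closedBall x0 r → ∀ j, Ff Q h a w (v a) j x = 0 := by
    intro a x hx j
    apply Ff_zero
    filter_upwards [hzero x hx] with z hz
    simp [hv_def, hz]
  have hFc : ∀ a j, HasCompactSupport (Ff Q h a w (v a) j) := fun a j =>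
    HasCompactSupport.intro (isCompact_closedBall x0 r) fun x hx => hF0 a x hx j
  have hFC : ∀ a j, ContDiff ℝ 1 (Ff Q h a w (v a) j) := fun a j => contDiff_Ff hQ hh (hv a) a w j
  have hfin := limit_arg (W := {x | 0 < p x ∧ 0 < m x}) hWo hu.continuous (x0 := x0)
    (ρ := min ρ' (r / 2)) (r := r) (c1 := c1) (K2 := K2) (s := r ^ 2 / 4)
    (a0 := 1 + G0 / c' + |C2| / c1) hc1p hK2n (by positivity)
    (fun a x => ∑ j, pd j (Ff Q h a w (v a) j) x) ?_ ?_ ?_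
  · intro x hx h1 h2
    exact hfin x ⟨h1, h2⟩ hx
  · intro a ha
    refine MeasureTheory.integrable_finsetSum _ fun j _ => ?_
    refine (continuous_pd (hFC a j)).integrable_of_hasCompactSupport ?_
    exact ((hFc a j).fderiv ℝ).comp_left (g := fun L => L (Pi.single j 1)) (by simp)
  · intro a ha
    obtain ⟨K1, hK1n, hK1⟩ := flux_bdry hQ hp hm hh (hv a) a w (hFc a) hKp hpathp
      (fun x hx j => hF0 a x (fun hx' => hx (Metric.closedBall_subset_ball hr_p hx')) j)
      (fun z hz => (hball z hz).2.1) (fun z hz => hcp z (hball z hz).2.2.2.2.2)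
      (fun z hz h1 h2 => by
        simp [hv_def, hut_def, hup z (hball z hz).2.2.2.2.2 h1 h2])
    obtain ⟨K1', hK1n', hK1'⟩ := flux_bdry hQ hm hp hh (hv a) a w (hFc a) hKm hpathm
      (fun x hx j => hF0 a x (fun hx' => hx (Metric.closedBall_subset_ball hr_m hx')) j)
      (fun z hz => (hball z hz).2.2.1) (fun z hz => hcm z (hball z hz).2.2.2.2.2)
      (fun z hz h1 h2 => by
        simp [hv_def, hut_def, hum z (hball z hz).2.2.2.2.2 h1 h2])
    refine flux_zero (hFC a) (hFc a) hp1 hm1 (K1 + K1') ?_ ?_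
    · intro x h1 h2
      have := hK1 x h1 h2
      nlinarith
    · intro x h1 h2
      have := hK1' x h2 h1
      nlinarith
  · intro a ha x hx
    have q1 : 0 ≤ G0 / c' := by positivity
    have q2 : 0 ≤ |C2| / c1 := by positivity
    refine pointwise (p := p) (m := m) hQ hh hut (by rfl) (fun x hx => hs x (hball x (hsub hx)).2.2.2.2.2) hc'
      (by linarith) ?_ hG1n ?_ hK2n hrpos hG0 hG1 hK2 (fun x hx => (hball x (hsub hx)).1.1)
      (fun x hx => (hball x (hsub hx)).1.2) ?_ (fun x hx => hineq x (hball x (hsub hx)).2.2.2.2.2)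
      (min_le_right _ _) ?_ heq hzero hx.1 hx.2
    · have : G0 / c' ≤ a := by linarith
      rw [div_le_iff₀ hc'] at this
      linarith
    · have : |C2| / c1 ≤ a := by linarith
      rw [div_le_iff₀ hc1p] at this
      rw [← hc1]; have := le_abs_self C2
      linarith
    · intro x hx h1 h2
      have := hball x (hsub hx)
      exact hw_le h1 h2 this.2.2.2.1 this.2.2.2.2.1
    · intro x hx
      exact (hball' x (Metric.ball_subset_ball (min_le_left _ _) hx)).le

end UC

namespace UC
variable {n : ℕ}

lemma quad_coer {f : (Fin n → ℝ) → ℝ} (hf : Continuous f)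
    (hh : ∀ (t : ℝ) ξ, f (t • ξ) = t ^ 2 * f ξ) (hpos : ∀ ξ, ξ ≠ 0 → 0 < f ξ) :
    ∃ c > 0, ∀ ξ, c * ∑ j, ξ j ^ 2 ≤ f ξ := by
  obtain ⟨d, hd, hd'⟩ := (isCompact_sphere (0 : Fin n → ℝ) 1).exists_forall_le' hf.continuousOn
    (a := 0) (fun ξ hξ => hpos ξ (by rintro rfl; simp at hξ))
  refine ⟨d / (n + 1), by positivity, fun ξ => ?_⟩
  have hsum : ∑ j, ξ j ^ 2 ≤ n * ‖ξ‖ ^ 2 := by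
    calc ∑ j, ξ j ^ 2 ≤ ∑ j : Fin n, ‖ξ‖ ^ 2 := by
          refine Finset.sum_le_sum fun j _ => ?_
          have := norm_le_pi_norm ξ j
          rw [Real.norm_eq_abs] at this
          rw [← sq_abs]
          gcongr
      _ = n * ‖ξ‖ ^ 2 := by simp
  by_cases h0 : ξ = 0
  · have := hh 0 0
    subst h0
    simp at this
    simp [this]
  · have hn : 0 < ‖ξ‖ := norm_pos_iff.2 h0
    have h1 := hd' (‖ξ‖⁻¹ • ξ) (by simp [norm_smul, hn.ne'])
    rw [hh, inv_pow, inv_mul_eq_div, le_div_iff₀ (by positivity)] at h1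
    refine le_trans ?_ h1
    rw [div_mul_eq_mul_div, div_le_iff₀ (by positivity)]
    have : d * ∑ j, ξ j ^ 2 ≤ d * (n * ‖ξ‖ ^ 2) := by gcongr
    have : 0 ≤ d * ‖ξ‖ ^ 2 := by positivity
    linarith

lemma lor_coord {N : ℕ} {f g : Fin (N + 1) → ℝ}
    (hf : ∑ i : Fin N, f i.castSucc ^ 2 < f (Fin.last N) ^ 2)
    (hfg : ∑ i : Fin N, f i.castSucc * g i.castSucc = f (Fin.last N) * g (Fin.last N))
    (hg : g ≠ 0) : g (Fin.last N) ^ 2 < ∑ i : Fin N, g i.castSucc ^ 2 := by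
  have cs := Finset.sum_mul_sq_le_sq_mul_sq Finset.univ (fun i : Fin N => f i.castSucc)
    (fun i => g i.castSucc)
  rw [hfg] at cs
  have hSf : 0 ≤ ∑ i : Fin N, f i.castSucc ^ 2 := Finset.sum_nonneg fun i _ => sq_nonneg _
  have hSg : 0 ≤ ∑ i : Fin N, g i.castSucc ^ 2 := Finset.sum_nonneg fun i _ => sq_nonneg _
  rcases hSg.eq_or_lt with h0 | h0
  · exfalso
    apply hg
    rw [← h0, mul_zero] at cs
    have h1 : f (Fin.last N) * g (Fin.last N) = 0 := by
      have := sq_nonneg (f (Fin.last N) * g (Fin.last N))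
      exact pow_eq_zero_iff (two_ne_zero) |>.1 (le_antisymm cs this)
    have h2 : f (Fin.last N) ≠ 0 := by
      intro h; rw [h] at hf; norm_num at hf; linarith
    have h3 : g (Fin.last N) = 0 := (mul_eq_zero.1 h1).resolve_left h2
    have h4 := (Finset.sum_eq_zero_iff_of_nonneg (fun i _ => sq_nonneg _)).1 h0.symm
    funext i
    refine Fin.lastCases ?_ (fun i => ?_) i
    · exact h3
    · simpa using h4 i (Finset.mem_univ i)
  · by_contra hcon
    rw [not_lt] at hcon
    nlinarith [mul_lt_mul_of_pos_right hf h0, mul_le_mul_of_nonneg_left hcon (sq_nonneg (f (Fin.last N)))]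

/-- bilinear form -/
noncomputable def bf (A : Fin n → Fin n → ℝ) (ξ η : Fin n → ℝ) : ℝ := ∑ l, (∑ k, A l k * ξ k) * η l

lemma bf_eq (A : Fin n → Fin n → ℝ) (ξ η : Fin n → ℝ) : bf A ξ η = η ⬝ᵥ (Matrix.of A *ᵥ ξ) := by
  simp [bf, dotProduct, mulVec, mul_comm]

lemma lor_orth {A : Fin n → Fin n → ℝ} {R : Matrix (Fin n) (Fin n) ℝ} (hR : IsUnit R)
    (hRA : Rᵀ * Matrix.of A * R
          = Matrix.diagonal (fun i : Fin n => if (i : ℕ) < n - 1 then (1 : ℝ) else -1))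
    {e η : Fin n → ℝ} (he : bf A e e < 0) (heη : bf A η e = 0) (hη : η ≠ 0) : 0 < bf A η η := by
  obtain ⟨f, rfl⟩ : ∃ f, R *ᵥ f = e := ⟨R⁻¹ *ᵥ e, by
    rw [mulVec_mulVec, Matrix.mul_nonsing_inv _ ((Matrix.isUnit_iff_isUnit_det _).1 hR), one_mulVec]⟩
  obtain ⟨g, rfl⟩ : ∃ f, R *ᵥ f = η := ⟨R⁻¹ *ᵥ η, by
    rw [mulVec_mulVec, Matrix.mul_nonsing_inv _ ((Matrix.isUnit_iff_isUnit_det _).1 hR), one_mulVec]⟩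
  have key : ∀ s t : Fin n → ℝ, bf A (R *ᵥ s) (R *ᵥ t) =
      ∑ i : Fin n, t i * ((if (i : ℕ) < n - 1 then (1 : ℝ) else -1) * s i) := by
    intro s t
    have : (R *ᵥ t) ⬝ᵥ (Matrix.of A *ᵥ (R *ᵥ s)) = t ⬝ᵥ ((Rᵀ * Matrix.of A * R) *ᵥ s) := by
      rw [← mulVec_mulVec, ← mulVec_mulVec, Matrix.dotProduct_mulVec t, Matrix.vecMul_transpose]
    rw [bf_eq, this, hRA]
    simp [dotProduct, mulVec_diagonal]
  rw [key] at he heη ⊢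
  have hg : g ≠ 0 := by rintro rfl; simp at hη
  cases n with
  | zero => simp at he
  | succ N =>
    rw [Fin.sum_univ_castSucc] at he heη ⊢
    simp at he heη ⊢
    have := lor_coord (f := f) (g := g) (by simp only [pow_two]; linarith) (by linarith) hg
    simp only [pow_two] at this
    linarith

lemma bf_comm {A : Fin n → Fin n → ℝ} (hA : ∀ j k, A j k = A k j) (ξ η : Fin n → ℝ) :
    bf A ξ η = bf A η ξ := by
  unfold bf
  simp only [Finset.sum_mul]
  rw [Finset.sum_comm]
  refine Finset.sum_congr rfl fun j _ => Finset.sum_congr rfl fun k _ => ?_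
  rw [hA]; ring

lemma bf_add (A : Fin n → Fin n → ℝ) (ξ ξ' η : Fin n → ℝ) :
    bf A (ξ + ξ') η = bf A ξ η + bf A ξ' η := by
  simp [bf_eq, mulVec_add]

lemma bf_smul (A : Fin n → Fin n → ℝ) (t : ℝ) (ξ η : Fin n → ℝ) :
    bf A (t • ξ) η = t * bf A ξ η := by
  simp [bf_eq, mulVec_smul]

lemma lor_pos {A : Fin n → Fin n → ℝ} (hA : ∀ j k, A j k = A k j)
    {R : Matrix (Fin n) (Fin n) ℝ} (hR : IsUnit R)
    (hRA : Rᵀ * Matrix.of A * R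
          = Matrix.diagonal (fun i : Fin n => if (i : ℕ) < n - 1 then (1 : ℝ) else -1))
    {e : Fin n → ℝ} (he : bf A e e < 0) :
    ∃ c > 0, ∃ k ≥ 0, ∀ ξ : Fin n → ℝ, c * ∑ j, ξ j ^ 2 ≤ bf A ξ ξ + k * bf A e ξ ^ 2 := by
  set b := - bf A e e with hb
  have hbp : 0 < b := by linarith
  have hcont : Continuous fun ξ => bf A ξ ξ + 2 / b * bf A e ξ ^ 2 := by
    unfold bf; fun_prop
  obtain ⟨c, hc, hc'⟩ := quad_coer hcont (by
    intro t ξ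
    simp only [bf_comm hA e, bf_smul]
    rw [bf_comm hA ξ (t • ξ), bf_smul]; ring) (by
    intro ξ hξ
    set B := bf A e ξ with hB
    have hB' : bf A ξ e = B := bf_comm hA _ _
    set η := ξ + (B / b) • e with hη
    have h1 : bf A η e = 0 := by
      rw [hη, bf_add, bf_smul, hB', show bf A e e = -b by linarith]
      field_simp
      ring
    have h2 : bf A ξ ξ = bf A η η - B ^ 2 / b := by
      have h3 : bf A η η = bf A η ξ := by
        conv_lhs => rw [bf_comm hA, hη, bf_add, bf_smul, bf_comm hA e, ← hη, h1]
        rw [bf_comm hA ξ]; ring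
      rw [h3, hη, bf_add, bf_smul, ← hB]; field_simp; ring
    rw [h2]
    have h4 : 2 / b * B ^ 2 = 2 * (B ^ 2 / b) := by ring
    rw [h4]
    by_cases hB0 : B = 0
    · have : η = ξ := by simp [hη, hB0]
      have := lor_orth hR hRA he h1 (this ▸ hξ)
      have : 0 ≤ B ^ 2 / b := by positivity
      linarith
    · have h5 : 0 < B ^ 2 / b := by positivity
      by_cases h0 : η = 0
      · have : bf A η η = 0 := by rw [h0]; simp [bf]
        linarith
      · have := lor_orth hR hRA he h1 h0
        linarith)
  exact ⟨c, hc, 2 / b, by positivity, hc'⟩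

lemma hpos_of {Q : (Fin n → ℝ) → Fin n → Fin n → ℝ} {p m : (Fin n → ℝ) → ℝ} {x0 : Fin n → ℝ}
    (hs : ∀ j k, Q x0 j k = Q x0 k j) {R : Matrix (Fin n) (Fin n) ℝ} (hR : IsUnit R)
    (hRA : Rᵀ * Matrix.of (Q x0) * R
          = Matrix.diagonal (fun i : Fin n => if (i : ℕ) < n - 1 then (1 : ℝ) else -1))
    (hpp : Pf Q p p x0 = 0) (hmm : Pf Q m m x0 = 0) (hpm : 0 < Pf Q p m x0) :
    ∃ c > 0, ∃ k, ∀ ξ : Fin n → ℝ, c * ∑ j, ξ j ^ 2 ≤ qf Q x0 ξ +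
      k * ((∑ l, Xf Q p l x0 * ξ l) ^ 2 + (∑ l, Xf Q m l x0 * ξ l) ^ 2) := by
  set P : Fin n → ℝ := fun j => pd j p x0
  set Mv : Fin n → ℝ := fun j => pd j m x0
  have e1 : bf (Q x0) P P = 0 := hpp
  have e2 : bf (Q x0) Mv Mv = 0 := hmm
  have e3 : 0 < bf (Q x0) P Mv := hpm
  have e4 : ∀ ξ, bf (Q x0) (P + (-1 : ℝ) • Mv) ξ = bf (Q x0) P ξ - bf (Q x0) Mv ξ := by
    intro ξ; rw [bf_add, bf_smul]; ring
  have he : bf (Q x0) (P + (-1 : ℝ) • Mv) (P + (-1 : ℝ) • Mv) < 0 := by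
    rw [e4, bf_comm hs P, bf_comm hs Mv, e4, e4, e1, e2, bf_comm hs Mv]
    linarith
  obtain ⟨c, hc, k, hk, h⟩ := lor_pos hs hR hRA he
  refine ⟨c, hc, 2 * k, fun ξ => (h ξ).trans ?_⟩
  have f1 : bf (Q x0) ξ ξ = qf Q x0 ξ := rfl
  have f2 : bf (Q x0) P ξ = ∑ l, Xf Q p l x0 * ξ l := rfl
  have f3 : bf (Q x0) Mv ξ = ∑ l, Xf Q m l x0 * ξ l := rfl
  rw [e4, f1, f2, f3]
  set α := ∑ l, Xf Q p l x0 * ξ l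
  set β := ∑ l, Xf Q m l x0 * ξ l
  nlinarith [mul_nonneg hk (sq_nonneg (α + β))]

end UC

namespace UC
variable {n : ℕ}

lemma glob {𝒰 : Set (Fin n → ℝ)} (h𝒰 : IsOpen 𝒰) {k : ℕ} {f : (Fin n → ℝ) → ℝ}
    (hf : ContDiffOn ℝ k f 𝒰) {x0 : Fin n → ℝ} {r : ℝ} (hr : 0 < r)
    (hsub : Metric.closedBall x0 r ⊆ 𝒰) :
    ∃ g : (Fin n → ℝ) → ℝ, ContDiff ℝ k g ∧ ∀ x ∈ Metric.ball x0 (r / 2), g x = f x := by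
  let χ : ContDiffBump x0 := ⟨r / 2, r, by positivity, by linarith⟩
  refine ⟨fun x => χ x * f x, ?_, ?_⟩
  · rw [contDiff_iff_contDiffAt]
    intro x
    by_cases hx : x ∈ 𝒰
    · exact χ.contDiffAt.mul (hf.contDiffAt (h𝒰.mem_nhds hx))
    · have hx' : x ∉ tsupport χ := by
        rw [χ.tsupport_eq]; exact fun h => hx (hsub h)
      have : (fun x => χ x * f x) =ᶠ[nhds x] fun _ => 0 := by
        filter_upwards [notMem_tsupport_iff_eventuallyEq.1 hx'] with y hy
        simp [hy]
      exact contDiffAt_const.congr_of_eventuallyEq this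
  · intro x hx
    have : χ x = 1 := χ.one_of_mem_closedBall (Metric.ball_subset_closedBall hx)
    simp [this]

lemma mem_frontier_of {𝒰 : Set (Fin n → ℝ)} (h𝒰 : IsOpen 𝒰) {p m : (Fin n → ℝ) → ℝ}
    {z : Fin n → ℝ} (hz : z ∈ 𝒰) (hmc : ContinuousAt m z) (hpz : p z = 0) (hmz : 0 < m z)
    (hd : (fun j => pd j p z) ≠ 0) : z ∈ frontier {x ∈ 𝒰 | 0 < p x ∧ 0 < m x} := by
  refine ⟨?_, fun hi => ?_⟩
  · by_contra hcl
    have hev : ∀ᶠ y in nhds z, y ∉ {x ∈ 𝒰 | 0 < p x ∧ 0 < m x} := by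
      filter_upwards [isClosed_closure.isOpen_compl.mem_nhds hcl] with y hy hy'
      exact hy (subset_closure hy')
    have hmax : IsLocalMax p z := by
      filter_upwards [hev, h𝒰.mem_nhds hz, hmc.eventually (lt_mem_nhds hmz)] with y h1 h2 h3
      rw [hpz]
      by_contra hcon
      exact h1 ⟨h2, not_le.1 hcon, h3⟩
    apply hd
    funext j
    simp [pd, hmax.fderiv_eq_zero]
  · have := (interior_subset hi).2.1
    rw [hpz] at this
    exact lt_irrefl _ this

lemma Lf_bound {Q : (Fin n → ℝ) → Fin n → Fin n → ℝ} (hQ : ∀ j k, ContDiff ℝ 1 (fun x => Q x j k))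
    {u : (Fin n → ℝ) → ℝ} (hu : ContDiff ℝ 2 u) (x0 : Fin n → ℝ) (r C : ℝ) :
    ∃ C2, ∀ x ∈ Metric.closedBall x0 r,
      |∑ j, ∑ k, Q x j k * pd j (pd k u) x| ≤ C * (Real.sqrt (∑ j, pd j u x ^ 2) + |u x|) →
      Lf Q u x ^ 2 ≤ C2 * (∑ j, pd j u x ^ 2 + u x ^ 2) := by
  have hcont : Continuous fun x => ∑ k, (∑ j, pd j (fun y => Q y j k) x) ^ 2 := by
    refine continuous_finsetSum _ fun k _ => (continuous_finsetSum _ fun j _ => ?_).pow 2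
    exact continuous_pd (hQ j k)
  obtain ⟨K, hK0, hK⟩ := bdd_closedBall hcont x0 r
  refine ⟨2 * K + 4 * C ^ 2, fun x hx hS => ?_⟩
  have hL : Lf Q u x = ∑ k, (∑ j, pd j (fun y => Q y j k) x) * pd k u x +
      ∑ j, ∑ k, Q x j k * pd j (pd k u) x := by
    unfold Lf
    simp only [pd_Xf hQ hu, Finset.sum_add_distrib, Finset.sum_mul]
    rw [Finset.sum_comm]
  rw [hL]
  set N := ∑ j, pd j u x ^ 2
  have hN : 0 ≤ N := Finset.sum_nonneg fun j _ => sq_nonneg _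
  set S := ∑ j, ∑ k, Q x j k * pd j (pd k u) x
  have hD : (∑ k, (∑ j, pd j (fun y => Q y j k) x) * pd k u x) ^ 2 ≤ K * N := by
    refine (Finset.sum_mul_sq_le_sq_mul_sq _ _ _).trans ?_
    exact mul_le_mul_of_nonneg_right (hK x hx) hN
  set D := ∑ k, (∑ j, pd j (fun y => Q y j k) x) * pd k u x
  have hS2 : S ^ 2 ≤ (C * (Real.sqrt N + |u x|)) ^ 2 := by
    rw [← sq_abs]; gcongr
  have h1 : (Real.sqrt N + |u x|) ^ 2 ≤ 2 * (N + u x ^ 2) := by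
    have := Real.sq_sqrt hN
    have := sq_abs (u x)
    nlinarith [sq_nonneg (Real.sqrt N - |u x|)]
  have h2 : S ^ 2 ≤ C ^ 2 * (2 * (N + u x ^ 2)) := by
    refine hS2.trans ?_
    rw [mul_pow]; gcongr
  nlinarith [sq_nonneg (D - S), mul_nonneg hK0 (sq_nonneg (u x))]

end UC

theorem unique_continuation_transversal_characteristic
    (n : ℕ) (hn : 3 ≤ n)
    (𝒰 : Set (Fin n → ℝ)) (h𝒰 : IsOpen 𝒰)
    (Q : (Fin n → ℝ) → Fin n → Fin n → ℝ)
    (hQreg : ContDiffOn ℝ 1 Q 𝒰)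
    (hQsym : ∀ x ∈ 𝒰, ∀ j k, Q x j k = Q x k j)
    (hQsig : ∀ x ∈ 𝒰, ∃ R : Matrix (Fin n) (Fin n) ℝ, IsUnit R ∧
        Rᵀ * Matrix.of (Q x) * R
          = Matrix.diagonal (fun i : Fin n => if (i : ℕ) < n - 1 then (1 : ℝ) else -1))
    (φp φm : (Fin n → ℝ) → ℝ)
    (hφp : ContDiffOn ℝ 2 φp 𝒰) (hφm : ContDiffOn ℝ 2 φm 𝒰)
    -- gradients of the defining functions
    (gp gm : (Fin n → ℝ) → Fin n → ℝ)
    (hgp : gp = fun x j => fderiv ℝ φp x (Pi.single j 1))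
    (hgm : gm = fun x j => fderiv ℝ φm x (Pi.single j 1))
    -- `dφ± ≠ 0` on `{φ± = 0}`
    (hdp : ∀ x ∈ 𝒰, φp x = 0 → gp x ≠ 0)
    (hdm : ∀ x ∈ 𝒰, φm x = 0 → gm x ≠ 0)
    -- transversality on `Σ₊ ∩ Σ₋`
    (htrans : ∀ x ∈ 𝒰, φp x = 0 → φm x = 0 → LinearIndependent ℝ ![gp x, gm x])
    (Ω Sp Sm : Set (Fin n → ℝ))
    (hΩ : Ω = {x ∈ 𝒰 | 0 < φp x ∧ 0 < φm x})
    (hSp : Sp = {x ∈ 𝒰 | φp x = 0}) (hSm : Sm = {x ∈ 𝒰 | φm x = 0})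
    -- both hypersurfaces are characteristic
    (hcharp : ∀ x ∈ Sp, ∑ j, ∑ k, Q x j k * gp x j * gp x k = 0)
    (hcharm : ∀ x ∈ Sm, ∑ j, ∑ k, Q x j k * gm x j * gm x k = 0)
    -- the sign condition on `Σ₊ ∩ Σ₋`
    (hsign : ∀ x ∈ Sp ∩ Sm, 0 < ∑ j, ∑ k, Q x j k * gp x j * gm x k)
    (u : (Fin n → ℝ) → ℝ) (hu : ContDiffOn ℝ 2 u 𝒰)
    (hubd : ∀ x ∈ 𝒰, x ∈ frontier Ω → u x = 0)
    (C : ℝ) (hC : 0 ≤ C)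
    (hineq : ∀ x ∈ Ω,
      |∑ j, ∑ k, Q x j k * iteratedFDeriv ℝ 2 u x ![Pi.single j 1, Pi.single k 1]|
        ≤ C * (Real.sqrt (∑ j, (fderiv ℝ u x (Pi.single j 1)) ^ 2) + |u x|)) :
    ∃ V : Set (Fin n → ℝ), IsOpen V ∧ Sp ∩ Sm ⊆ V ∧ ∀ x ∈ Ω ∩ V, u x = 0 := by
  have main : ∀ x0 ∈ Sp ∩ Sm, ∃ ρ > 0, ∀ x ∈ Metric.ball x0 ρ, x ∈ Ω → u x = 0 := by
    intro x0 hx0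
    have hsgn := hsign x0 hx0
    have hx0p := hx0.1
    have hx0m := hx0.2
    rw [hSp] at hx0p
    rw [hSm] at hx0m
    obtain ⟨hx0U, hp0⟩ := hx0p
    have hm0 := hx0m.2
    obtain ⟨r', hr', hsub'⟩ := Metric.isOpen_iff.1 h𝒰 x0 hx0U
    set r := r' / 2 with hr
    have hrp : 0 < r := by positivity
    have hsub : Metric.closedBall x0 r ⊆ 𝒰 :=
      (Metric.closedBall_subset_ball (by linarith)).trans hsub'
    obtain ⟨p, hpC, hpe⟩ := UC.glob h𝒰 (k := 2) hφp hrp hsub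
    obtain ⟨m, hmC, hme⟩ := UC.glob h𝒰 (k := 2) hφm hrp hsub
    obtain ⟨ut, hutC, hute⟩ := UC.glob h𝒰 (k := 2) hu hrp hsub
    have hQ1 : ∀ j k, ContDiffOn ℝ 1 (fun x => Q x j k) 𝒰 := fun j k =>
      contDiffOn_pi.1 (contDiffOn_pi.1 hQreg j) k
    choose Qf hQfC hQfe using fun j k => UC.glob h𝒰 (k := 1) (hQ1 j k) hrp hsub
    set Qt : (Fin n → ℝ) → Fin n → Fin n → ℝ := fun x j k => Qf j k x with hQt
    have hQtC : ∀ j k, ContDiff ℝ 1 (fun x => Qt x j k) := fun j k => hQfC j k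
    set r0 := r / 2 with hr0
    have hr0p : 0 < r0 := by positivity
    have hBU : Metric.ball x0 r0 ⊆ 𝒰 := fun x hx =>
      hsub (Metric.ball_subset_closedBall (Metric.ball_subset_ball (by linarith) hx))
    have hQe : ∀ x ∈ Metric.ball x0 r0, Qt x = Q x := by
      intro x hx; funext j k; exact hQfe j k x hx
    have ev : ∀ {f g : (Fin n → ℝ) → ℝ}, (∀ x ∈ Metric.ball x0 r0, f x = g x) →
        ∀ x ∈ Metric.ball x0 r0, f =ᶠ[nhds x] g := by
      intro f g h x hx
      filter_upwards [Metric.isOpen_ball.mem_nhds hx] with y hy using h y hy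
    have hgpe : ∀ x ∈ Metric.ball x0 r0, (fun j => UC.pd j p x) = gp x := by
      intro x hx; funext j; rw [UC.pd_congr (ev hpe x hx), hgp]; rfl
    have hgme : ∀ x ∈ Metric.ball x0 r0, (fun j => UC.pd j m x) = gm x := by
      intro x hx; funext j; rw [UC.pd_congr (ev hme x hx), hgm]; rfl
    have hPf : ∀ x, ∀ f g : (Fin n → ℝ) → ℝ, (∀ j k, Qt x j k = Qt x k j) → UC.Pf Qt f g x =
        ∑ j, ∑ k, Qt x j k * UC.pd j f x * UC.pd k g x := by
      intro x f g hs
      unfold UC.Pf UC.Xf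
      simp only [Finset.sum_mul]
      rw [Finset.sum_comm]
      refine Finset.sum_congr rfl fun j _ => Finset.sum_congr rfl fun k _ => ?_
      rw [hs]
    have hs : ∀ x ∈ Metric.ball x0 r0, ∀ j k, Qt x j k = Qt x k j := by
      intro x hx j k
      rw [hQe x hx]; exact hQsym x (hBU hx) j k
    have hx0B : x0 ∈ Metric.ball x0 r0 := Metric.mem_ball_self hr0p
    have hcp : ∀ x ∈ Metric.ball x0 r0, p x = 0 → UC.Pf Qt p p x = 0 := by
      intro x hx hpx
      rw [hPf x p p (hs x hx), hQe x hx]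
      simp only [fun j => congrFun (hgpe x hx) j]
      exact hcharp x (by rw [hSp]; exact ⟨hBU hx, by rw [← hpe x hx, hpx]⟩)
    have hcm : ∀ x ∈ Metric.ball x0 r0, m x = 0 → UC.Pf Qt m m x = 0 := by
      intro x hx hpx
      rw [hPf x m m (hs x hx), hQe x hx]
      simp only [fun j => congrFun (hgme x hx) j]
      exact hcharm x (by rw [hSm]; exact ⟨hBU hx, by rw [← hme x hx, hpx]⟩)
    have hpm : 0 < UC.Pf Qt p m x0 := by
      rw [hPf x0 p m (hs x0 hx0B), hQe x0 hx0B]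
      simp only [fun j => congrFun (hgme x0 hx0B) j, fun j => congrFun (hgpe x0 hx0B) j]
      exact hsgn
    have hi : LinearIndependent ℝ ![fun j => UC.pd j p x0, fun j => UC.pd j m x0] := by
      rw [hgpe x0 hx0B, hgme x0 hx0B]
      exact htrans x0 hx0U hp0 hm0
    obtain ⟨R, hR, hRA⟩ := hQsig x0 hx0U
    rw [← hQe x0 hx0B] at hRA
    have hp0' : p x0 = 0 := by rw [hpe x0 hx0B, hp0]
    have hm0' : m x0 = 0 := by rw [hme x0 hx0B, hm0]
    obtain ⟨c, hc, k, hpos⟩ := UC.hpos_of (hs x0 hx0B) hR hRA (hcp x0 hx0B hp0')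
      (hcm x0 hx0B hm0') hpm
    obtain ⟨C2, hC2⟩ := UC.Lf_bound hQtC hutC x0 r0 C
    have huc := UC.local_uc hQtC hpC hmC hutC hr0p hs hp0' hm0' hcp hcm hpm.ne' hi hc hpos
      (C2 := C2) ?_ ?_ ?_
    · obtain ⟨ρ, hρ, hfin⟩ := huc
      refine ⟨min ρ r0, lt_min hρ hr0p, fun x hx hxΩ => ?_⟩
      have hxB : x ∈ Metric.ball x0 r0 := Metric.ball_subset_ball (min_le_right _ _) hx
      rw [hΩ] at hxΩ
      rw [← hute x hxB]
      exact hfin x (Metric.ball_subset_ball (min_le_left _ _) hx)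
        (by rw [hpe x hxB]; exact hxΩ.2.1) (by rw [hme x hxB]; exact hxΩ.2.2)
    · intro x hx h1 h2
      rw [hpe x hx] at h1
      rw [hme x hx] at h2
      rw [hute x hx]
      apply hubd x (hBU hx)
      rw [hΩ]
      refine UC.mem_frontier_of h𝒰 (hBU hx)
        (hφm.continuousOn.continuousAt (h𝒰.mem_nhds (hBU hx))) h1 h2 ?_
      have := hdp x (hBU hx) h1
      rw [hgp] at this
      exact this
    · intro x hx h1 h2
      rw [hme x hx] at h1
      rw [hpe x hx] at h2
      rw [hute x hx]
      apply hubd x (hBU hx)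
      have hsw : Ω = {x ∈ 𝒰 | 0 < φm x ∧ 0 < φp x} := by
        rw [hΩ]; ext y; simp only [Set.mem_setOf_eq]; tauto
      rw [hsw]
      refine UC.mem_frontier_of h𝒰 (hBU hx)
        (hφp.continuousOn.continuousAt (h𝒰.mem_nhds (hBU hx))) h1 h2 ?_
      have := hdm x (hBU hx) h1
      rw [hgm] at this
      exact this
    · intro x hx h1 h2
      refine hC2 x (Metric.ball_subset_closedBall hx) ?_
      rw [hpe x hx] at h1
      rw [hme x hx] at h2
      have h3 := hineq x (by rw [hΩ]; exact ⟨hBU hx, h1, h2⟩)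
      have hue := ev hute x hx
      have e1 : ∀ j k, UC.pd j (UC.pd k ut) x =
          iteratedFDeriv ℝ 2 u x ![Pi.single j 1, Pi.single k 1] := by
        intro j k
        rw [UC.pd_pd hutC, iteratedFDeriv_two_apply, hue.fderiv.fderiv_eq]
        rfl
      have e2 : ∀ j, UC.pd j ut x = fderiv ℝ u x (Pi.single j 1) := by
        intro j; rw [UC.pd_congr hue]; rfl
      simp only [e1, e2, hQe x hx, hute x hx]
      exact h3
  choose! ρ hρ hmain using main
  refine ⟨⋃ x0 ∈ Sp ∩ Sm, Metric.ball x0 (ρ x0), isOpen_biUnion fun _ _ => Metric.isOpen_ball, ?_, ?_⟩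
  · intro x hx
    exact Set.mem_biUnion hx (Metric.mem_ball_self (hρ x hx))
  · rintro x ⟨hxΩ, hxV⟩
    obtain ⟨x0, hx0, hxb⟩ := Set.mem_iUnion₂.1 hxV
    exact hmain x0 hx0 x hxb hxΩ
end

section
/- Let n ≥ 2, J = (−1,1)ⁿ with coordinates y = (y₁, y₂, y₃), y₃ ∈ ℝ^{n−2}. Let U : J → ℝ be C² with U(0, y₂, y₃) = 0 whenever y₂ ≥ 0 and U(y₁, 0, y₃) = 0 whenever y₁ ≥ 0, and set V(y) = H(y₁)H(y₂)U(y), where H = 1_{[0,∞)} is the Heaviside function. Then for every smooth compactly supported test function φ on J and for each i ∈ {1,2}: ∫_J V(y) ∂φ/∂y_i (y) dy = − ∫_{J ∩ {y₁>0, y₂>0}} (∂U/∂y_i)(y) φ(y) dy. (Equivalently, the distributional first derivatives of V are ∂V/∂y_i = H(y₁)H(y₂) ∂U/∂y_i.) -/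
open MeasureTheory

/-- The Heaviside function, indicator of `[0,∞)`. -/
noncomputable def Heaviside (t : ℝ) : ℝ := if 0 ≤ t then 1 else 0

/-- Fubini plus the one-dimensional fundamental theorem of calculus. -/
lemma key (m : ℕ) (i j : Fin (m+1)) (hij : j ≠ i) (W : (Fin (m+1) → ℝ) → ℝ)
    (hW : ContDiff ℝ 1 W) (hc : HasCompactSupport W)
    (h0 : ∀ y, y i = 0 → 0 ≤ y j → W y = 0) :
    ∫ y in {y : Fin (m+1) → ℝ | 0 < y i ∧ 0 < y j}, fderiv ℝ W y (Pi.single i 1) = 0 := by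
  obtain ⟨k, rfl⟩ := Fin.exists_succAbove_eq hij
  have hS : MeasurableSet {y : Fin (m+1) → ℝ | 0 < y i ∧ 0 < y (i.succAbove k)} :=
    (measurableSet_lt measurable_const (measurable_pi_apply _)).inter
      (measurableSet_lt measurable_const (measurable_pi_apply _))
  have hcont : Continuous fun y => fderiv ℝ W y (Pi.single i 1) :=
    (hW.continuous_fderiv (by norm_num)).clm_apply continuous_const
  have hint : Integrable fun y => fderiv ℝ W y (Pi.single i 1) :=
    hcont.integrable_of_hasCompactSupport (hc.fderiv_apply ℝ _)
  rw [← integral_indicator hS]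
  have mp := (volume_preserving_piFinSuccAbove (fun _ : Fin (m+1) => ℝ) i).symm
  rw [← mp.integral_comp' ]
  have hint2 := (mp.integrable_comp_emb (MeasurableEquiv.measurableEmbedding _)).2
    (hint.indicator hS)
  rw [Measure.volume_eq_prod] at hint2 ⊢
  refine (integral_prod_symm _ hint2).trans ?_
  refine integral_eq_zero_of_ae (Filter.Eventually.of_forall fun z => ?_)
  simp only [Pi.zero_apply]
  have e : ∀ t : ℝ, (MeasurableEquiv.piFinSuccAbove (fun _ : Fin (m+1) => ℝ) i).symm (t, z)
      = i.insertNth t z := fun t => rfl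
  simp only [Function.comp_apply, e]
  have e2 : ∀ t : ℝ, (i.insertNth t z : Fin (m+1) → ℝ)
      = i.insertNth 0 z + t • Pi.single i 1 := by
    intro t
    ext l
    refine Fin.succAboveCases i ?_ (fun l => ?_) l <;> simp
  by_cases hz : 0 < z k
  · have hcl : Topology.IsClosedEmbedding fun t : ℝ => (i.insertNth t z : Fin (m+1) → ℝ) := by
      refine Function.LeftInverse.isClosedEmbedding (f := fun y : Fin (m+1) → ℝ => y i) ?_
        (continuous_apply i) ?_
      · intro t; simp
      · exact Continuous.finInsertNth i continuous_id continuous_const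
    have hd : ∀ t : ℝ, HasDerivAt (fun t : ℝ => W (i.insertNth t z))
        (fderiv ℝ W (i.insertNth t z) (Pi.single i 1)) t := by
      intro t
      have h1 : HasDerivAt (fun t : ℝ => (i.insertNth t z : Fin (m+1) → ℝ)) (Pi.single i 1) t := by
        rw [funext e2]
        simpa using ((hasDerivAt_id t).smul_const (Pi.single i (1:ℝ) : Fin (m+1) → ℝ)).const_add
          (i.insertNth 0 z)
      exact ((hW.differentiable (by norm_num)) _).hasFDerivAt.comp_hasDerivAt t h1
    have hs : ContDiff ℝ 1 (fun t : ℝ => W (i.insertNth t z)) := by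
      refine hW.comp ?_
      rw [funext e2]
      fun_prop
    have := HasCompactSupport.integral_Ioi_deriv_eq hs (hc.comp_isClosedEmbedding hcl) 0
    rw [h0 _ (by simp) (by simpa using hz.le), neg_zero, ← integral_indicator measurableSet_Ioi] at this
    refine Eq.trans ?_ this
    congr 1
    ext t
    simp [Set.indicator, hz, (hd t).deriv]
  · simp [Set.indicator, hz]

/-- Products with a function supported in the open set `J` are as smooth as on `J`. -/
lemma contDiff_mul_of_support {n : ℕ} {J : Set (Fin n → ℝ)} (hJ : IsOpen J) {k : WithTop ℕ∞}
    {f g : (Fin n → ℝ) → ℝ}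
    (hf : ContDiffOn ℝ k f J) (hg : ContDiff ℝ k g) (hs : tsupport g ⊆ J) :
    ContDiff ℝ k (fun y => f y * g y) := by
  rw [contDiff_iff_contDiffAt]
  intro x
  by_cases hx : x ∈ tsupport g
  · exact (hf.contDiffAt (hJ.mem_nhds (hs hx))).mul hg.contDiffAt
  · have h := notMem_tsupport_iff_eventuallyEq.mp hx
    refine (contDiffAt_const (c := (0:ℝ))).congr_of_eventuallyEq ?_
    filter_upwards [h] with y hy
    simp [hy]

lemma main_aux {m : ℕ} {J : Set (Fin (m+1) → ℝ)} (hJ : IsOpen J)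
    {U φ : (Fin (m+1) → ℝ) → ℝ} (hU : ContDiffOn ℝ 2 U J) (i j : Fin (m+1)) (hij : j ≠ i)
    (hU1 : ∀ y ∈ J, y i = 0 → 0 ≤ y j → U y = 0)
    (hφ : ContDiff ℝ (⊤ : ℕ∞) φ) (hφc : HasCompactSupport φ) (hφs : tsupport φ ⊆ J) :
    ∫ y in J ∩ {y | 0 < y i ∧ 0 < y j}, U y * fderiv ℝ φ y (Pi.single i 1)
      = - ∫ y in J ∩ {y | 0 < y i ∧ 0 < y j}, fderiv ℝ U y (Pi.single i 1) * φ y := by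
  have hS : MeasurableSet {y : Fin (m+1) → ℝ | 0 < y i ∧ 0 < y j} :=
    (measurableSet_lt measurable_const (measurable_pi_apply _)).inter
      (measurableSet_lt measurable_const (measurable_pi_apply _))
  have hφ1 : ContDiff ℝ 1 φ := hφ.of_le (by exact_mod_cast le_top)
  have hW : ContDiff ℝ 1 (fun y => U y * φ y) :=
    contDiff_mul_of_support hJ (hU.of_le (by norm_num)) hφ1 hφs
  have hφd : ContDiff ℝ 0 fun y => fderiv ℝ φ y (Pi.single i 1) := by
    have : ContDiff ℝ 0 (fderiv ℝ φ) := hφ1.fderiv_right (by norm_num)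
    exact this.clm_apply contDiff_const
  have hUd : ContDiffOn ℝ 0 (fun y => fderiv ℝ U y (Pi.single i 1)) J := by
    have : ContDiffOn ℝ 0 (fderiv ℝ U) J := hU.fderiv_of_isOpen hJ (by norm_num)
    exact this.clm_apply contDiffOn_const
  have i1 : Integrable fun y => U y * fderiv ℝ φ y (Pi.single i 1) :=
    (contDiff_mul_of_support hJ (hU.of_le (by norm_num)) hφd
      ((tsupport_fderiv_apply_subset ℝ _).trans hφs)).continuous.integrable_of_hasCompactSupport
      (hφc.fderiv_apply ℝ _).mul_left
  have i2 : Integrable fun y => fderiv ℝ U y (Pi.single i 1) * φ y :=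
    (contDiff_mul_of_support hJ hUd (hφ1.of_le (by norm_num))
      hφs).continuous.integrable_of_hasCompactSupport hφc.mul_left
  have k := key m i j hij _ hW hφc.mul_left (by
    intro y h1 h2
    by_cases hy : y ∈ J
    · simp [hU1 y hy h1 h2]
    · simp [image_eq_zero_of_notMem_tsupport fun h => hy (hφs h)])
  rw [eq_neg_iff_add_eq_zero, ← integral_add i1.integrableOn i2.integrableOn]
  refine Eq.trans ?_ k
  rw [setIntegral_eq_of_subset_of_forall_sdiff_eq_zero hS
    (Set.inter_subset_right : J ∩ _ ⊆ {y : Fin (m+1) → ℝ | 0 < y i ∧ 0 < y j})]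
  · refine setIntegral_congr_fun (hJ.measurableSet.inter hS) fun y hy => ?_
    have dU : DifferentiableAt ℝ U y :=
      (hU.contDiffAt (hJ.mem_nhds hy.1)).differentiableAt (by norm_num)
    have dφ : DifferentiableAt ℝ φ y := hφ1.differentiable (by norm_num) y
    rw [fderiv_fun_mul dU dφ]
    simp
    ring
  · intro y hy
    have hyJ : y ∉ J := fun h => hy.2 ⟨h, hy.1⟩
    have hn : y ∉ tsupport (fun x => U x * φ x) := fun h =>
      hyJ (hφs (tsupport_mul_subset_right h))
    have h0 : fderiv ℝ (fun x => U x * φ x) y = 0 :=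
      image_eq_zero_of_notMem_tsupport fun h => hn (tsupport_fderiv_subset ℝ h)
    rw [h0]
    rfl

/-- **Lemma 1 (first derivatives)**: for `U ∈ C²((-1,1)ⁿ)` vanishing on the two
characteristic faces, `V = H(y₁)H(y₂)U` has distributional first derivatives
`∂V/∂y_i = H(y₁)H(y₂) ∂U/∂y_i` for `i ∈ {1,2}`. -/
theorem heaviside_product_first_derivative
    (n : ℕ) (hn : 2 ≤ n)
    (J : Set (Fin n → ℝ))
    (hJ : J = {y : Fin n → ℝ | ∀ i, y i ∈ Set.Ioo (-1 : ℝ) 1})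
    (U : (Fin n → ℝ) → ℝ)
    (hU : ContDiffOn ℝ 2 U J)
    (hU1 : ∀ y ∈ J, y ⟨0, by omega⟩ = 0 → 0 ≤ y ⟨1, by omega⟩ → U y = 0)
    (hU2 : ∀ y ∈ J, y ⟨1, by omega⟩ = 0 → 0 ≤ y ⟨0, by omega⟩ → U y = 0)
    (V : (Fin n → ℝ) → ℝ)
    (hV : V = fun y => Heaviside (y ⟨0, by omega⟩) * Heaviside (y ⟨1, by omega⟩) * U y)
    (φ : (Fin n → ℝ) → ℝ)
    (hφ : ContDiff ℝ (⊤ : ℕ∞) φ) (hφc : HasCompactSupport φ) (hφs : tsupport φ ⊆ J)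
    (i : Fin n) (hi : i = ⟨0, by omega⟩ ∨ i = ⟨1, by omega⟩) :
    ∫ y in J, V y * fderiv ℝ φ y (Pi.single i 1)
      = - ∫ y in J ∩ {y : Fin n → ℝ | 0 < y ⟨0, by omega⟩ ∧ 0 < y ⟨1, by omega⟩},
            fderiv ℝ U y (Pi.single i 1) * φ y := by
  obtain ⟨m, rfl⟩ : ∃ m, n = m + 1 := ⟨n - 1, by omega⟩
  have hJo : IsOpen J := by
    have : J = Set.univ.pi fun _ => Set.Ioo (-1 : ℝ) 1 := by
      rw [hJ]; ext y; simp
    rw [this]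
    exact isOpen_set_pi Set.finite_univ fun _ _ => isOpen_Ioo
  have hS : MeasurableSet {y : Fin (m+1) → ℝ | 0 < y ⟨0, by omega⟩ ∧ 0 < y ⟨1, by omega⟩} :=
    (measurableSet_lt measurable_const (measurable_pi_apply _)).inter
      (measurableSet_lt measurable_const (measurable_pi_apply _))
  have h1 : ∫ y in J, V y * fderiv ℝ φ y (Pi.single i 1)
      = ∫ y in J ∩ {y : Fin (m+1) → ℝ | 0 < y ⟨0, by omega⟩ ∧ 0 < y ⟨1, by omega⟩},
            U y * fderiv ℝ φ y (Pi.single i 1) := by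
    rw [← setIntegral_indicator hS]
    refine setIntegral_congr_fun hJo.measurableSet fun y hy => ?_
    have a1 := hU1 y hy
    have a2 := hU2 y hy
    simp only [hV, Heaviside, Set.indicator, Set.mem_ofPred_eq]
    generalize y ⟨0, by omega⟩ = a at *
    generalize y ⟨1, by omega⟩ = b at *
    rcases lt_trichotomy a 0 with ha | ha | ha
    · simp [ha.not_ge, ha.not_gt]
    · by_cases hb : 0 ≤ b
      · simp [ha, a1 ha hb]
      · simp [ha, hb]
    · rcases lt_trichotomy b 0 with hb | hb | hb
      · simp [hb.not_ge, hb.not_gt]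
      · simp [hb, a2 hb ha.le]
      · simp [ha, hb, ha.le, hb.le]
  rw [h1]
  rcases hi with rfl | rfl
  · exact main_aux hJo hU _ _ (by simp [Fin.ext_iff]) hU1 hφ hφc hφs
  · have := main_aux hJo hU ⟨1, by omega⟩ ⟨0, by omega⟩ (by simp [Fin.ext_iff]) hU2 hφ hφc hφs
    simp only [and_comm] at this ⊢
    exact this
end

section
/- Let n ≥ 2, J = (−1,1)ⁿ with coordinates y = (y₁, y₂, y₃), y₃ ∈ ℝ^{n−2}. Let U : J → ℝ be C² with U(0, y₂, y₃) = 0 whenever y₂ ≥ 0 and U(y₁, 0, y₃) = 0 whenever y₁ ≥ 0, and set V(y) = H(y₁)H(y₂)U(y), where H = 1_{[0,∞)}. Then for every smooth compactly supported test function φ on J: ∫_J V(y) (∂²φ/∂y₁∂y₂)(y) dy = ∫_{J ∩ {y₁>0, y₂>0}} (∂²U/∂y₁∂y₂)(y) φ(y) dy. (Equivalently, ∂²V/∂y₁∂y₂ = H(y₁)H(y₂) ∂²U/∂y₁∂y₂ in the sense of distributions; no boundary simple-layer term appears.) -/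
open MeasureTheory

open scoped Topology ContDiff Manifold in
/-- Cutoff: extend a `C²` function on an open set to a global compactly supported one. -/
theorem exists_cutoff_aux {n : ℕ} (J K : Set (Fin n → ℝ)) (hJ : IsOpen J) (hK : IsCompact K)
    (hKJ : K ⊆ J) (U : (Fin n → ℝ) → ℝ) (hU : ContDiffOn ℝ 2 U J) :
    ∃ W : (Fin n → ℝ) → ℝ, ContDiff ℝ 2 W ∧ HasCompactSupport W ∧
      (∀ y ∈ K, W =ᶠ[𝓝 y] U) ∧ (∀ y, y ∉ J → W y = 0) ∧ (∀ y, U y = 0 → W y = 0) := by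
  obtain ⟨L, hL, hKL, hLJ⟩ := exists_compact_between hK hJ hKJ
  obtain ⟨f, h1, h0, -⟩ := exists_contMDiffMap_one_nhds_of_subset_interior (n := 2)
    𝓘(ℝ, Fin n → ℝ) hK.isClosed hKL
  have hf : ContDiff ℝ 2 (f : (Fin n → ℝ) → ℝ) := f.contMDiff.contDiff
  refine ⟨fun y => f y * U y, ?_, ?_, ?_, ?_, ?_⟩
  · rw [contDiff_iff_contDiffAt]
    intro y
    by_cases hy : y ∈ J
    · exact hf.contDiffAt.mul (hU.contDiffAt (hJ.mem_nhds hy))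
    · have : (fun y => f y * U y) =ᶠ[𝓝 y] fun _ => 0 := by
        filter_upwards [hL.isClosed.isOpen_compl.mem_nhds (fun h => hy (hLJ h))] with z hz
        rw [h0 z hz, zero_mul]
      exact contDiffAt_const.congr_of_eventuallyEq this
  · exact HasCompactSupport.intro hL (fun x hx => by simp [h0 x hx])
  · intro y hy
    have := (Filter.Eventually.filter_mono (nhds_le_nhdsSet hy) h1)
    filter_upwards [this] with z hz
    simp [hz]
  · intro y hy
    simp [h0 y (fun h => hy (hLJ h))]
  · intro y hy
    simp [hy]

/-- Integration of a partial derivative over a quadrant. -/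
theorem integral_partial_quadrant_aux {n : ℕ} (F : (Fin n → ℝ) → ℝ) (hF : ContDiff ℝ 1 F)
    (hc : HasCompactSupport F) (i j : Fin n) (hij : i ≠ j)
    (h0 : ∀ y, y i = 0 → 0 < y j → F y = 0) :
    ∫ y in {y : Fin n → ℝ | 0 < y i ∧ 0 < y j}, fderiv ℝ F y (Pi.single i 1) = 0 := by
  obtain _ | m := n
  · exact i.elim0
  obtain ⟨k, rfl⟩ := Fin.exists_succAbove_eq hij.symm
  have hcont : Continuous fun y => fderiv ℝ F y (Pi.single i 1) :=
    (hF.continuous_fderiv one_ne_zero).clm_apply continuous_const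
  have hFi : Integrable fun y => fderiv ℝ F y (Pi.single i 1) :=
    hcont.integrable_of_hasCompactSupport (hc.fderiv_apply ℝ _)
  have hS : MeasurableSet {y : Fin (m+1) → ℝ | 0 < y i ∧ 0 < y (i.succAbove k)} :=
    (measurableSet_lt measurable_const (measurable_pi_apply _)).inter
      (measurableSet_lt measurable_const (measurable_pi_apply _))
  have mp := (volume_preserving_piFinSuccAbove (fun _ : Fin (m+1) => ℝ) i).symm
  rw [← integral_indicator hS,
    ← mp.integral_comp (MeasurableEquiv.measurableEmbedding _)]
  have hFi' := (mp.integrable_comp_emb (MeasurableEquiv.measurableEmbedding _)).2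
    (hFi.indicator hS)
  rw [Measure.volume_eq_prod]
  refine (integral_prod_symm _ hFi').trans ?_
  refine integral_eq_zero_of_ae (Filter.Eventually.of_forall fun x => ?_)
  have key : ∀ t : ℝ, (MeasurableEquiv.piFinSuccAbove (fun _ : Fin (m+1) => ℝ) i).symm (t, x)
      = Function.update (i.insertNth 0 x : Fin (m+1) → ℝ) i t := by
    intro t
    rw [Fin.update_insertNth]
    rfl
  simp only [Function.comp_apply, key, Pi.zero_apply]
  set p : Fin (m+1) → ℝ := i.insertNth 0 x with hp
  have hpk : ∀ t, Function.update p i t (i.succAbove k) = x k := by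
    intro t
    rw [Function.update_of_ne (Fin.succAbove_ne i k)]
    simp [hp]
  by_cases hx : 0 < x k
  · have e : ∀ t, ({y : Fin (m+1) → ℝ | 0 < y i ∧ 0 < y (i.succAbove k)}.indicator
        (fun y => fderiv ℝ F y (Pi.single i 1))) (Function.update p i t)
        = (Set.Ioi (0:ℝ)).indicator (deriv fun t => F (Function.update p i t)) t := by
      intro t
      have hd : HasDerivAt (fun t => F (Function.update p i t))
          (fderiv ℝ F (Function.update p i t) (Pi.single i 1)) t :=
        ((hF.differentiable one_ne_zero) _).hasFDerivAt.comp_hasDerivAt t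
          (hasDerivAt_update p i t)
      simp only [Set.indicator, Set.mem_ofPred_eq, Set.mem_Ioi, hpk, hx, and_true, hd.deriv,
        Function.update_self]
    simp only [e]
    rw [integral_indicator measurableSet_Ioi, HasCompactSupport.integral_Ioi_deriv_eq]
    · rw [h0 _ (by simp) (by rw [hpk]; exact hx), neg_zero]
    · exact hF.comp (contDiff_update 1 p i)
    · refine HasCompactSupport.intro (K := (fun y : Fin (m+1) → ℝ => y i) '' tsupport F)
        (hc.isCompact.image (continuous_apply i)) fun t ht => ?_
      apply image_eq_zero_of_notMem_tsupport
      intro h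
      exact ht ⟨_, h, by simp⟩
  · have e : ∀ t, ({y : Fin (m+1) → ℝ | 0 < y i ∧ 0 < y (i.succAbove k)}.indicator
        (fun y => fderiv ℝ F y (Pi.single i 1))) (Function.update p i t) = 0 := by
      intro t
      apply Set.indicator_of_notMem
      rintro ⟨-, h⟩
      rw [hpk] at h
      exact hx h
    simp [e]

theorem global_aux {n : ℕ} (i j : Fin n) (hij : i ≠ j) (U φ : (Fin n → ℝ) → ℝ)
    (hU : ContDiff ℝ 2 U) (hφ : ContDiff ℝ 2 φ) (hUc : HasCompactSupport U)
    (hφc : HasCompactSupport φ)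
    (h1 : ∀ y, y i = 0 → 0 ≤ y j → U y = 0) (h2 : ∀ y, y j = 0 → 0 ≤ y i → U y = 0) :
    ∫ y in {y : Fin n → ℝ | 0 < y i ∧ 0 < y j},
        U y * iteratedFDeriv ℝ 2 φ y ![Pi.single i 1, Pi.single j 1]
      = ∫ y in {y : Fin n → ℝ | 0 < y i ∧ 0 < y j},
        iteratedFDeriv ℝ 2 U y ![Pi.single i 1, Pi.single j 1] * φ y := by
  have pd : ∀ f : (Fin n → ℝ) → ℝ, ContDiff ℝ 2 f → ∀ v, ContDiff ℝ 1 fun y => fderiv ℝ f y v :=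
    fun f hf v => (hf.fderiv_right (by norm_num)).clm_apply contDiff_const
  have sd : ∀ f : (Fin n → ℝ) → ℝ, ContDiff ℝ 2 f → ∀ y v w,
      fderiv ℝ (fun y => fderiv ℝ f y v) y w = fderiv ℝ (fderiv ℝ f) y w v := by
    intro f hf y v w
    have hd : DifferentiableAt ℝ (fderiv ℝ f) y :=
      ((hf.fderiv_right (m := 1) (by norm_num)).differentiable one_ne_zero) y
    rw [fderiv_clm_apply hd (differentiableAt_const v)]
    simp
  have hU1 : ContDiff ℝ 1 U := hU.of_le (by norm_num)
  have hφ1 : ContDiff ℝ 1 φ := hφ.of_le (by norm_num)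
  have A := integral_partial_quadrant_aux (fun y => U y * fderiv ℝ φ y (Pi.single j 1))
    (hU1.mul (pd φ hφ _)) hUc.mul_right i j hij
    (fun y hy hy' => by simp [h1 y hy hy'.le])
  have B := integral_partial_quadrant_aux (fun y => fderiv ℝ U y (Pi.single i 1) * φ y)
    ((pd U hU _).mul hφ1) hφc.mul_left j i hij.symm (by
      intro y hy hy'
      have hd : HasDerivAt (fun t => U (Function.update y i t))
          (fderiv ℝ U y (Pi.single i 1)) (y i) := by
        have h := ((hU1.differentiable one_ne_zero) (Function.update y i (y i))).hasFDerivAt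
          |>.comp_hasDerivAt (y i) (hasDerivAt_update y i (y i))
        rwa [Function.update_eq_self] at h
      have hz : (fun t => U (Function.update y i t)) =ᶠ[nhds (y i)] fun _ => 0 := by
        filter_upwards [lt_mem_nhds hy'] with t ht
        apply h2
        · rw [Function.update_of_ne hij.symm, hy]
        · simpa using ht.le
      have := hd.unique ((hasDerivAt_const (y i) (0:ℝ)).congr_of_eventuallyEq hz)
      simp [this])
  have hsym : ∀ y v w, fderiv ℝ (fderiv ℝ U) y v w = fderiv ℝ (fderiv ℝ U) y w v :=
    fun y v w => (hU.contDiffAt.isSymmSndFDerivAt (by simp)) v w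
  have eA : ∀ y, fderiv ℝ (fun y => U y * fderiv ℝ φ y (Pi.single j 1)) y (Pi.single i 1)
      = U y * iteratedFDeriv ℝ 2 φ y ![Pi.single i 1, Pi.single j 1]
        + fderiv ℝ U y (Pi.single i 1) * fderiv ℝ φ y (Pi.single j 1) := by
    intro y
    rw [fderiv_fun_mul ((hU1.differentiable one_ne_zero) y)
      (((pd φ hφ _).differentiable one_ne_zero) y)]
    simp [sd φ hφ, iteratedFDeriv_two_apply, mul_comm]
  have eB : ∀ y, fderiv ℝ (fun y => fderiv ℝ U y (Pi.single i 1) * φ y) y (Pi.single j 1)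
      = iteratedFDeriv ℝ 2 U y ![Pi.single i 1, Pi.single j 1] * φ y
        + fderiv ℝ U y (Pi.single i 1) * fderiv ℝ φ y (Pi.single j 1) := by
    intro y
    rw [fderiv_fun_mul (((pd U hU _).differentiable one_ne_zero) y)
      ((hφ1.differentiable one_ne_zero) y)]
    simp [sd U hU, iteratedFDeriv_two_apply, hsym y (Pi.single j 1) (Pi.single i 1)]
    ring
  have c2 : ∀ f : (Fin n → ℝ) → ℝ, ContDiff ℝ 2 f →
      Continuous fun y => iteratedFDeriv ℝ 2 f y ![Pi.single i 1, Pi.single j 1] := by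
    intro f hf
    have := (pd f hf (Pi.single j 1)).continuous_fderiv one_ne_zero
    simp only [iteratedFDeriv_two_apply]
    have h3 := this.clm_apply (continuous_const (y := (Pi.single i 1 : Fin n → ℝ)))
    simpa [sd f hf] using h3
  have i1 : Integrable fun y => U y * iteratedFDeriv ℝ 2 φ y ![Pi.single i 1, Pi.single j 1] :=
    (hU.continuous.mul (c2 φ hφ)).integrable_of_hasCompactSupport hUc.mul_right
  have i2 : Integrable fun y => iteratedFDeriv ℝ 2 U y ![Pi.single i 1, Pi.single j 1] * φ y :=
    ((c2 U hU).mul hφ.continuous).integrable_of_hasCompactSupport hφc.mul_left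
  have i3 : Integrable fun y => fderiv ℝ U y (Pi.single i 1) * fderiv ℝ φ y (Pi.single j 1) :=
    ((pd U hU _).continuous.mul (pd φ hφ _).continuous).integrable_of_hasCompactSupport
      (hφc.fderiv_apply ℝ _).mul_left
  have hset : {y : Fin n → ℝ | 0 < y j ∧ 0 < y i} = {y : Fin n → ℝ | 0 < y i ∧ 0 < y j} := by
    ext y
    exact and_comm
  simp only [eA] at A
  simp only [eB, hset] at B
  rw [integral_add i1.integrableOn i3.integrableOn] at A
  rw [integral_add i2.integrableOn i3.integrableOn] at B
  linarith

/-- **Lemma 1 (mixed second derivative)**: for `U ∈ C²((-1,1)ⁿ)` vanishing on the two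
characteristic faces, `V = H(y₁)H(y₂)U` satisfies
`∂²V/∂y₁∂y₂ = H(y₁)H(y₂) ∂²U/∂y₁∂y₂` in the sense of distributions:
no simple-layer boundary term appears. -/
theorem heaviside_product_mixed_second_derivative
    (n : ℕ) (hn : 2 ≤ n)
    (J : Set (Fin n → ℝ))
    (hJ : J = {y : Fin n → ℝ | ∀ i, y i ∈ Set.Ioo (-1 : ℝ) 1})
    (U : (Fin n → ℝ) → ℝ)
    (hU : ContDiffOn ℝ 2 U J)
    (hU1 : ∀ y ∈ J, y ⟨0, by omega⟩ = 0 → 0 ≤ y ⟨1, by omega⟩ → U y = 0)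
    (hU2 : ∀ y ∈ J, y ⟨1, by omega⟩ = 0 → 0 ≤ y ⟨0, by omega⟩ → U y = 0)
    (V : (Fin n → ℝ) → ℝ)
    (hV : V = fun y => Heaviside (y ⟨0, by omega⟩) * Heaviside (y ⟨1, by omega⟩) * U y)
    (φ : (Fin n → ℝ) → ℝ)
    (hφ : ContDiff ℝ (⊤ : ℕ∞) φ) (hφc : HasCompactSupport φ) (hφs : tsupport φ ⊆ J) :
    ∫ y in J, V y * iteratedFDeriv ℝ 2 φ y
        ![Pi.single ⟨0, by omega⟩ 1, Pi.single ⟨1, by omega⟩ 1]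
      = ∫ y in J ∩ {y : Fin n → ℝ | 0 < y ⟨0, by omega⟩ ∧ 0 < y ⟨1, by omega⟩},
          iteratedFDeriv ℝ 2 U y
            ![Pi.single ⟨0, by omega⟩ 1, Pi.single ⟨1, by omega⟩ 1] * φ y := by
  have hJo : IsOpen J := by
    have : J = Set.pi Set.univ fun _ => Set.Ioo (-1 : ℝ) 1 := by
      rw [hJ]; ext y; simp
    rw [this]
    exact isOpen_set_pi Set.finite_univ fun _ _ => isOpen_Ioo
  obtain ⟨W, hW, hWc, hWU, hWJ, hW0⟩ :=
    exists_cutoff_aux J (tsupport φ) hJo hφc.isCompact hφs U hU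
  have hφ2 : ContDiff ℝ 2 φ := contDiff_infty.1 hφ 2
  generalize hi : (⟨0, by omega⟩ : Fin n) = i at *
  generalize hj : (⟨1, by omega⟩ : Fin n) = j at *
  have hij : i ≠ j := by
    rw [← hi, ← hj]; simp
  have G := global_aux i j hij W φ hW hφ2 hWc hφc
    (fun y h h' => by
      by_cases hy : y ∈ J
      · exact hW0 y (hU1 y hy h h')
      · exact hWJ y hy)
    (fun y h h' => by
      by_cases hy : y ∈ J
      · exact hW0 y (hU2 y hy h h')
      · exact hWJ y hy)
  set S : Set (Fin n → ℝ) := {y | 0 < y i ∧ 0 < y j} with hSdef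
  have hS : MeasurableSet S :=
    (measurableSet_lt measurable_const (measurable_pi_apply _)).inter
      (measurableSet_lt measurable_const (measurable_pi_apply _))
  have hz : ∀ y, y ∉ tsupport φ → iteratedFDeriv ℝ 2 φ y = 0 := by
    intro y hy
    by_contra h
    exact hy (support_iteratedFDeriv_subset 2 h)
  have L : ∫ y in J, V y * iteratedFDeriv ℝ 2 φ y ![Pi.single i 1, Pi.single j 1]
      = ∫ y in S, W y * iteratedFDeriv ℝ 2 φ y ![Pi.single i 1, Pi.single j 1] := by
    rw [← integral_indicator hJo.measurableSet, ← integral_indicator hS]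
    congr 1
    ext y
    by_cases hy : y ∈ tsupport φ
    · have hyJ := hφs hy
      rw [Set.indicator_of_mem hyJ, hV]
      have hWy : W y = U y := (hWU y hy).eq_of_nhds
      by_cases hyS : y ∈ S
      · rw [Set.indicator_of_mem hyS, hWy]
        simp [Heaviside, hyS.1.le, hyS.2.le]
      · rw [Set.indicator_of_notMem hyS]
        by_cases hi0 : 0 ≤ y i
        · by_cases hj0 : 0 ≤ y j
          · have : U y = 0 := by
              rcases hi0.eq_or_lt with h | h
              · exact hU1 y hyJ h.symm hj0
              · rcases hj0.eq_or_lt with h' | h'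
                · exact hU2 y hyJ h'.symm hi0
                · exact absurd ⟨h, h'⟩ hyS
            simp [this]
          · simp [Heaviside, hj0]
        · simp [Heaviside, hi0]
    · simp [Set.indicator, hz y hy]
  have R : ∫ y in J ∩ S, iteratedFDeriv ℝ 2 U y ![Pi.single i 1, Pi.single j 1] * φ y
      = ∫ y in S, iteratedFDeriv ℝ 2 W y ![Pi.single i 1, Pi.single j 1] * φ y := by
    rw [← integral_indicator (hJo.measurableSet.inter hS), ← integral_indicator hS]
    congr 1
    ext y
    by_cases hy : y ∈ tsupport φ
    · have hyJ := hφs hy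
      have : iteratedFDeriv ℝ 2 W y = iteratedFDeriv ℝ 2 U y :=
        ((hWU y hy).iteratedFDeriv ℝ 2).eq_of_nhds
      simp [Set.indicator, hyJ, this]
    · simp [Set.indicator, image_eq_zero_of_notMem_tsupport hy]
  rw [L, R, G]
end

section
/- Let n ≥ 3, J = (−1,1)ⁿ with coordinates y = (y₁, y₂, y₃), y₃ ∈ ℝ^{n−2}. Let U : J → ℝ be C² with U(0, y₂, y₃) = 0 whenever y₂ ≥ 0 and U(y₁, 0, y₃) = 0 whenever y₁ ≥ 0, and set V(y) = H(y₁)H(y₂)U(y), where H = 1_{[0,∞)}. Then for every j with 3 ≤ j ≤ n, every k with 3 ≤ k ≤ n, each i ∈ {1,2}, and every smooth compactly supported test function φ on J: ∫_J V ∂²φ/∂y_i∂y_j dy = ∫_{J ∩ {y₁>0, y₂>0}} (∂²U/∂y_i∂y_j) φ dy and ∫_J V ∂²φ/∂y_j∂y_k dy = ∫_{J ∩ {y₁>0, y₂>0}} (∂²U/∂y_j∂y_k) φ dy. -/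
open MeasureTheory

theorem hp_contDiff_mul {E : Type*} [NormedAddCommGroup E] [NormedSpace ℝ E] {k : WithTop ℕ∞}
    {J : Set E} (hJ : IsOpen J) {f g : E → ℝ} (hf : ContDiffOn ℝ k f J) (hg : ContDiff ℝ k g)
    (hs : tsupport g ⊆ J) : ContDiff ℝ k (fun y => f y * g y) := by
  rw [contDiff_iff_contDiffAt]
  intro x
  by_cases hx : x ∈ J
  · exact (hf.contDiffAt (hJ.mem_nhds hx)).mul hg.contDiffAt
  · have h0 : g =ᶠ[nhds x] 0 := notMem_tsupport_iff_eventuallyEq.mp (fun h => hx (hs h))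
    refine (contDiffAt_const (c := (0 : ℝ))).congr_of_eventuallyEq ?_
    filter_upwards [h0] with y hy
    simp [hy]

theorem hp_fderiv_mul {E : Type*} [NormedAddCommGroup E] [NormedSpace ℝ E]
    {J : Set E} (hJ : IsOpen J) {f g : E → ℝ} (hf : ContDiffOn ℝ 1 f J) (hg : ContDiff ℝ 1 g)
    (hs : tsupport g ⊆ J) (x v : E) :
    fderiv ℝ (fun y => f y * g y) x v = f x * fderiv ℝ g x v + fderiv ℝ f x v * g x := by
  by_cases hx : x ∈ J
  · have h1 : DifferentiableAt ℝ f x :=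
      (hf.contDiffAt (hJ.mem_nhds hx)).differentiableAt (by norm_num)
    have h2 : DifferentiableAt ℝ g x := hg.differentiable (by norm_num) x
    rw [fderiv_fun_mul h1 h2]
    simp [mul_comm]
  · have h0 : g =ᶠ[nhds x] 0 := notMem_tsupport_iff_eventuallyEq.mp (fun h => hx (hs h))
    have h1 : (fun y => f y * g y) =ᶠ[nhds x] (fun _ => (0 : ℝ)) := by
      filter_upwards [h0] with y hy
      simp [hy]
    have h0' : g =ᶠ[nhds x] (fun _ => (0 : ℝ)) := h0
    rw [h1.fderiv_eq, h0'.fderiv_eq, h0'.eq_of_nhds]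
    simp

theorem hp_box {n : ℕ} (a b : Fin (n + 1) → ℝ) (hab : a ≤ b) (m : Fin (n + 1))
    (h : (Fin (n + 1) → ℝ) → ℝ) (hh : ContDiff ℝ 1 h)
    (h0 : ∀ y ∈ Set.Icc a b, (y m = a m ∨ y m = b m) → h y = 0) :
    ∫ y in Set.Icc a b, fderiv ℝ h y (Pi.single m 1) = 0 := by
  have key := integral_divergence_of_hasFDerivAt_off_countable' a b hab
    (fun i y => if i = m then h y else 0)
    (fun i y => if i = m then fderiv ℝ h y else 0) ∅ Set.countable_empty
    (fun i => by
      by_cases hi : i = m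
      · simpa [hi] using hh.continuous.continuousOn
      · simpa [hi] using continuousOn_const)
    (fun x _ i => by
      by_cases hi : i = m
      · simpa [hi] using (hh.differentiable (by norm_num) x).hasFDerivAt
      · simpa [hi] using hasFDerivAt_const (0 : ℝ) x)
    (by
      have : (fun x => ∑ i, (if i = m then fderiv ℝ h x else 0) (Pi.single i 1))
          = fun x => fderiv ℝ h x (Pi.single m 1) := by
        funext x
        rw [Finset.sum_eq_single m] <;> simp +contextual
      rw [this]
      exact ((hh.continuous_fderiv (by norm_num)).clm_apply
        continuous_const).continuousOn.integrableOn_compact isCompact_Icc)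
  have e1 : (fun x => ∑ i, (if i = m then fderiv ℝ h x else 0) (Pi.single i 1))
      = fun x => fderiv ℝ h x (Pi.single m 1) := by
    funext x
    rw [Finset.sum_eq_single m] <;> simp +contextual
  rw [e1] at key
  rw [key]
  refine Finset.sum_eq_zero fun i _ => ?_
  by_cases hi : i = m
  · subst hi
    have hmem : ∀ c ∈ Set.Icc (a i) (b i), ∀ x ∈ Set.Icc (a ∘ i.succAbove) (b ∘ i.succAbove),
        i.insertNth c x ∈ Set.Icc a b := by
      intro c hc x hx
      rw [Fin.insertNth_mem_Icc]
      exact ⟨hc, hx⟩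
    rw [setIntegral_eq_zero_of_forall_eq_zero, setIntegral_eq_zero_of_forall_eq_zero, sub_zero]
    · intro x hx
      simp only [if_true]
      exact h0 _ (hmem _ ⟨le_rfl, hab i⟩ x hx) (Or.inl (by simp))
    · intro x hx
      simp only [if_true]
      exact h0 _ (hmem _ ⟨hab i, le_rfl⟩ x hx) (Or.inr (by simp))
  · simp [hi]

theorem hp_ibp {n : ℕ} (a b : Fin (n + 1) → ℝ) (hab : a ≤ b) (m : Fin (n + 1))
    {J : Set (Fin (n + 1) → ℝ)} (hJ : IsOpen J) {f g : (Fin (n + 1) → ℝ) → ℝ}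
    (hf : ContDiffOn ℝ 1 f J) (hg : ContDiff ℝ 1 g) (hs : tsupport g ⊆ J)
    (h0 : ∀ y ∈ Set.Icc a b, (y m = a m ∨ y m = b m) → f y * g y = 0) :
    ∫ y in Set.Icc a b, f y * fderiv ℝ g y (Pi.single m 1)
      = - ∫ y in Set.Icc a b, fderiv ℝ f y (Pi.single m 1) * g y := by
  have key := hp_box a b hab m _ (hp_contDiff_mul hJ hf hg hs) h0
  simp only [hp_fderiv_mul hJ hf hg hs] at key
  have c1 : Continuous fun y => f y * fderiv ℝ g y (Pi.single m 1) := by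
    refine (hp_contDiff_mul (k := 0) hJ (contDiffOn_zero.2 hf.continuousOn)
      (contDiff_zero.2 ((hg.continuous_fderiv (by norm_num)).clm_apply continuous_const)) ?_).continuous
    exact (tsupport_fderiv_apply_subset ℝ _).trans hs
  have c2 : Continuous fun y => fderiv ℝ f y (Pi.single m 1) * g y := by
    refine (hp_contDiff_mul (k := 0) hJ (contDiffOn_zero.2 ?_)
      (contDiff_zero.2 hg.continuous) hs).continuous
    exact (hf.continuousOn_fderiv_of_isOpen hJ (by norm_num)).clm_apply continuousOn_const
  rw [integral_add (c1.continuousOn.integrableOn_compact isCompact_Icc)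
    (c2.continuousOn.integrableOn_compact isCompact_Icc)] at key
  linarith

theorem hp_ibp2 {n : ℕ} (a b : Fin (n + 1) → ℝ) (hab : a ≤ b) (p q : Fin (n + 1))
    {J : Set (Fin (n + 1) → ℝ)} (hJ : IsOpen J) {f g : (Fin (n + 1) → ℝ) → ℝ}
    (hf : ContDiffOn ℝ 2 f J) (hg : ContDiff ℝ 2 g) (hs : tsupport g ⊆ J)
    (hp : ∀ y ∈ Set.Icc a b, y ∈ J → (y p = a p ∨ y p = b p) → f y = 0)
    (hq : ∀ y ∈ J, y q ≠ a q ∧ y q ≠ b q) :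
    ∫ y in Set.Icc a b, f y * iteratedFDeriv ℝ 2 g y ![Pi.single p 1, Pi.single q 1]
      = ∫ y in Set.Icc a b, iteratedFDeriv ℝ 2 f y ![Pi.single p 1, Pi.single q 1] * g y := by
  have hs' : tsupport (fun y => fderiv ℝ g y (Pi.single q 1)) ⊆ J :=
    (tsupport_fderiv_apply_subset ℝ _).trans hs
  have hgd : ContDiff ℝ 1 (fderiv ℝ g) := hg.fderiv_right (by norm_num)
  have hfd : ContDiffOn ℝ 1 (fderiv ℝ f) J := hf.fderiv_of_isOpen hJ (by norm_num)
  have i1 := hp_ibp a b hab p hJ (hf.of_le (by norm_num)) 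
    (g := fun y => fderiv ℝ g y (Pi.single q 1)) (hgd.clm_apply contDiff_const) hs'
    (fun y hy hy' => by
      by_cases hyJ : y ∈ J
      · rw [hp y hy hyJ hy', zero_mul]
      · rw [image_eq_zero_of_notMem_tsupport (f := fun y => fderiv ℝ g y (Pi.single q 1))
          (fun h => hyJ (hs' h)), mul_zero])
  have i2 := hp_ibp a b hab q hJ (f := fun y => fderiv ℝ f y (Pi.single p 1)) (g := g)
    (hfd.clm_apply contDiffOn_const) (hg.of_le (by norm_num)) hs
    (fun y hy hy' => by
      by_cases hyJ : y ∈ J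
      · have := hq y hyJ
        tauto
      · rw [image_eq_zero_of_notMem_tsupport (fun h => hyJ (hs h)), mul_zero])
  have e1 : ∀ y, iteratedFDeriv ℝ 2 g y ![Pi.single p 1, Pi.single q 1]
      = fderiv ℝ (fun y => fderiv ℝ g y (Pi.single q 1)) y (Pi.single p 1) := by
    intro y
    rw [iteratedFDeriv_two_apply, fderiv_clm_apply (hgd.differentiable (by norm_num) y)
      (differentiableAt_const _)]
    simp
  have e2 : ∀ y, iteratedFDeriv ℝ 2 f y ![Pi.single p 1, Pi.single q 1] * g y
      = fderiv ℝ (fun y => fderiv ℝ f y (Pi.single p 1)) y (Pi.single q 1) * g y := by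
    intro y
    by_cases hyJ : y ∈ J
    · have hc : ContDiffAt ℝ 2 f y := hf.contDiffAt (hJ.mem_nhds hyJ)
      have hsym : IsSymmSndFDerivAt ℝ f y := hc.isSymmSndFDerivAt (by simp)
      rw [iteratedFDeriv_two_apply, fderiv_clm_apply
        ((hfd.contDiffAt (hJ.mem_nhds hyJ)).differentiableAt (by norm_num))
        (differentiableAt_const _)]
      simp [hsym.eq (Pi.single p 1) (Pi.single q 1)]
    · rw [image_eq_zero_of_notMem_tsupport (fun h => hyJ (hs h)), mul_zero, mul_zero]
  simp only [e1, e2]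
  rw [i1, i2, neg_neg]

/-- **Lemma 1 (second derivatives involving tangential directions)**: for
`U ∈ C²((-1,1)ⁿ)` vanishing on the two characteristic faces and
`V = H(y₁)H(y₂)U`, one has `∂²V/∂y_i∂y_j = H(y₁)H(y₂)∂²U/∂y_i∂y_j` for
`i ∈ {1,2}`, `j ≥ 3`, and `∂²V/∂y_j∂y_k = H(y₁)H(y₂)∂²U/∂y_j∂y_k` for `j,k ≥ 3`,
in the sense of distributions. -/
theorem heaviside_product_tangential_second_derivatives
    (n : ℕ) (hn : 3 ≤ n)
    (J : Set (Fin n → ℝ))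
    (hJ : J = {y : Fin n → ℝ | ∀ i, y i ∈ Set.Ioo (-1 : ℝ) 1})
    (U : (Fin n → ℝ) → ℝ)
    (hU : ContDiffOn ℝ 2 U J)
    (hU1 : ∀ y ∈ J, y ⟨0, by omega⟩ = 0 → 0 ≤ y ⟨1, by omega⟩ → U y = 0)
    (hU2 : ∀ y ∈ J, y ⟨1, by omega⟩ = 0 → 0 ≤ y ⟨0, by omega⟩ → U y = 0)
    (V : (Fin n → ℝ) → ℝ)
    (hV : V = fun y => Heaviside (y ⟨0, by omega⟩) * Heaviside (y ⟨1, by omega⟩) * U y)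
    (φ : (Fin n → ℝ) → ℝ)
    (hφ : ContDiff ℝ (⊤ : ℕ∞) φ) (hφc : HasCompactSupport φ) (hφs : tsupport φ ⊆ J)
    (j k : Fin n) (hj : 2 ≤ (j : ℕ)) (hk : 2 ≤ (k : ℕ))
    (i : Fin n) (hi : i = ⟨0, by omega⟩ ∨ i = ⟨1, by omega⟩) :
    (∫ y in J, V y * iteratedFDeriv ℝ 2 φ y ![Pi.single i 1, Pi.single j 1]
      = ∫ y in J ∩ {y : Fin n → ℝ | 0 < y ⟨0, by omega⟩ ∧ 0 < y ⟨1, by omega⟩},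
          iteratedFDeriv ℝ 2 U y ![Pi.single i 1, Pi.single j 1] * φ y)
    ∧
    (∫ y in J, V y * iteratedFDeriv ℝ 2 φ y ![Pi.single j 1, Pi.single k 1]
      = ∫ y in J ∩ {y : Fin n → ℝ | 0 < y ⟨0, by omega⟩ ∧ 0 < y ⟨1, by omega⟩},
          iteratedFDeriv ℝ 2 U y ![Pi.single j 1, Pi.single k 1] * φ y) := by
  obtain ⟨N, rfl⟩ : ∃ N, n = N + 1 := ⟨n - 1, by omega⟩
  set z : Fin (N + 1) := ⟨0, by omega⟩ with hz
  set o : Fin (N + 1) := ⟨1, by omega⟩ with ho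
  have hzo : o ≠ z := by simp [hz, ho]
  have hJo : IsOpen J := by
    have : J = Set.univ.pi fun _ => Set.Ioo (-1 : ℝ) 1 := by
      rw [hJ]; ext y; simp
    rw [this]
    exact isOpen_set_pi Set.finite_univ fun _ _ => isOpen_Ioo
  let a : Fin (N + 1) → ℝ := fun l => if l = z ∨ l = o then 0 else -1
  let b : Fin (N + 1) → ℝ := fun _ => 1
  have ha01 : ∀ l, -1 ≤ a l ∧ a l ≤ 0 := by
    intro l
    by_cases hl : l = z ∨ l = o <;> simp [a, hl]
  have hab : a ≤ b := fun l => by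
    have := (ha01 l).2
    simp only [b]; linarith
  have haz : a z = 0 := by simp [a]
  have hao : a o = 0 := by simp [a]
  have hge : ∀ l : Fin (N + 1), 2 ≤ (l : ℕ) → a l = -1 := by
    intro l hl
    have h1 : l ≠ z := by rintro rfl; simp [hz] at hl
    have h2 : l ≠ o := by rintro rfl; simp [ho] at hl
    simp [a, h1, h2]
  have hset : J ∩ {y : Fin (N + 1) → ℝ | 0 < y z ∧ 0 < y o}
      = Set.univ.pi fun l => Set.Ioo (a l) (b l) := by
    ext y
    simp only [hJ, Set.mem_inter_iff, Set.mem_setOf_eq, Set.mem_pi, Set.mem_univ, true_imp_iff,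
      Set.mem_Ioo]
    constructor
    · rintro ⟨h1, h2, h3⟩ l
      refine ⟨?_, (h1 l).2⟩
      by_cases hl : l = z ∨ l = o
      · rcases hl with rfl | rfl
        · rw [haz]; exact h2
        · rw [hao]; exact h3
      · simp only [a, hl, if_false]; exact (h1 l).1
    · intro h
      refine ⟨fun l => ⟨(ha01 l).1.trans_lt (h l).1, (h l).2⟩, ?_, ?_⟩
      · rw [← haz]; exact (h z).1
      · rw [← hao]; exact (h o).1
  have hae : (J ∩ {y : Fin (N + 1) → ℝ | 0 < y z ∧ 0 < y o} : Set (Fin (N + 1) → ℝ))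
      =ᵐ[volume] Set.Icc a b := by
    rw [hset]
    exact Measure.univ_pi_Ioo_ae_eq_Icc
  have hQ'sub : J ∩ {y : Fin (N + 1) → ℝ | 0 ≤ y z ∧ 0 ≤ y o} ⊆ Set.Icc a b := by
    rintro y ⟨h1, h2, h3⟩
    rw [hJ] at h1
    refine ⟨fun l => ?_, fun l => (h1 l).2.le⟩
    by_cases hl : l = z ∨ l = o
    · rcases hl with rfl | rfl
      · rw [haz]; exact h2
      · rw [hao]; exact h3
    · simp only [a, hl, if_false]; exact (h1 l).1.le
  have hae' : (J ∩ {y : Fin (N + 1) → ℝ | 0 ≤ y z ∧ 0 ≤ y o} : Set (Fin (N + 1) → ℝ))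
      =ᵐ[volume] Set.Icc a b := by
    refine (HasSubset.Subset.eventuallyLE hQ'sub).antisymm (hae.symm.le.trans ?_)
    refine HasSubset.Subset.eventuallyLE ?_
    rintro y ⟨h1, h2, h3⟩
    exact ⟨h1, h2.le, h3.le⟩
  have hQm : MeasurableSet {y : Fin (N + 1) → ℝ | 0 ≤ y z ∧ 0 ≤ y o} :=
    (measurableSet_le measurable_const (measurable_pi_apply z)).inter
      (measurableSet_le measurable_const (measurable_pi_apply o))
  have hVint : ∀ ψ : (Fin (N + 1) → ℝ) → ℝ,
      ∫ y in J, V y * ψ y = ∫ y in Set.Icc a b, U y * ψ y := by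
    intro ψ
    rw [← setIntegral_congr_set hae', ← setIntegral_indicator hQm]
    congr 1
    funext y
    rw [hV]
    by_cases h1 : 0 ≤ y z <;> by_cases h2 : 0 ≤ y o <;> simp [Heaviside, Set.indicator, h1, h2]
  have main : ∀ p q : Fin (N + 1), 2 ≤ (q : ℕ) →
      ∫ y in J, V y * iteratedFDeriv ℝ 2 φ y ![Pi.single p 1, Pi.single q 1]
      = ∫ y in J ∩ {y : Fin (N + 1) → ℝ | 0 < y z ∧ 0 < y o},
          iteratedFDeriv ℝ 2 U y ![Pi.single p 1, Pi.single q 1] * φ y := by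
    intro p q hq
    rw [hVint, setIntegral_congr_set hae]
    refine hp_ibp2 a b hab p q hJo hU (by exact_mod_cast contDiff_infty.1 hφ 2) hφs ?_ ?_
    · intro y hy hyJ hyp
      have hyJ' := hyJ
      rw [hJ] at hyJ'
      have hyp' : y p = a p := by
        rcases hyp with h | h
        · exact h
        · exact absurd h (hyJ' p).2.ne
      by_cases hl : p = z ∨ p = o
      · rcases hl with rfl | rfl
        · exact hU1 y hyJ (hyp'.trans haz) (hao ▸ hy.1 o)
        · exact hU2 y hyJ (hyp'.trans hao) (haz ▸ hy.1 z)
      · simp only [a, hl, if_false] at hyp'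
        exact absurd hyp' (hyJ' p).1.ne'
    · intro y hyJ
      rw [hJ] at hyJ
      rw [hge q hq]
      exact ⟨(hyJ q).1.ne', (hyJ q).2.ne⟩
  exact ⟨main i j hj, main j k hk⟩
end

section
/- Let n ≥ 2, J = (−1,1)ⁿ with coordinates y = (y₁, y₂, y₃), y₃ ∈ ℝ^{n−2}. Let U : J → ℝ be C² with U(0, y₂, y₃) = 0 whenever y₂ ≥ 0 and U(y₁, 0, y₃) = 0 whenever y₁ ≥ 0, and set V(y) = H(y₁)H(y₂)U(y), where H = 1_{[0,∞)}. Let B(y) = (β_{jk}(y))_{1≤j,k≤n} be a real symmetric matrix-valued C¹ function on J with β₁₁ ≡ 0 and β₂₂ ≡ 0. Then the distribution ⟨B(y)∂_y, ∂_y⟩V = ∑_{j,k} ∂_j(β_{jk} ∂_k V) − ∑_{j,k}(∂_jβ_{jk}) ∂_k V equals the locally bounded function H(y₁)H(y₂) ∑_{j,k} β_{jk}(y) (∂²U/∂y_j∂y_k)(y); explicitly, for every smooth compactly supported test function φ on J: −∑_{j,k=1}^n ∫_{J ∩ {y₁>0, y₂>0}} (∂U/∂y_k)(y) ∂_j(β_{jk}φ)(y)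 dy − ∑_{j,k=1}^n ∫_{J ∩ {y₁>0, y₂>0}} (∂_jβ_{jk})(y)(∂U/∂y_k)(y) φ(y) dy · 0 = ∫_{J ∩ {y₁>0, y₂>0}} (∑_{j,k} β_{jk} ∂_j∂_k U)(y) φ(y) dy, where the left-hand side is understood as the pairing ⟨∑_{j,k}β_{jk}∂_j∂_k V, φ⟩ computed using that ∂_kV = H(y₁)H(y₂)∂_kU in the sense of distributions. Moreover ∇V = H(y₁)H(y₂)∇U as locally bounded functions. -/
open MeasureTheory

/-- Product of a function that is `C^k` on an open set and a `C^k` function supported there. -/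
lemma aux_contDiff_mul {n : ℕ} {J : Set (Fin n → ℝ)} (hJo : IsOpen J) {k : WithTop ℕ∞}
    {f g : (Fin n → ℝ) → ℝ} (hf : ContDiffOn ℝ k f J) (hg : ContDiff ℝ k g)
    (hs : tsupport g ⊆ J) : ContDiff ℝ k (fun y => f y * g y) := by
  rw [contDiff_iff_contDiffAt]
  intro y
  by_cases hy : y ∈ J
  · exact (hf.contDiffAt (hJo.mem_nhds hy)).mul hg.contDiffAt
  · have h1 : g =ᶠ[nhds y] 0 := notMem_tsupport_iff_eventuallyEq.1 (fun h => hy (hs h))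
    have h2 : (fun y => f y * g y) =ᶠ[nhds y] fun _ => (0 : ℝ) := by
      filter_upwards [h1] with z hz
      simp [hz]
    exact contDiffAt_const.congr_of_eventuallyEq h2

lemma aux_tsupport_mul {n : ℕ} (f g : (Fin n → ℝ) → ℝ) :
    tsupport (fun y => f y * g y) ⊆ tsupport g :=
  tsupport_mul_subset_right

/-- Integral of a derivative over an orthant. -/
lemma aux_integral_zero {m : ℕ} (S : Finset (Fin (m + 1))) (j : Fin (m + 1))
    (w : (Fin (m + 1) → ℝ) → ℝ) (hw : ContDiff ℝ 1 w) (hc : HasCompactSupport w)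
    (h0 : j ∈ S → ∀ y : Fin (m + 1) → ℝ, y j = 0 → (∀ i ∈ S, i ≠ j → 0 < y i) → w y = 0) :
    ∫ y in {y : Fin (m + 1) → ℝ | ∀ i ∈ S, 0 < y i}, fderiv ℝ w y (Pi.single j 1) = 0 := by
  have hQm : MeasurableSet {y : Fin (m + 1) → ℝ | ∀ i ∈ S, 0 < y i} := by
    have : {y : Fin (m + 1) → ℝ | ∀ i ∈ S, 0 < y i} = ⋂ i ∈ S, {y | 0 < y i} := by
      ext; simp
    rw [this]
    exact Finset.measurableSet_biInter _
      (fun i _ => measurableSet_lt measurable_const (measurable_pi_apply i))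
  set Q := {y : Fin (m + 1) → ℝ | ∀ i ∈ S, 0 < y i} with hQ
  have hcont : Continuous (fun y => fderiv ℝ w y (Pi.single j 1)) :=
    (hw.continuous_fderiv (by norm_num)).clm_apply continuous_const
  have hcs : HasCompactSupport (fun y => fderiv ℝ w y (Pi.single j 1)) :=
    hc.fderiv_apply (𝕜 := ℝ) _
  have hint : Integrable (fun y => fderiv ℝ w y (Pi.single j 1)) :=
    hcont.integrable_of_hasCompactSupport hcs
  rw [← integral_indicator hQm]
  have hi : Integrable (Q.indicator fun y => fderiv ℝ w y (Pi.single j 1)) :=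
    hint.indicator hQm
  have mp := (volume_preserving_piFinSuccAbove (fun _ : Fin (m + 1) => ℝ) j).symm
  rw [← mp.integral_comp (MeasurableEquiv.measurableEmbedding _)]
  have hi2 := (mp.integrable_comp_emb (MeasurableEquiv.measurableEmbedding _)).2 hi
  rw [Measure.volume_eq_prod, integral_prod_symm
    (fun x => Q.indicator (fun y => fderiv ℝ w y (Pi.single j 1))
      ((MeasurableEquiv.piFinSuccAbove (fun _ => ℝ) j).symm x)) hi2]
  rw [← integral_zero (Fin m → ℝ) ℝ]
  congr 1
  ext z
  -- the line
  have hder : ∀ t : ℝ, HasDerivAt (fun t : ℝ => w (j.insertNth t z))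
      (fderiv ℝ w (j.insertNth t z) (Pi.single j 1)) t := by
    intro t
    have hl : HasDerivAt (fun t : ℝ => (j.insertNth t z : Fin (m + 1) → ℝ)) (Pi.single j 1) t := by
      rw [hasDerivAt_pi]
      intro i
      refine Fin.succAboveCases j ?_ (fun i => ?_) i
      · simpa using hasDerivAt_id' t
      · simpa using hasDerivAt_const t (z i)
    exact ((hw.differentiable (by norm_num)) _).hasFDerivAt.comp_hasDerivAt t hl
  have hemb : Topology.IsClosedEmbedding (fun t : ℝ => (j.insertNth t z : Fin (m + 1) → ℝ)) := by
    have hl : Function.LeftInverse (fun y : Fin (m + 1) → ℝ => y j)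
      (fun t : ℝ => (j.insertNth t z : Fin (m + 1) → ℝ)) := fun t => by simp
    refine hl.isClosedEmbedding (continuous_apply j) ?_
    fun_prop
  have hc1 : HasCompactSupport (fun t : ℝ => w (j.insertNth t z)) :=
    hc.comp_isClosedEmbedding hemb
  have hd1 : ContDiff ℝ 1 (fun t : ℝ => w (j.insertNth t z)) := by
    refine hw.comp ?_
    rw [contDiff_pi]
    intro i
    refine Fin.succAboveCases j ?_ (fun i => ?_) i
    · simp only [Fin.insertNth_apply_same]; exact contDiff_id
    · simpa using contDiff_const
  have hval : ∀ t : ℝ, (MeasurableEquiv.piFinSuccAbove (fun _ : Fin (m + 1) => ℝ) j).symm (t, z)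
      = j.insertNth t z := fun t => rfl
  simp only [hval, Set.indicator]
  have hmem : ∀ t : ℝ, ((j.insertNth t z : Fin (m + 1) → ℝ) ∈ Q) ↔
      ((j ∈ S → 0 < t) ∧ ∀ i, j.succAbove i ∈ S → 0 < z i) := by
    intro t
    simp only [hQ, Set.mem_setOf_eq]
    rw [Fin.forall_iff_succAbove j]
    simp
  simp only [hmem]
  by_cases hz : ∀ i, j.succAbove i ∈ S → 0 < z i
  · by_cases hj : j ∈ S
    · have e : ∀ t : ℝ, (if ((j ∈ S → 0 < t) ∧ ∀ i, j.succAbove i ∈ S → 0 < z i) then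
          fderiv ℝ w (j.insertNth t z) (Pi.single j 1) else 0) =
          (Set.Ioi (0:ℝ)).indicator (deriv (fun t : ℝ => w (j.insertNth t z))) t := by
        intro t
        rw [(hder t).deriv.symm]
        simp only [Set.indicator, Set.mem_Ioi]
        by_cases ht : 0 < t
        · rw [if_pos ⟨fun _ => ht, hz⟩, if_pos ht]
        · rw [if_neg (fun h => ht (h.1 hj)), if_neg ht]
      simp only [e]
      rw [integral_indicator measurableSet_Ioi, hc1.integral_Ioi_deriv_eq hd1 0]
      rw [h0 hj]
      · simp
      · simp
      · intro i hi hij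
        obtain ⟨i, rfl⟩ := Fin.exists_succAbove_eq hij
        simpa using hz i hi
    · have e : ∀ t : ℝ, (if ((j ∈ S → 0 < t) ∧ ∀ i, j.succAbove i ∈ S → 0 < z i) then
          fderiv ℝ w (j.insertNth t z) (Pi.single j 1) else 0) =
          (deriv (fun t : ℝ => w (j.insertNth t z))) t := by
        intro t
        rw [(hder t).deriv.symm, if_pos ⟨fun h => absurd h hj, hz⟩]
      simp only [e]
      exact integral_eq_zero_of_hasDerivAt_of_integrable
        (fun t => (hder t).differentiableAt.hasDerivAt)
        ((hd1.continuous_deriv (by norm_num)).integrable_of_hasCompactSupport hc1.deriv)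
        (hd1.continuous.integrable_of_hasCompactSupport hc1)
  · have e : ∀ t : ℝ, (if ((j ∈ S → 0 < t) ∧ ∀ i, j.succAbove i ∈ S → 0 < z i) then
          fderiv ℝ w (j.insertNth t z) (Pi.single j 1) else 0) = 0 := by
      intro t
      rw [if_neg (fun h => hz h.2)]
    simp only [e, integral_zero]

/-- Integration by parts on `J ∩ Q`. -/
lemma aux_ibp {n : ℕ} {J : Set (Fin n → ℝ)} (hJo : IsOpen J) (a b : Fin n) (j : Fin n)
    (f g : (Fin n → ℝ) → ℝ) (hf : ContDiffOn ℝ 1 f J) (hg : ContDiff ℝ 1 g)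
    (hgc : HasCompactSupport g) (hs : tsupport g ⊆ J)
    (ha : j = a → ∀ y ∈ J, y a = 0 → (a ≠ b → 0 < y b) → f y * g y = 0)
    (hb : j = b → ∀ y ∈ J, y b = 0 → (a ≠ b → 0 < y a) → f y * g y = 0) :
    IntegrableOn (fun y => fderiv ℝ f y (Pi.single j 1) * g y) (J ∩ {y | 0 < y a ∧ 0 < y b}) ∧
    ∫ y in J ∩ {y | 0 < y a ∧ 0 < y b}, f y * fderiv ℝ g y (Pi.single j 1) =
      - ∫ y in J ∩ {y | 0 < y a ∧ 0 < y b}, fderiv ℝ f y (Pi.single j 1) * g y := by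
  have hsg' : tsupport (fun y => fderiv ℝ g y (Pi.single j 1)) ⊆ tsupport g :=
    tsupport_fderiv_apply_subset ℝ _
  have hgz : ∀ y, y ∉ J → g y = 0 := fun y hy => image_eq_zero_of_notMem_tsupport (fun h => hy (hs h))
  have hw := aux_contDiff_mul hJo hf hg hs
  have hwc : HasCompactSupport (fun y => f y * g y) := hgc.mul_left
  have hI1 : Integrable (fun y => fderiv ℝ f y (Pi.single j 1) * g y) := by
    refine Continuous.integrable_of_hasCompactSupport ?_ hgc.mul_left
    rw [← contDiff_zero (𝕜 := ℝ)]
    refine aux_contDiff_mul hJo ?_ (hg.of_le (by norm_num)) hs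
    rw [contDiffOn_zero]
    exact (hf.continuousOn_fderiv_of_isOpen hJo (by norm_num)).clm_apply continuousOn_const
  have hI2 : Integrable (fun y => f y * fderiv ℝ g y (Pi.single j 1)) := by
    refine Continuous.integrable_of_hasCompactSupport ?_ (hgc.fderiv_apply (𝕜 := ℝ) _).mul_left
    rw [← contDiff_zero (𝕜 := ℝ)]
    refine aux_contDiff_mul hJo (hf.of_le (by norm_num)) ?_ (hsg'.trans hs)
    rw [contDiff_zero]
    exact (hg.continuous_fderiv (by norm_num)).clm_apply continuous_const
  refine ⟨hI1.integrableOn, ?_⟩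
  rw [eq_neg_iff_add_eq_zero, ← integral_add hI2.integrableOn hI1.integrableOn]
  have hQm : MeasurableSet {y : Fin n → ℝ | 0 < y a ∧ 0 < y b} :=
    (measurableSet_lt measurable_const (measurable_pi_apply a)).inter
      (measurableSet_lt measurable_const (measurable_pi_apply b))
  have e1 : ∫ y in J ∩ {y | 0 < y a ∧ 0 < y b},
        (f y * fderiv ℝ g y (Pi.single j 1) + fderiv ℝ f y (Pi.single j 1) * g y) =
      ∫ y in J ∩ {y | 0 < y a ∧ 0 < y b}, fderiv ℝ (fun y => f y * g y) y (Pi.single j 1) := by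
    refine setIntegral_congr_fun (hJo.measurableSet.inter hQm) ?_
    intro y hy
    have hfd : DifferentiableAt ℝ f y :=
      (hf.contDiffAt (hJo.mem_nhds hy.1)).differentiableAt (by norm_num)
    have hgd : DifferentiableAt ℝ g y := hg.differentiable (by norm_num) y
    simp only [fderiv_fun_mul hfd hgd]
    simp
    ring
  rw [e1]
  have e2 : ∫ y in J ∩ {y | 0 < y a ∧ 0 < y b}, fderiv ℝ (fun y => f y * g y) y (Pi.single j 1) =
      ∫ y in {y | 0 < y a ∧ 0 < y b}, fderiv ℝ (fun y => f y * g y) y (Pi.single j 1) := by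
    symm
    refine setIntegral_eq_of_subset_of_forall_sdiff_eq_zero hQm Set.inter_subset_right ?_
    intro y hy
    have hyJ : y ∉ J := fun h => hy.2 ⟨h, hy.1⟩
    refine image_eq_zero_of_notMem_tsupport (f := fun y => fderiv ℝ (fun y => f y * g y) y (Pi.single j 1)) ?_
    intro h
    exact hyJ (hs (aux_tsupport_mul f g (tsupport_fderiv_apply_subset ℝ _ h)))
  rw [e2]
  obtain ⟨m, rfl⟩ : ∃ m, n = m + 1 := ⟨n - 1, by have := a.2; omega⟩
  have hQ : {y : Fin (m + 1) → ℝ | 0 < y a ∧ 0 < y b} =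
      {y | ∀ i ∈ ({a, b} : Finset (Fin (m + 1))), 0 < y i} := by
    ext y; simp
  rw [hQ]
  refine aux_integral_zero {a, b} j _ hw hwc ?_
  intro hj y hy hpos
  by_cases hyJ : y ∈ J
  · simp only [Finset.mem_insert, Finset.mem_singleton] at hj
    rcases hj with rfl | rfl
    · exact ha rfl y hyJ hy (fun hab => hpos b (by simp) (Ne.symm hab))
    · exact hb rfl y hyJ hy (fun hab => hpos a (by simp) hab)
  · simp [hgz y hyJ]

/-- Tangential derivative vanishes. -/
lemma aux_tangential {n : ℕ} {J : Set (Fin n → ℝ)} (hJo : IsOpen J) (a b : Fin n) (hab : a ≠ b)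
    (U : (Fin n → ℝ) → ℝ) (hU : ContDiffOn ℝ 2 U J)
    (h : ∀ y ∈ J, y a = 0 → 0 ≤ y b → U y = 0) (k : Fin n) (hk : k ≠ a)
    (y : Fin n → ℝ) (hy : y ∈ J) (hya : y a = 0) (hyb : 0 < y b) :
    fderiv ℝ U y (Pi.single k 1) = 0 := by
  have hd : DifferentiableAt ℝ U y :=
    (hU.contDiffAt (hJo.mem_nhds hy)).differentiableAt (by norm_num)
  rw [← hd.lineDeriv_eq_fderiv, lineDeriv]
  have hc : Continuous (fun t : ℝ => y + t • (Pi.single k 1 : Fin n → ℝ)) := by fun_prop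
  have h1 : ∀ᶠ t : ℝ in nhds 0, y + t • (Pi.single k 1 : Fin n → ℝ) ∈ J := by
    apply hc.continuousAt.eventually_mem
    simpa using hJo.mem_nhds hy
  have h2 : ∀ᶠ t : ℝ in nhds 0, 0 < (y + t • (Pi.single k 1 : Fin n → ℝ)) b := by
    have hc2 : Continuous (fun t : ℝ => (y + t • (Pi.single k 1 : Fin n → ℝ)) b) :=
      (continuous_apply b).comp hc
    refine hc2.continuousAt.eventually (lt_mem_nhds ?_)
    simpa using hyb
  have h3 : (fun t : ℝ => U (y + t • (Pi.single k 1 : Fin n → ℝ))) =ᶠ[nhds 0] fun _ => 0 := by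
    filter_upwards [h1, h2] with t ht1 ht2
    refine h _ ht1 ?_ ht2.le
    simp [hya, Pi.single_apply, hk.symm]
  rw [h3.deriv_eq]
  simp

/-- **Lemma 2 of the paper**: for `U ∈ C²((-1,1)ⁿ)` vanishing on the two faces,
`V = H(y₁)H(y₂)U`, and a symmetric `C¹` matrix `B = (β_{jk})` with `β₁₁ ≡ β₂₂ ≡ 0`,
the distribution `⟨B(y)∂_y,∂_y⟩V` equals the locally bounded function
`H(y₁)H(y₂)⟨B(y)∂_y,∂_y⟩U`; the pairing `⟨β_{jk}∂_j∂_k V, φ⟩` is computed by one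
integration by parts, using `∂_k V = H(y₁)H(y₂)∂_k U`.  Moreover
`∇V = H(y₁)H(y₂)∇U` (distributionally, tested against `φ`). -/
theorem heaviside_product_second_order_operator
    (n : ℕ) (hn : 2 ≤ n)
    (J : Set (Fin n → ℝ))
    (hJ : J = {y : Fin n → ℝ | ∀ i, y i ∈ Set.Ioo (-1 : ℝ) 1})
    (U : (Fin n → ℝ) → ℝ)
    (hU : ContDiffOn ℝ 2 U J)
    (hU1 : ∀ y ∈ J, y ⟨0, by omega⟩ = 0 → 0 ≤ y ⟨1, by omega⟩ → U y = 0)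
    (hU2 : ∀ y ∈ J, y ⟨1, by omega⟩ = 0 → 0 ≤ y ⟨0, by omega⟩ → U y = 0)
    (V : (Fin n → ℝ) → ℝ)
    (hV : V = fun y => Heaviside (y ⟨0, by omega⟩) * Heaviside (y ⟨1, by omega⟩) * U y)
    (B : (Fin n → ℝ) → Fin n → Fin n → ℝ)
    (hB : ContDiffOn ℝ 1 B J)
    (hBsym : ∀ y ∈ J, ∀ j k, B y j k = B y k j)
    (hB11 : ∀ y ∈ J, B y ⟨0, by omega⟩ ⟨0, by omega⟩ = 0)
    (hB22 : ∀ y ∈ J, B y ⟨1, by omega⟩ ⟨1, by omega⟩ = 0)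
    (φ : (Fin n → ℝ) → ℝ)
    (hφ : ContDiff ℝ (⊤ : ℕ∞) φ) (hφc : HasCompactSupport φ) (hφs : tsupport φ ⊆ J) :
    ((- ∑ j, ∑ k, ∫ y in J ∩ {y : Fin n → ℝ | 0 < y ⟨0, by omega⟩ ∧ 0 < y ⟨1, by omega⟩},
          fderiv ℝ U y (Pi.single k 1) * fderiv ℝ (fun z => B z j k * φ z) y (Pi.single j 1))
      - (∑ j, ∑ k, ∫ y in J ∩ {y : Fin n → ℝ | 0 < y ⟨0, by omega⟩ ∧ 0 < y ⟨1, by omega⟩},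
          fderiv ℝ (fun z => B z j k) y (Pi.single j 1) * fderiv ℝ U y (Pi.single k 1) * φ y) * 0
      = ∫ y in J ∩ {y : Fin n → ℝ | 0 < y ⟨0, by omega⟩ ∧ 0 < y ⟨1, by omega⟩},
          (∑ j, ∑ k, B y j k * iteratedFDeriv ℝ 2 U y ![Pi.single j 1, Pi.single k 1]) * φ y)
    ∧
    (∀ k : Fin n, ∫ y in J, V y * fderiv ℝ φ y (Pi.single k 1)
      = - ∫ y in J ∩ {y : Fin n → ℝ | 0 < y ⟨0, by omega⟩ ∧ 0 < y ⟨1, by omega⟩},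
            fderiv ℝ U y (Pi.single k 1) * φ y) := by
  have hJo : IsOpen J := by
    rw [hJ]
    have : {y : Fin n → ℝ | ∀ i, y i ∈ Set.Ioo (-1 : ℝ) 1} = ⋂ i, {y | y i ∈ Set.Ioo (-1 : ℝ) 1} := by
      ext; simp
    rw [this]
    exact isOpen_iInter_of_finite (fun i => isOpen_Ioo.preimage (continuous_apply i))
  clear hJ
  generalize ha : (⟨0, by omega⟩ : Fin n) = a at *
  generalize hb : (⟨1, by omega⟩ : Fin n) = b at *
  have hab : a ≠ b := by
    rw [← ha, ← hb]; simp [Fin.ext_iff]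
  have hφ1 : ContDiff ℝ 1 φ := hφ.of_le (by exact_mod_cast le_top)
  have hQm : MeasurableSet {y : Fin n → ℝ | 0 < y a ∧ 0 < y b} :=
    (measurableSet_lt measurable_const (measurable_pi_apply a)).inter
      (measurableSet_lt measurable_const (measurable_pi_apply b))
  refine ⟨?_, ?_⟩
  · rw [mul_zero, sub_zero]
    have hBjk : ∀ j k, ContDiffOn ℝ 1 (fun z => B z j k) J := by
      intro j k
      exact contDiffOn_pi.1 (contDiffOn_pi.1 hB j) k
    have hg : ∀ j k, ContDiff ℝ 1 (fun z => B z j k * φ z) :=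
      fun j k => aux_contDiff_mul hJo (hBjk j k) hφ1 hφs
    have hf : ∀ k, ContDiffOn ℝ 1 (fun y => fderiv ℝ U y (Pi.single k 1)) J := by
      intro k
      exact (hU.fderiv_of_isOpen hJo (by norm_num)).clm_apply contDiffOn_const
    have key := fun j k => aux_ibp hJo a b j _ _ (hf k) (hg j k) hφc.mul_left
      ((aux_tsupport_mul _ _).trans hφs)
      (by
        rintro rfl y hy hy0 hpos
        by_cases hk : k = j
        · subst hk; simp [hB11 y hy]
        · rw [aux_tangential hJo j b hab U hU hU1 k hk y hy hy0 (hpos hab), zero_mul])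
      (by
        rintro rfl y hy hy0 hpos
        by_cases hk : k = j
        · subst hk; simp [hB22 y hy]
        · rw [aux_tangential hJo j a hab.symm U hU hU2 k hk y hy hy0 (hpos hab), zero_mul])
    have e : ∫ y in J ∩ {y : Fin n → ℝ | 0 < y a ∧ 0 < y b},
          (∑ j, ∑ k, B y j k * iteratedFDeriv ℝ 2 U y ![Pi.single j 1, Pi.single k 1]) * φ y =
        ∫ y in J ∩ {y : Fin n → ℝ | 0 < y a ∧ 0 < y b}, ∑ j, ∑ k,
          fderiv ℝ (fun y => fderiv ℝ U y (Pi.single k 1)) y (Pi.single j 1) * (B y j k * φ y) := by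
      refine setIntegral_congr_fun (hJo.measurableSet.inter hQm) ?_
      intro y hy
      have hd : DifferentiableAt ℝ (fderiv ℝ U) y :=
        ((hU.fderiv_of_isOpen (m := 1) hJo (by norm_num)).contDiffAt
          (hJo.mem_nhds hy.1)).differentiableAt (by norm_num)
      simp only [Finset.sum_mul]
      refine Finset.sum_congr rfl fun j _ => Finset.sum_congr rfl fun k _ => ?_
      rw [iteratedFDeriv_two_apply, fderiv_clm_apply hd (differentiableAt_const _)]
      simp
      ring
    rw [e, integral_finsetSum _ (fun j _ => integrable_finsetSum _ (fun k _ => (key j k).1)),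
      ← Finset.sum_neg_distrib]
    refine Finset.sum_congr rfl fun j _ => ?_
    rw [integral_finsetSum _ (fun k _ => (key j k).1), ← Finset.sum_neg_distrib]
    refine Finset.sum_congr rfl fun k _ => ?_
    rw [(key j k).2, neg_neg]
  · intro k
    have key := aux_ibp hJo a b k U φ (hU.of_le (by norm_num)) hφ1 hφc hφs
      (by
        rintro rfl y hy hy0 hpos
        rw [hU1 y hy hy0 (hpos hab).le, zero_mul])
      (by
        rintro rfl y hy hy0 hpos
        rw [hU2 y hy hy0 (hpos hab).le, zero_mul])
    rw [← key.2, ← setIntegral_indicator hQm]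
    refine integral_congr_ae (ae_restrict_of_ae ?_)
    have na : ∀ i : Fin n, ∀ᵐ y : Fin n → ℝ, y i ≠ 0 := fun i => by
      exact Measure.ae_eval_ne (fun _ : Fin n => (volume : Measure ℝ)) i 0
    filter_upwards [na a, na b] with y h1 h2
    simp only [hV, Heaviside, Set.indicator, Set.mem_setOf_eq]
    rcases lt_or_gt_of_ne h1 with h1 | h1 <;> rcases lt_or_gt_of_ne h2 with h2 | h2 <;>
      simp [h1, h2, h1.le, h2.le, h1.not_ge, h2.not_ge, h1.not_gt, h2.not_gt]
end
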